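/- The only integer solutions (x₁, y₁) ∈ ℤ² of |x₁⁴ − 9x₁³y₁ − 21x₁²y₁² + 88x₁y₁³ + 48y₁⁴| ≤ 36 are, up to sign, (0,0), (1,0), (1,−2), (2,0), (2,−4). -/

import Mathlib

open Finset in
theorem sum_degree_ge {ι : Type*} [Fintype ι] (N : ℕ) (hN : Fintype.card ι = N)
    (F : ι → Option (Fin N)) (hF : ∀ c c' m, F c = some m → F c' = some m → c = c') :
    ∑ j ∈ range N, j ≤ ∑ c, (F c).elim N (fun m => (m : ℕ)) := by
  classical
  set A := univ.filter (fun c => (F c).isSome) with hA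
  set T : Finset ℕ := A.image (fun c => (F c).elim N (fun m => (m : ℕ))) with hT
  have hinj : Set.InjOn (fun c => (F c).elim N (fun m => (m : ℕ))) A := by
    intro c hc c' hc' h
    simp only [hA, coe_filter, mem_univ, true_and, Set.mem_ofPred_eq] at hc hc'
    obtain ⟨m, hm⟩ := Option.isSome_iff_exists.1 hc
    obtain ⟨m', hm'⟩ := Option.isSome_iff_exists.1 hc'
    simp only [hm, hm', Option.elim] at h
    have : m = m' := Fin.ext h
    subst this
    exact hF c c' m hm hm'
  have hTsub : T ⊆ range N := by
    intro t ht
    simp only [hT, mem_image, hA, mem_filter, mem_univ, true_and] at ht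
    obtain ⟨c, hc, rfl⟩ := ht
    obtain ⟨m, hm⟩ := Option.isSome_iff_exists.1 hc
    simp [hm]
  have hcard : T.card = A.card := card_image_of_injOn hinj
  have h1 : ∑ j ∈ range N, j = ∑ j ∈ T, j + ∑ j ∈ range N \ T, j := by
    rw [add_comm, sum_sdiff hTsub]
  have h2 : ∑ j ∈ range N \ T, j ≤ (range N \ T).card * N := by
    rw [← smul_eq_mul]
    apply sum_le_card_nsmul
    intro j hj
    simp only [mem_sdiff, mem_range] at hj
    omega
  have h3 : (range N \ T).card = (univ.filter (fun c => ¬ (F c).isSome)).card := by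
    rw [card_sdiff_of_subset hTsub, hcard, card_range]
    have := card_filter_add_card_filter_not (s := (univ : Finset ι)) (fun c => (F c).isSome)
    rw [card_univ, hN, ← hA] at this
    omega
  have h4 : ∑ c, (F c).elim N (fun m => (m : ℕ)) = ∑ c ∈ A, (F c).elim N (fun m => (m : ℕ)) +
      ∑ c ∈ univ.filter (fun c => ¬ (F c).isSome), (F c).elim N (fun m => (m : ℕ)) :=
    (sum_filter_add_sum_filter_not _ _ _).symm
  have h5 : ∑ c ∈ A, (F c).elim N (fun m => (m : ℕ)) = ∑ j ∈ T, j := by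
    rw [hT, sum_image hinj]
  have h6 : ∑ c ∈ univ.filter (fun c => ¬ (F c).isSome), (F c).elim N (fun m => (m : ℕ)) =
      (univ.filter (fun c => ¬ (F c).isSome)).card * N := by
    rw [← smul_eq_mul]
    apply sum_eq_card_nsmul
    intro c hc
    simp only [mem_filter, mem_univ, true_and, Bool.not_eq_true, Option.isSome_eq_false_iff,
      Option.isNone_iff_eq_none] at hc
    simp [hc]
  rw [h3] at h2
  omega

/-- Upper bound for an interpolation determinant whose rows are Taylor sections plus small errors. -/
theorem abs_det_interpolation_le {ι : Type*} [Fintype ι] [DecidableEq ι] (N : ℕ)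
    (hN : Fintype.card ι = N) (a : ι → Fin N → ℝ) (b : ι → ι → ℝ) (x : ι → ℝ) (V ρ : ℝ)
    (hρ : 1 ≤ ρ)
    (ha : ∀ c m μ, |a c m * x μ ^ (m : ℕ)| * ρ ^ (m : ℕ) ≤ V)
    (hb : ∀ c μ, |b c μ| * ρ ^ N ≤ V) :
    |(Matrix.of fun c μ => ∑ m, a c m * x μ ^ (m : ℕ) + b c μ).det| * ρ ^ (∑ j ∈ Finset.range N, j) ≤
      (N + 1 : ℝ) ^ N * (N.factorial * V ^ N) := by
  have hρ0 : 0 < ρ := by linarith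
  let T : ι → Option (Fin N) → ι → ℝ := fun c o =>
    o.elim (fun μ => b c μ) (fun m μ => a c m * x μ ^ (m : ℕ))
  let dg : Option (Fin N) → ℕ := fun o => o.elim N (fun m => (m : ℕ))
  have hT : ∀ c o μ, |T c o μ| * ρ ^ dg o ≤ V := by
    intro c o μ
    cases o with
    | none => exact hb c μ
    | some m => exact ha c m μ
  have hexp : (Matrix.of fun c μ => ∑ m, a c m * x μ ^ (m : ℕ) + b c μ).det =
      ∑ F : ι → Option (Fin N), (Matrix.of fun c => T c (F c)).det := by
    have := (Matrix.detRowAlternating (n := ι) (R := ℝ)).toMultilinearMap.map_sum T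
    have h2 : (Matrix.of fun c μ => ∑ m, a c m * x μ ^ (m : ℕ) + b c μ) =
        Matrix.of (fun c => ∑ o, T c o) := by
      ext c μ
      simp [T, Fintype.sum_option, add_comm]
    rw [h2]
    exact this
  have hterm : ∀ F : ι → Option (Fin N),
      |(Matrix.of fun c => T c (F c)).det| * ρ ^ (∑ j ∈ Finset.range N, j) ≤ N.factorial * V ^ N := by
    intro F
    by_cases hF : ∀ c c' m, F c = some m → F c' = some m → c = c'
    · have hs := sum_degree_ge N hN F hF
      have hdet : (Matrix.of fun c μ => ρ ^ dg (F c) * T c (F c) μ).det =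
          (∏ c, ρ ^ dg (F c)) * (Matrix.of fun c => T c (F c)).det :=
        Matrix.det_mul_column (fun c => ρ ^ dg (F c)) (Matrix.of fun c => T c (F c))
      have hle := Matrix.det_le (A := Matrix.of fun c μ => ρ ^ dg (F c) * T c (F c) μ)
        (abv := AbsoluteValue.abs) (x := V) (by
          intro c μ
          simp only [Matrix.of_apply, AbsoluteValue.abs_apply, abs_mul]
          rw [abs_of_pos (pow_pos hρ0 _), mul_comm]
          exact hT c (F c) μ)
      rw [hdet, hN, Finset.prod_pow_eq_pow_sum, nsmul_eq_mul] at hle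
      simp only [AbsoluteValue.abs_apply, abs_mul] at hle
      rw [abs_of_pos (pow_pos hρ0 _)] at hle
      refine le_trans ?_ hle
      rw [mul_comm]
      gcongr
    · push Not at hF
      obtain ⟨c, c', m, h1, h2, h3⟩ := hF
      have hV : 0 ≤ V := le_trans (by positivity) (hT c none c)
      have hz : (Matrix.of fun c => T c (F c)).det = 0 := by
        by_cases hc' : a c' m = 0
        · apply Matrix.det_eq_zero_of_row_eq_zero c'
          intro μ
          simp [T, h2, hc']
        · have hupd : Matrix.of (fun d => T d (F d)) =
              (Matrix.of (fun d => T d (F d))).updateRow c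
                ((a c m / a c' m) • (Matrix.of (fun d => T d (F d))) c') := by
            ext d μ
            by_cases hd : d = c
            · subst hd
              simp [T, h1, h2]
              field_simp
            · simp [Matrix.updateRow_ne hd]
          rw [hupd, Matrix.det_updateRow_smul, Matrix.det_updateRow_eq_zero h3.symm, mul_zero]
      rw [hz]
      simp only [abs_zero, zero_mul]
      positivity
  rw [hexp]
  calc _ ≤ (∑ F : ι → Option (Fin N), |(Matrix.of fun c => T c (F c)).det|) *
        ρ ^ (∑ j ∈ Finset.range N, j) := by
        gcongr
        exact Finset.abs_sum_le_sum_abs _ _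
    _ ≤ ∑ F : ι → Option (Fin N), (N.factorial * V ^ N : ℝ) := by
        rw [Finset.sum_mul]
        exact Finset.sum_le_sum fun F _ => hterm F
    _ = _ := by
        simp [hN, Finset.card_univ]

/-- `f` is on `[0, X]` the sum of a power series whose majorant at `U` is at most `v`. -/
def HasMajorant (U X v : ℝ) (f : ℝ → ℝ) : Prop :=
  ∃ a : ℕ → ℝ, (∀ n, ∑ m ∈ Finset.range n, |a m| * U ^ m ≤ v) ∧
    ∀ x, 0 ≤ x → x ≤ X → HasSum (fun m => a m * x ^ m) (f x)

theorem HasMajorant.exp {U : ℝ} (hU : 0 ≤ U) (X t : ℝ) :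
    HasMajorant U X (Real.exp (|t| * U)) (fun x => Real.exp (t * x)) := by
  refine ⟨fun m => t ^ m / m.factorial, fun n => ?_, fun x _ _ => ?_⟩
  · have := Real.sum_le_exp_of_nonneg (x := |t| * U) (by positivity) n
    refine le_trans (le_of_eq ?_) this
    refine Finset.sum_congr rfl fun m _ => ?_
    rw [abs_div, abs_pow, mul_pow, Nat.abs_cast]
    ring
  · have := NormedSpace.expSeries_div_hasSum_exp (𝔸 := ℝ) (t * x)
    rw [← Real.exp_eq_exp_ℝ] at this
    have e : (fun m : ℕ => t ^ m / m.factorial * x ^ m) =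
        fun m : ℕ => (t * x) ^ m / m.factorial := by
      funext m
      rw [mul_pow]
      ring
    rw [e]
    exact this

theorem HasMajorant.linear_mul {U X v : ℝ} {f : ℝ → ℝ} (hU : 0 ≤ U) {i : ℝ} (hi : 0 ≤ i)
    (hf : HasMajorant U X v f) : HasMajorant U X ((U + i) * v) (fun x => (x - i) * f x) := by
  obtain ⟨a, ha, hs⟩ := hf
  have hv : 0 ≤ v := by simpa using ha 0
  let s : ℕ → ℝ := fun m => if m = 0 then 0 else a (m - 1)
  have s0 : s 0 = 0 := by simp [s]
  have s1 : ∀ m, s (m + 1) = a m := fun m => by simp [s]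
  refine ⟨fun m => s m - i * a m, fun n => ?_, fun x h0 h1 => ?_⟩
  · have h1 : ∑ m ∈ Finset.range n, |s m| * U ^ m ≤ U * v := by
      cases n with
      | zero => simp; positivity
      | succ n =>
        rw [Finset.sum_range_succ']
        simp only [s0, s1, abs_zero, zero_mul, add_zero]
        calc _ = U * ∑ m ∈ Finset.range n, |a m| * U ^ m := by
              rw [Finset.mul_sum]
              refine Finset.sum_congr rfl fun m _ => ?_
              ring
          _ ≤ _ := by gcongr; exact ha n
    have h2 := ha n
    calc _ ≤ ∑ m ∈ Finset.range n, (|s m| * U ^ m + i * (|a m| * U ^ m)) := by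
          refine Finset.sum_le_sum fun m _ => ?_
          have : |s m - i * a m| ≤ |s m| + i * |a m| := by
            refine (abs_sub _ _).trans ?_
            rw [abs_mul, abs_of_nonneg hi]
          calc _ ≤ (|s m| + i * |a m|) * U ^ m := by gcongr
            _ = _ := by ring
      _ = ∑ m ∈ Finset.range n, |s m| * U ^ m + i * ∑ m ∈ Finset.range n, |a m| * U ^ m := by
          rw [Finset.sum_add_distrib, Finset.mul_sum]
      _ ≤ U * v + i * v := by gcongr
      _ = _ := by ring
  · have h := hs x h0 h1
    have hsh : HasSum (fun m => s m * x ^ m) (x * f x) := by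
      have := h.mul_left x
      rw [← hasSum_nat_add_iff' 1]
      simp only [Finset.range_one, Finset.sum_singleton, s0, s1, zero_mul, sub_zero]
      have e : (fun m => a m * x ^ (m + 1)) = fun m => x * (a m * x ^ m) := by
        funext m
        ring
      rw [e]
      exact this
    have := hsh.sub (h.mul_left i)
    simp only [← mul_assoc] at this
    simp only [sub_mul]
    exact this

theorem HasMajorant.const_mul {U X v : ℝ} {f : ℝ → ℝ} {r : ℝ} (hr : 0 ≤ r)
    (hf : HasMajorant U X v f) : HasMajorant U X (r * v) (fun x => r * f x) := by
  obtain ⟨a, ha, hs⟩ := hf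
  refine ⟨fun m => r * a m, fun n => ?_, fun x h0 h1 => ?_⟩
  · have := mul_le_mul_of_nonneg_left (ha n) hr
    rw [Finset.mul_sum] at this
    refine le_trans (le_of_eq (Finset.sum_congr rfl fun m _ => ?_)) this
    rw [abs_mul, abs_of_nonneg hr]
    ring
  · have := (hs x h0 h1).mul_left r
    have e : (fun m => r * a m * x ^ m) = fun m => r * (a m * x ^ m) := by
      funext m
      ring
    rw [e]
    exact this

theorem HasMajorant.prod_sub_mul {U X v : ℝ} {f : ℝ → ℝ} (hU : 0 ≤ U) {K : ℕ}
    (hf : HasMajorant U X v f) (k : ℕ) (hk : k ≤ K) :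
    HasMajorant U X ((U + K) ^ k * v) (fun x => (∏ i ∈ Finset.range k, (x - i)) * f x) := by
  have hv : 0 ≤ v := by obtain ⟨a, ha, -⟩ := hf; simpa using ha 0
  induction k with
  | zero => simpa using hf
  | succ k ih =>
    obtain ⟨a, ha, hs⟩ := (ih (by omega)).linear_mul hU (Nat.cast_nonneg k)
    refine ⟨a, fun n => (ha n).trans ?_, fun x h0 h1 => ?_⟩
    · have : (k : ℝ) ≤ K := by exact_mod_cast (by omega : k ≤ K)
      calc _ ≤ (U + K) * ((U + K) ^ k * v) := by gcongr
        _ = _ := by ring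
    · have := hs x h0 h1
      convert this using 1
      simp only [Finset.prod_range_succ]
      ring

theorem HasMajorant.taylor {X v ρ : ℝ} {f : ℝ → ℝ} (hX : 0 < X) (hρ : 1 ≤ ρ)
    (hf : HasMajorant (ρ * X) X v f) (N : ℕ) :
    ∃ a : ℕ → ℝ, (∀ m, ∀ x, 0 ≤ x → x ≤ X → |a m * x ^ m| * ρ ^ m ≤ v) ∧
      ∀ x, 0 ≤ x → x ≤ X → |f x - ∑ m : Fin N, a m * x ^ (m : ℕ)| * ρ ^ N ≤ v := by
  obtain ⟨a, ha, hs⟩ := hf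
  have hρ0 : 0 < ρ := by linarith
  have hU : 0 < ρ * X := by positivity
  have hsum : Summable (fun m => |a m| * (ρ * X) ^ m) :=
    summable_of_sum_range_le (fun m => by positivity) ha
  refine ⟨a, fun m x h0 h1 => ?_, fun x h0 h1 => ?_⟩
  · have h2 := ha (m + 1)
    have h3 : |a m| * (ρ * X) ^ m ≤ v :=
      (Finset.single_le_sum (f := fun m => |a m| * (ρ * X) ^ m) (fun i _ => by positivity)
        (Finset.self_mem_range_succ m)).trans h2
    refine le_trans ?_ h3
    rw [abs_mul, abs_of_nonneg (pow_nonneg h0 m), mul_pow]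
    calc |a m| * x ^ m * ρ ^ m ≤ |a m| * X ^ m * ρ ^ m := by gcongr
      _ = _ := by ring
  · rw [Fin.sum_univ_eq_sum_range (fun m => a m * x ^ m) N]
    have h := (hasSum_nat_add_iff' N).2 (hs x h0 h1)
    have h2 := h.mul_right (ρ ^ N)
    have hle : ∀ m, |a (m + N) * x ^ (m + N) * ρ ^ N| ≤ |a (m + N)| * (ρ * X) ^ (m + N) := by
      intro m
      rw [abs_mul, abs_mul, abs_of_nonneg (pow_nonneg h0 _), abs_of_nonneg (pow_nonneg hρ0.le _),
        mul_pow]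
      calc _ ≤ |a (m + N)| * X ^ (m + N) * ρ ^ (m + N) := by
            gcongr
            omega
        _ = _ := by ring
    have hsum' : Summable (fun m => |a (m + N)| * (ρ * X) ^ (m + N)) :=
      (summable_nat_add_iff N).2 hsum
    have hb : |(f x - ∑ m ∈ Finset.range N, a m * x ^ m) * ρ ^ N| ≤
        ∑' m, |a (m + N)| * (ρ * X) ^ (m + N) := by
      have := tsum_of_norm_bounded hsum'.hasSum (fun m => by
        rw [Real.norm_eq_abs]; exact hle m)
      rwa [h2.tsum_eq, Real.norm_eq_abs] at this
    rw [abs_mul, abs_of_nonneg (pow_nonneg hρ0.le N)] at hb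
    refine hb.trans ?_
    have h3 : ∑' m, |a m| * (ρ * X) ^ m ≤ v :=
      Real.tsum_le_of_sum_range_le (fun m => by positivity) ha
    have h4 := hsum.sum_add_tsum_nat_add N
    have h5 : 0 ≤ ∑ m ∈ Finset.range N, |a m| * (ρ * X) ^ m :=
      Finset.sum_nonneg fun m _ => by positivity
    linarith

theorem taylor_choose_mul_exp {X ρ : ℝ} (hX : 0 < X) (hρ : 1 ≤ ρ) (N K k : ℕ) (hk : k ≤ K)
    (t : ℝ) :
    ∃ a : ℕ → ℝ,
      (∀ m, ∀ x : ℝ, 0 ≤ x → x ≤ X → |a m * x ^ m| * ρ ^ m ≤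
        (ρ * X + K) ^ k / k.factorial * Real.exp (|t| * (ρ * X))) ∧
      ∀ x : ℕ, (x : ℝ) ≤ X → |x.choose k * Real.exp (t * x) - ∑ m : Fin N, a m * (x : ℝ) ^ (m : ℕ)|
        * ρ ^ N ≤ (ρ * X + K) ^ k / k.factorial * Real.exp (|t| * (ρ * X)) := by
  have hU : 0 ≤ ρ * X := by positivity
  have h := (((HasMajorant.exp hU X t).prod_sub_mul hU k hk).const_mul
    (r := 1 / k.factorial) (by positivity)).taylor hX hρ N
  obtain ⟨a, h1, h2⟩ := h
  have e : 1 / (k.factorial : ℝ) * ((ρ * X + K) ^ k * Real.exp (|t| * (ρ * X))) =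
      (ρ * X + K) ^ k / k.factorial * Real.exp (|t| * (ρ * X)) := by ring
  rw [e] at h1 h2
  refine ⟨a, h1, fun x hx => ?_⟩
  have := h2 x (Nat.cast_nonneg x) hx
  have e2 : (x.choose k : ℝ) = 1 / k.factorial * ∏ i ∈ Finset.range k, ((x : ℝ) - i) := by
    rw [Nat.cast_choose_eq_descPochhammer_div, descPochhammer_eval_eq_prod_range]
    ring
  rw [e2]
  convert this using 3
  ring

open Polynomial in
theorem coeff_prod_sum_of_natDegree_le {R ι : Type*} [CommSemiring R] [DecidableEq ι]
    (s : Finset ι) (f : ι → R[X]) (d : ι → ℕ) (h : ∀ i ∈ s, (f i).natDegree ≤ d i) :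
    (∏ i ∈ s, f i).coeff (∑ i ∈ s, d i) = ∏ i ∈ s, (f i).coeff (d i) := by
  induction s using Finset.induction_on with
  | empty => simp
  | insert a s ha ih =>
    rw [Finset.prod_insert ha, Finset.sum_insert ha, Finset.prod_insert ha]
    have h1 : (∏ i ∈ s, f i).natDegree ≤ ∑ i ∈ s, d i :=
      (natDegree_prod_le s f).trans
        (Finset.sum_le_sum fun i hi => h i (Finset.mem_insert_of_mem hi))
    rw [coeff_mul_add_eq_of_natDegree_le (h a (Finset.mem_insert_self a s)) h1,
      ih fun i hi => h i (Finset.mem_insert_of_mem hi)]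

open Polynomial in
theorem coeff_det_of_natDegree_le {R : Type*} [CommRing R] {n : ℕ}
    (M : Matrix (Fin n) (Fin n) R[X]) (d : Fin n → ℕ) (h : ∀ i j, (M i j).natDegree ≤ d j) :
    M.det.coeff (∑ j, d j) = (Matrix.of fun i j => (M i j).coeff (d j)).det := by
  rw [Matrix.det_apply, Matrix.det_apply, finsetSum_coeff]
  refine Finset.sum_congr rfl fun σ _ => ?_
  rw [coeff_smul, coeff_prod_sum_of_natDegree_le _ _ _ fun i _ => h _ _]
  rfl

open Polynomial in
/-- A polynomial relation `∑ Q_l(x) y ^ l = 0` cannot hold at too many points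
`(p + r q, ω ^ p g ^ q)`. -/
theorem interpolation_zero_estimate {F : Type*} [Field F] [CharZero F] {ω g : F} (hω0 : ω ≠ 0)
    (hω : ∀ a b : ℕ, ω ^ a = ω ^ b → a = b) (hg : g ≠ 0) {r R S K L : ℕ} (hRr : R ≤ r)
    (hK : 0 < K) (hL : L ≤ R) (hcount : L * K ≤ (R - L) * S) (Q : Fin L → F[X])
    (hdeg : ∀ l, (Q l).natDegree < K)
    (hzero : ∀ p < R, ∀ q < S,
      ∑ l, (Q l).eval ((p + r * q : ℕ) : F) * (ω ^ p * g ^ q) ^ (l : ℕ) = 0) :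
    Q = 0 := by
  classical
  by_contra hQ
  set J := Finset.univ.filter (fun l => Q l ≠ 0) with hJ
  have hJne : J.Nonempty := by
    by_contra hne
    apply hQ
    funext l
    by_contra hl
    exact hne ⟨l, by simpa [hJ] using hl⟩
  set s := J.card with hs
  have hspos : 0 < s := Finset.card_pos.2 hJne
  have hsL : s ≤ L := by
    simpa using Finset.card_le_univ J
  let e : Fin s ≃ J := J.equivFin.symm
  let ix : Fin s → Fin L := fun j => (e j : Fin L)
  have hixinj : Function.Injective ix := Subtype.val_injective.comp e.injective
  have hQix : ∀ j, Q (ix j) ≠ 0 := fun j => by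
    have := (e j).2
    exact (Finset.mem_filter.1 this).2
  let M : Matrix (Fin s) (Fin s) F[X] := Matrix.of fun a j =>
    (Q (ix j)).comp (X + C ((a : ℕ) : F)) * C ((ω ^ (ix j : ℕ)) ^ (a : ℕ))
  have hMdeg : ∀ a j, (M a j).natDegree ≤ (Q (ix j)).natDegree := by
    intro a j
    refine (natDegree_mul_C_le _ _).trans (le_of_eq ?_)
    change ((Q (ix j)).comp (X + C ((a : ℕ) : F))).natDegree = _
    rw [natDegree_comp, natDegree_X_add_C, mul_one]
  have hlead : M.det.coeff (∑ j, (Q (ix j)).natDegree) ≠ 0 := by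
    rw [coeff_det_of_natDegree_le M _ hMdeg]
    have h1 : (Matrix.of fun a j => (M a j).coeff (Q (ix j)).natDegree) =
        Matrix.of fun a j => (Q (ix j)).leadingCoeff *
          (Matrix.vandermonde fun j => ω ^ (ix j : ℕ)).transpose a j := by
      ext a j
      simp only [M, Matrix.of_apply, coeff_mul_C, Matrix.transpose_apply, Matrix.vandermonde_apply]
      congr 1
      have h2 : ((Q (ix j)).comp (X + C ((a : ℕ) : F))).natDegree = (Q (ix j)).natDegree := by
        rw [natDegree_comp, natDegree_X_add_C, mul_one]
      rw [← h2]
      change leadingCoeff _ = _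
      rw [leadingCoeff_comp (by rw [natDegree_X_add_C]; exact one_ne_zero)]
      rw [leadingCoeff_X_add_C, one_pow, mul_one]
    rw [h1, Matrix.det_mul_row]
    refine mul_ne_zero (Finset.prod_ne_zero_iff.2 fun j _ => leadingCoeff_ne_zero.2 (hQix j)) ?_
    rw [Matrix.det_transpose, Matrix.det_vandermonde_ne_zero_iff]
    intro j j' hjj
    exact hixinj (Fin.ext (hω _ _ hjj))
  have hdet0 : M.det ≠ 0 := fun h => hlead (by rw [h, coeff_zero])
  have hdetdeg : M.det.natDegree ≤ ∑ j, (Q (ix j)).natDegree := by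
    rw [Matrix.det_apply]
    refine natDegree_sum_le_of_forall_le _ _ fun σ _ => ?_
    refine (natDegree_smul_le _ _).trans ((natDegree_prod_le _ _).trans ?_)
    exact Finset.sum_le_sum fun i _ => hMdeg _ _
  have hlt : ∑ j, (Q (ix j)).natDegree < (R - L) * S := by
    refine lt_of_lt_of_le ?_ hcount
    have : ∑ j, (Q (ix j)).natDegree ≤ ∑ _j : Fin s, (K - 1) :=
      Finset.sum_le_sum fun j _ => by have := hdeg (ix j); omega
    simp only [Finset.sum_const, Finset.card_univ, Fintype.card_fin, smul_eq_mul] at this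
    refine lt_of_le_of_lt (this.trans (Nat.mul_le_mul_right (K - 1) hsL)) ?_
    exact Nat.mul_lt_mul_of_pos_left (by omega) (by omega)
  have hrootpt : ∀ p < R - L, ∀ q < S, M.det.eval ((p + r * q : ℕ) : F) = 0 := by
    intro p hp q hq
    have hmap : M.det.eval ((p + r * q : ℕ) : F) =
        ((evalRingHom ((p + r * q : ℕ) : F)).mapMatrix M).det := by
      rw [← RingHom.map_det]
      rfl
    rw [hmap]
    apply Matrix.exists_mulVec_eq_zero_iff.1
    refine ⟨fun j => (ω ^ p * g ^ q) ^ (ix j : ℕ), ?_, ?_⟩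
    · intro h
      have := congrFun h ⟨0, hspos⟩
      exact pow_ne_zero _ (mul_ne_zero (pow_ne_zero _ hω0) (pow_ne_zero _ hg)) this
    · funext a
      have ha : (a : ℕ) < s := a.2
      have h3 := hzero (p + a) (by omega) q hq
      have h4 : ∑ l, (Q l).eval ((p + a + r * q : ℕ) : F) * (ω ^ (p + (a : ℕ)) * g ^ q) ^ (l : ℕ) =
          ∑ j : Fin s, (Q (ix j)).eval ((p + a + r * q : ℕ) : F) *
            (ω ^ (p + (a : ℕ)) * g ^ q) ^ (ix j : ℕ) := by
        have h5 : ∑ l ∈ J, (Q l).eval ((p + a + r * q : ℕ) : F) *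
            (ω ^ (p + (a : ℕ)) * g ^ q) ^ (l : ℕ) = ∑ l, (Q l).eval ((p + a + r * q : ℕ) : F) *
            (ω ^ (p + (a : ℕ)) * g ^ q) ^ (l : ℕ) := by
          apply Finset.sum_subset (Finset.subset_univ J)
          intro l _ hl
          have : Q l = 0 := by simpa [hJ] using hl
          rw [this]
          simp
        rw [← h5, ← Finset.sum_coe_sort]
        exact (Equiv.sum_comp e _).symm
      rw [h4] at h3
      simp only [Matrix.mulVec, dotProduct, RingHom.mapMatrix_apply, Matrix.map_apply, M,
        Matrix.of_apply, coe_evalRingHom, eval_mul, eval_comp, eval_add, eval_X, eval_C,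
        Pi.zero_apply]
      rw [← h3]
      refine Finset.sum_congr rfl fun j _ => ?_
      rw [show (((p + r * q : ℕ) : F) + ((a : ℕ) : F)) = ((p + a + r * q : ℕ) : F) by
        push_cast; ring]
      rw [← pow_mul, mul_pow (ω ^ p), mul_pow (ω ^ (p + (a : ℕ))), ← pow_mul, ← pow_mul, ← pow_mul,
        add_mul, pow_add, mul_comm (ix j : ℕ) (a : ℕ)]
      ring
  let Z : Finset F := ((Finset.range (R - L)) ×ˢ (Finset.range S)).image
    (fun z => ((z.1 + r * z.2 : ℕ) : F))
  have hZcard : Z.card = (R - L) * S := by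
    rw [Finset.card_image_of_injOn, Finset.card_product, Finset.card_range, Finset.card_range]
    rintro ⟨p, q⟩ h ⟨p', q'⟩ h' heq
    simp only [Finset.coe_product, Finset.coe_range, Set.mem_prod, Set.mem_Iio] at h h'
    have heq' : p + r * q = p' + r * q' := Nat.cast_injective (R := F) heq
    have hp : p < r := by omega
    have hp' : p' < r := by omega
    have hr : 0 < r := by omega
    have e1 : q = q' := by
      have := congrArg (· / r) heq'
      simpa [Nat.add_mul_div_left _ _ hr, Nat.div_eq_of_lt hp, Nat.div_eq_of_lt hp'] using this
    subst e1
    simp only [Prod.mk.injEq, and_true]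
    omega
  have hZ : Z.card ≤ M.det.natDegree := by
    apply Polynomial.card_le_degree_of_subset_roots
    intro z hz
    rw [Finset.mem_val] at hz
    simp only [Z, Finset.mem_image, Finset.mem_product, Finset.mem_range] at hz
    obtain ⟨⟨p, q⟩, ⟨hp, hq⟩, rfl⟩ := hz
    exact (mem_roots hdet0).2 (hrootpt p hp q hq)
  omega

theorem Matrix.exists_submatrix_det_ne_zero {F m n : Type*} [Field F] [Fintype m] [Fintype n]
    [DecidableEq n] (M : Matrix m n F) (h : ∀ v, M.mulVec v = 0 → v = 0) :
    ∃ f : n → m, (M.submatrix f id).det ≠ 0 := by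
  have hinj : Function.Injective M.mulVecLin := by
    rw [← LinearMap.ker_eq_bot, LinearMap.ker_eq_bot']
    exact h
  have hrank : M.rank = Fintype.card n := by
    rw [Matrix.rank, LinearMap.finrank_range_of_inj hinj, Module.finrank_fintype_fun_eq_card]
  rw [Matrix.rank_eq_finrank_span_row] at hrank
  obtain ⟨t, hts, htcard, -, hind⟩ :=
    Submodule.exists_finset_span_eq_linearIndepOn F (Set.range M.row)
  rw [hrank] at htcard
  let e : n ≃ t := Fintype.equivOfCardEq (by simp [htcard])
  have hx : ∀ i : n, ∃ j : m, M.row j = (e i : n → F) := fun i => hts (e i).2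
  choose f hf using hx
  refine ⟨f, ?_⟩
  have hli : LinearIndependent F (M.submatrix f id).row := by
    have h1 : (M.submatrix f id).row = fun i => ((e i : t) : n → F) := by
      funext i
      rw [← hf i]
      rfl
    rw [h1]
    exact hind.comp e e.injective
  exact (Matrix.isUnit_iff_isUnit_det _).1
    (Matrix.linearIndependent_rows_iff_isUnit.1 hli) |>.ne_zero

theorem one_le_prod_abs_conj {L : Type*} [Field L] [NumberField L] [IsGalois ℚ L] (φ : L →+* ℝ)
    {z : L} (hz : IsIntegral ℤ z) (hz0 : z ≠ 0) : 1 ≤ ∏ σ : L ≃ₐ[ℚ] L, |φ (σ z)| := by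
  have h1 := Algebra.norm_eq_prod_automorphisms ℚ z
  obtain ⟨n, hn⟩ := IsIntegrallyClosed.isIntegral_iff.1 (Algebra.isIntegral_norm ℚ hz)
  have hn0 : n ≠ 0 := by
    rintro rfl
    rw [map_zero] at hn
    exact hz0 (Algebra.norm_eq_zero_iff.1 hn.symm)
  have h2 : ∏ σ : L ≃ₐ[ℚ] L, |φ (σ z)| = |(n : ℝ)| := by
    rw [← Finset.abs_prod, ← map_prod, ← h1, ← hn]
    simp
  rw [h2]
  exact_mod_cast Int.one_le_abs hn0

theorem pow_div_factorial_le {U : ℝ} (hU : 0 ≤ U) {k K : ℕ} (hk : k ≤ K) (hK : 0 < K) :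
    (U + K) ^ k / k.factorial ≤ Real.exp (K * (1 + Real.log ((U + K) / K))) := by
  have hK' : (0 : ℝ) < K := by exact_mod_cast hK
  have h1 : 1 ≤ (U + K) / K := by rw [le_div_iff₀ hK']; linarith
  have h2 : Real.exp (K * (1 + Real.log ((U + K) / K))) = Real.exp K * ((U + K) / K) ^ K := by
    rw [mul_add, mul_one, Real.exp_add, mul_comm (K : ℝ) (Real.log _), Real.exp_mul,
      Real.exp_log (by linarith), Real.rpow_natCast]
  rw [h2]
  have h3 : (K : ℝ) ^ k / k.factorial ≤ Real.exp K := Real.pow_div_factorial_le_exp _ hK'.le k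
  calc (U + K) ^ k / k.factorial = (K : ℝ) ^ k / k.factorial * ((U + K) / K) ^ k := by
        rw [div_pow]; field_simp
    _ ≤ _ := by gcongr

set_option maxHeartbeats 1000000 in
/-- An effective two-logarithm estimate: the algebraic numbers `ω`, `g` cannot satisfy
`g = ω ^ r ξ` with `ξ` too close to `1`, by an interpolation determinant. -/
theorem false_of_close_power {L : Type*} [Field L] [NumberField L] [IsGalois ℚ L] (φ : L →+* ℝ)
    (hcard : Fintype.card (L ≃ₐ[ℚ] L) ≤ 24) {ω g : L} {r R S K H d N : ℕ}
    {w ξ Hω Hg ρ : ℝ} (hd : 1 ≤ d) (hω : IsIntegral ℤ ω) (hg : IsIntegral ℤ ((d : L) * g)) (hg0 : g ≠ 0)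
    (hw0 : w ≠ 0) (hφω : φ ω = Real.exp w) (hφg : φ g = Real.exp (w * r) * ξ)
    (hHω : 0 ≤ Hω) (hHg : 0 ≤ Hg)
    (hσω : ∀ σ : L ≃ₐ[ℚ] L, |φ (σ ω)| ≤ Real.exp Hω)
    (hσg : ∀ σ : L ≃ₐ[ℚ] L, |φ (σ g)| ≤ Real.exp Hg)
    (hρ : 1 ≤ ρ) (hRr : R ≤ r) (hK : 0 < K) (hH0 : 0 < H) (hH : H ≤ R) (hS : 0 < S)
    (hcount : H * K ≤ (R - H) * S) (hN : N = K * H)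
    (hξ : ∀ l < H, ∀ q < S, |ξ ^ (l * q) - 1| * ρ ^ N ≤ 1)
    (hfinal : 25 * Real.log (N + 1) + Real.log 2 + 24 * (H * S * Real.log d) +
      24 * (K * (1 + Real.log ((ρ * (r * S) + K) / K))) + H * |w| * (ρ * (r * S)) +
      23 * (H * (R * Hω + S * Hg)) < ((N : ℝ) - 1) / 2 * Real.log ρ) : False := by
  classical
  have hρ0 : 0 < ρ := by linarith
  have hr : 0 < r := by omega
  have hd' : (1 : ℝ) ≤ d := by exact_mod_cast hd
  set X : ℝ := (r : ℝ) * S with hX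
  have hX0 : 0 < X := by positivity
  set DD : ℝ := (d : ℝ) ^ (H * S) with hDD
  have hDD1 : 1 ≤ DD := one_le_pow₀ hd'
  set A : ℝ := K * (1 + Real.log ((ρ * X + K) / K)) with hA
  have hKr : (0 : ℝ) < K := by exact_mod_cast hK
  have hA0 : 0 ≤ A := by
    have : 1 ≤ (ρ * X + K) / K := by
      rw [le_div_iff₀ hKr]; nlinarith [mul_pos hρ0 hX0]
    have := Real.log_nonneg this
    positivity
  have hω0 : ω ≠ 0 := by
    rintro rfl
    rw [map_zero] at hφω
    exact (Real.exp_pos w).ne hφω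
  have hωinj : ∀ a b : ℕ, ω ^ a = ω ^ b → a = b := by
    intro a b h
    have h2 := congrArg φ h
    rw [map_pow, map_pow, hφω, ← Real.exp_nat_mul, ← Real.exp_nat_mul, Real.exp_eq_exp] at h2
    exact_mod_cast mul_right_cancel₀ hw0 h2
  let xx : Fin R × Fin S → ℕ := fun z => z.1 + r * z.2
  have hxx : ∀ z, xx z ≤ r * S := by
    rintro ⟨p, q⟩
    have hp := p.2
    have hq := q.2
    have : r * (q + 1) ≤ r * S := Nat.mul_le_mul_left r hq
    simp only [xx]
    nlinarith
  have hxxX : ∀ z, (xx z : ℝ) ≤ X := fun z => by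
    rw [hX]; exact_mod_cast hxx z
  let M : Matrix (Fin R × Fin S) (Fin K × Fin H) L := Matrix.of fun z c =>
    (d : L) ^ (H * S) * ((xx z).choose c.1 : L) * (ω ^ (z.1 : ℕ) * g ^ (z.2 : ℕ)) ^ (c.2 : ℕ)
  have hlq : ∀ (l : Fin H) (q : Fin S), (l : ℕ) * q ≤ H * S := fun l q =>
    Nat.mul_le_mul l.2.le q.2.le
  have hnat : ∀ n : ℕ, IsIntegral ℤ (n : L) := fun n => by
    simpa using (isIntegral_algebraMap (R := ℤ) (A := L) (x := (n : ℤ)))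
  have hMint : ∀ z c, IsIntegral ℤ (M z c) := by
    rintro ⟨p, q⟩ ⟨k, l⟩
    have e : M (p, q) (k, l) = ((d : L) ^ (H * S - l * q)) * ((xx (p, q)).choose k : L) *
        ω ^ ((p : ℕ) * l) * ((d : L) * g) ^ ((l : ℕ) * q) := by
      simp only [M, Matrix.of_apply]
      rw [mul_pow (d : L) g, mul_pow (ω ^ (p : ℕ)), ← pow_mul, ← pow_mul, mul_comm (q : ℕ) l]
      rw [← Nat.sub_add_cancel (hlq l q), pow_add, Nat.add_sub_cancel]
      ring
    rw [e]
    refine IsIntegral.mul (IsIntegral.mul (IsIntegral.mul ?_ ?_) (hω.pow _)) (hg.pow _)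
    · exact (hnat d).pow _
    · exact hnat _
  have hker : ∀ v, M.mulVec v = 0 → v = 0 := by
    intro v hv
    let B : ℕ → Polynomial L := fun k =>
      Polynomial.C ((k.factorial : L)⁻¹) * descPochhammer L k
    have hB : ∀ k n : ℕ, (B k).eval (n : L) = (n.choose k : L) := by
      intro k n
      simp only [B, Polynomial.eval_mul, Polynomial.eval_C]
      rw [Nat.cast_choose_eq_descPochhammer_div]
      ring
    let Q : Fin H → Polynomial L := fun l => ∑ k : Fin K, Polynomial.C (v (k, l)) * B k
    have hQdeg : ∀ l, (Q l).natDegree < K := by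
      intro l
      refine lt_of_le_of_lt (Polynomial.natDegree_sum_le_of_forall_le (n := K - 1) _ _ ?_) (by omega)
      intro k _
      refine (Polynomial.natDegree_C_mul_le _ _).trans ((Polynomial.natDegree_C_mul_le _ _).trans ?_)
      rw [descPochhammer_natDegree]
      omega
    have hQ : Q = 0 := by
      refine interpolation_zero_estimate hω0 hωinj hg0 hRr hK hH hcount Q hQdeg ?_
      intro p hp q hq
      have h1 := congrFun hv (⟨p, hp⟩, ⟨q, hq⟩)
      simp only [Matrix.mulVec, dotProduct, M, Matrix.of_apply, xx, Pi.zero_apply,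
        Fintype.sum_prod_type] at h1
      have hdL : (d : L) ^ (H * S) ≠ 0 := pow_ne_zero _ (by exact_mod_cast (by omega : d ≠ 0))
      apply mul_left_cancel₀ hdL
      rw [mul_zero, ← h1, Finset.sum_comm, Finset.mul_sum]
      refine Finset.sum_congr rfl fun l _ => ?_
      simp only [Q, Polynomial.eval_finsetSum, Polynomial.eval_mul, Polynomial.eval_C, hB]
      rw [Finset.sum_mul, Finset.mul_sum]
      refine Finset.sum_congr rfl fun k _ => ?_
      ring
    have hzero : ∀ l : Fin H, ∀ n : ℕ, ∀ hn : n < K, v (⟨n, hn⟩, l) = 0 := by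
      intro l n
      induction n using Nat.strong_induction_on with
      | _ n ih =>
        intro hn
        have h1 := congrArg (Polynomial.eval (n : L)) (congrFun hQ l)
        simp only [Q, Polynomial.eval_finsetSum, Polynomial.eval_mul, Polynomial.eval_C, hB,
          Pi.zero_apply, Polynomial.eval_zero] at h1
        rw [Finset.sum_eq_single ⟨n, hn⟩] at h1
        · simpa using h1
        · intro k _ hk
          rcases lt_trichotomy (k : ℕ) n with h | h | h
          · rw [ih k h k.2, zero_mul]
          · exact absurd (Fin.ext h) hk
          · rw [Nat.choose_eq_zero_of_lt h, Nat.cast_zero, mul_zero]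
        · intro h
          exact absurd (Finset.mem_univ _) h
    funext ⟨k, l⟩
    exact hzero l k k.2
  obtain ⟨f, hf⟩ := M.exists_submatrix_det_ne_zero hker
  set Δ := (M.submatrix f id).det with hΔ
  have hΔint : IsIntegral ℤ Δ := IsIntegral.det fun i j => hMint _ _
  have hcardι : Fintype.card (Fin K × Fin H) = N := by simp [hN]
  have hchoose : ∀ (k : Fin K) z, ((xx z).choose k : ℝ) ≤ Real.exp A := by
    intro k z
    refine le_trans ?_ (pow_div_factorial_le (by positivity : 0 ≤ ρ * X) k.2.le hK)
    refine (Nat.choose_le_pow_div (k : ℕ) (xx z)).trans ?_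
    gcongr
    have := hxxX z
    nlinarith
  -- the bound for an arbitrary conjugate
  set E : ℝ := DD * Real.exp (A + H * (R * Hω + S * Hg)) with hE
  have hE1 : 1 ≤ E := one_le_mul_of_one_le_of_one_le hDD1 (Real.one_le_exp (by positivity))
  set G : ℝ := N.factorial * E ^ N with hG
  have hG1 : 1 ≤ G := one_le_mul_of_one_le_of_one_le
    (by exact_mod_cast Nat.factorial_pos N) (one_le_pow₀ hE1)
  have hconj : ∀ σ : L ≃ₐ[ℚ] L, |φ (σ Δ)| ≤ G := by
    intro σ
    have h1 : φ (σ Δ) = ((φ.comp (σ : L →+* L)).mapMatrix (M.submatrix f id)).det := by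
      rw [← RingHom.map_det]
      rfl
    rw [h1]
    have := Matrix.det_le (A := (φ.comp (σ : L →+* L)).mapMatrix (M.submatrix f id))
      (abv := AbsoluteValue.abs) (x := E) (by
        rintro i ⟨k, l⟩
        have e : ((φ.comp (σ : L →+* L)).mapMatrix (M.submatrix f id)) i (k, l) =
            DD * ((xx (f i)).choose k : ℝ) *
              (φ (σ ω) ^ ((f i).1 : ℕ) * φ (σ g) ^ ((f i).2 : ℕ)) ^ (l : ℕ) := by
          simp only [RingHom.mapMatrix_apply, Matrix.map_apply, Matrix.submatrix_apply, id, M,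
            Matrix.of_apply, map_mul, map_pow, map_natCast, RingHom.comp_apply, RingHom.coe_coe,
            hDD]
        rw [e, AbsoluteValue.abs_apply, abs_mul, abs_mul, abs_of_nonneg (by linarith : 0 ≤ DD),
          Nat.abs_cast, abs_pow, abs_mul, abs_pow, abs_pow, hE, Real.exp_add, mul_assoc]
        gcongr
        · exact hchoose k _
        · have h2 : |φ (σ ω)| ^ ((f i).1 : ℕ) * |φ (σ g)| ^ ((f i).2 : ℕ) ≤
              Real.exp (R * Hω + S * Hg) := by
            rw [Real.exp_add, Real.exp_nat_mul, Real.exp_nat_mul]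
            gcongr
            · exact (pow_le_pow_left₀ (abs_nonneg _) (hσω σ) _).trans
                (pow_le_pow_right₀ (Real.one_le_exp hHω) (f i).1.2.le)
            · exact (pow_le_pow_left₀ (abs_nonneg _) (hσg σ) _).trans
                (pow_le_pow_right₀ (Real.one_le_exp hHg) (f i).2.2.le)
          rw [Real.exp_nat_mul]
          exact (pow_le_pow_left₀ (by positivity) h2 _).trans
            (pow_le_pow_right₀ (Real.one_le_exp (by positivity)) l.2.le))
    rw [hcardι, nsmul_eq_mul] at this
    exact this
  -- the analytic bound
  set v : ℝ := Real.exp (A + H * |w| * (ρ * X)) with hv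
  have hana : |φ Δ| * ρ ^ (∑ j ∈ Finset.range N, j) ≤
      (N + 1 : ℝ) ^ N * (N.factorial * (2 * DD * v) ^ N) := by
    have htay := fun c : Fin K × Fin H =>
      taylor_choose_mul_exp hX0 hρ N K c.1 c.1.2.le ((c.2 : ℝ) * w)
    choose a ha hb using htay
    have hvc : ∀ c : Fin K × Fin H, (ρ * X + K) ^ (c.1 : ℕ) / ((c.1 : ℕ).factorial : ℝ) *
        Real.exp (|(c.2 : ℝ) * w| * (ρ * X)) ≤ v := by
      intro c
      rw [hv, Real.exp_add, abs_mul, Nat.abs_cast]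
      have : (c.2 : ℝ) ≤ H := by exact_mod_cast c.2.2.le
      gcongr
      exact pow_div_factorial_le (by positivity : 0 ≤ ρ * X) c.1.2.le hK
    let b : Fin K × Fin H → Fin K × Fin H → ℝ := fun c μ =>
      φ (M (f μ) c) - ∑ m : Fin N, DD * a c m * (xx (f μ) : ℝ) ^ (m : ℕ)
    have hent : ∀ c z, φ (M z c) = DD * (((xx z).choose c.1 : ℝ) *
        Real.exp ((c.2 : ℝ) * w * xx z)) * ξ ^ ((c.2 : ℕ) * z.2) := by
      rintro ⟨k, l⟩ ⟨p, q⟩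
      simp only [M, Matrix.of_apply, map_mul, map_pow, map_natCast, hφω, hφg, xx]
      have e : Real.exp ((l : ℝ) * w * ((p + r * q : ℕ) : ℝ)) =
          (Real.exp w ^ (p : ℕ) * Real.exp (w * r) ^ (q : ℕ)) ^ (l : ℕ) := by
        rw [← Real.exp_nat_mul, ← Real.exp_nat_mul, ← Real.exp_add, ← Real.exp_nat_mul]
        congr 1
        push_cast
        ring
      rw [e, mul_pow (Real.exp (w * r)) ξ, mul_comm (l : ℕ) (q : ℕ), pow_mul ξ]
      ring
    have hdet : φ Δ = (Matrix.of fun c μ =>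
        ∑ m : Fin N, DD * a c m * (xx (f μ) : ℝ) ^ (m : ℕ) + b c μ).det := by
      rw [hΔ, ← Matrix.det_transpose, RingHom.map_det]
      congr 1
      ext c μ
      simp [b]
    rw [hdet]
    refine abs_det_interpolation_le N hcardι (fun c m => DD * a c m) b (fun μ => (xx (f μ) : ℝ)) _ ρ
      hρ ?_ ?_
    · intro c m μ
      rw [mul_assoc DD, abs_mul, abs_of_nonneg (by linarith : 0 ≤ DD), mul_assoc]
      have h1 := (ha c m (xx (f μ)) (Nat.cast_nonneg _) (hxxX _)).trans (hvc c)
      have h2 : 0 ≤ DD * v := by positivity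
      calc _ ≤ DD * v := by gcongr
        _ ≤ _ := by linarith
    · intro c μ
      have h1 := (hb c (xx (f μ)) (hxxX _)).trans (hvc c)
      set F := ((xx (f μ)).choose c.1 : ℝ) * Real.exp ((c.2 : ℝ) * w * xx (f μ)) with hF
      have hFv : F ≤ v := by
        rw [hF, hv, Real.exp_add]
        refine mul_le_mul (hchoose _ _) (Real.exp_le_exp.2 ?_) (Real.exp_pos _).le
          (Real.exp_pos _).le
        have h2 : (c.2 : ℝ) ≤ H := by exact_mod_cast c.2.2.le
        have h3 := hxxX (f μ)
        have h4 : (xx (f μ) : ℝ) ≤ ρ * X := h3.trans (le_mul_of_one_le_left hX0.le hρ)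
        calc (c.2 : ℝ) * w * xx (f μ) ≤ (c.2 : ℝ) * |w| * xx (f μ) := by
              gcongr; exact le_abs_self w
          _ ≤ H * |w| * (ρ * X) := by gcongr
      have hF0 : 0 ≤ F := by positivity
      have hsum : ∑ m : Fin N, DD * a c m * (xx (f μ) : ℝ) ^ (m : ℕ) =
          DD * ∑ m : Fin N, a c m * (xx (f μ) : ℝ) ^ (m : ℕ) := by
        rw [Finset.mul_sum]
        refine Finset.sum_congr rfl fun m _ => ?_
        ring
      have hb' : b c μ = DD * (F * (ξ ^ ((c.2 : ℕ) * (f μ).2) - 1) +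
          (F - ∑ m : Fin N, a c m * (xx (f μ) : ℝ) ^ (m : ℕ))) := by
        simp only [b]
        rw [hent, hsum]
        ring
      have h5 := hξ c.2 c.2.2 (f μ).2 (f μ).2.2
      rw [hb', abs_mul, abs_of_nonneg (by linarith : 0 ≤ DD)]
      have h6 := abs_add_le (F * (ξ ^ ((c.2 : ℕ) * (f μ).2) - 1))
        (F - ∑ m : Fin N, a c m * (xx (f μ) : ℝ) ^ (m : ℕ))
      have h7 : |F * (ξ ^ ((c.2 : ℕ) * (f μ).2) - 1)| * ρ ^ N ≤ v := by
        rw [abs_mul, abs_of_nonneg hF0, mul_assoc]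
        calc _ ≤ F * 1 := by gcongr
          _ ≤ v := by linarith
      have h8 : |F * (ξ ^ ((c.2 : ℕ) * (f μ).2) - 1) +
          (F - ∑ m : Fin N, a c m * (xx (f μ) : ℝ) ^ (m : ℕ))| * ρ ^ N ≤ 2 * v := by
        have := mul_le_mul_of_nonneg_right h6 (pow_nonneg hρ0.le N)
        linarith
      calc _ = DD * (|F * (ξ ^ ((c.2 : ℕ) * (f μ).2) - 1) +
          (F - ∑ m : Fin N, a c m * (xx (f μ) : ℝ) ^ (m : ℕ))| * ρ ^ N) := by ring
        _ ≤ DD * (2 * v) := by gcongr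
        _ = _ := by ring
  have hprod : 1 ≤ |φ Δ| * G ^ 23 := by
    have h1 := one_le_prod_abs_conj φ hΔint hf
    rw [← Finset.mul_prod_erase Finset.univ _ (Finset.mem_univ (1 : L ≃ₐ[ℚ] L))] at h1
    have h2 : ∏ σ ∈ Finset.univ.erase (1 : L ≃ₐ[ℚ] L), |φ (σ Δ)| ≤ G ^ 23 := by
      refine (Finset.prod_le_prod (fun _ _ => abs_nonneg _) fun σ _ => hconj σ).trans ?_
      rw [Finset.prod_const]
      refine pow_le_pow_right₀ hG1 ?_
      rw [Finset.card_erase_of_mem (Finset.mem_univ _), Finset.card_univ]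
      omega
    refine h1.trans ?_
    simp only [AlgEquiv.one_apply]
    exact mul_le_mul_of_nonneg_left h2 (abs_nonneg _)
  have hkey : ρ ^ (∑ j ∈ Finset.range N, j) ≤
      (N + 1 : ℝ) ^ N * (N.factorial * (2 * DD * v) ^ N) * G ^ 23 := by
    calc ρ ^ (∑ j ∈ Finset.range N, j) ≤ ρ ^ (∑ j ∈ Finset.range N, j) * (|φ Δ| * G ^ 23) :=
          le_mul_of_one_le_right (by positivity) hprod
      _ = (|φ Δ| * ρ ^ (∑ j ∈ Finset.range N, j)) * G ^ 23 := by ring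
      _ ≤ _ := by gcongr
  have hNpos : 0 < N := by rw [hN]; positivity
  have hNr : (0 : ℝ) < N := by exact_mod_cast hNpos
  have hfac : (N.factorial : ℝ) ≤ (N + 1 : ℝ) ^ N := by
    have h1 : (N.factorial : ℝ) ≤ (N : ℝ) ^ N := by exact_mod_cast Nat.factorial_le_pow N
    exact h1.trans (by gcongr; linarith)
  have hkey2 : ρ ^ (∑ j ∈ Finset.range N, j) ≤
      ((N + 1 : ℝ) ^ 25 * 2 * DD ^ 24 * v * Real.exp (A + H * (R * Hω + S * Hg)) ^ 23) ^ N := by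
    calc _ ≤ (N + 1 : ℝ) ^ N * (N.factorial * (2 * DD * v) ^ N) * G ^ 23 := hkey
      _ ≤ (N + 1 : ℝ) ^ N * ((N + 1 : ℝ) ^ N * (2 * DD * v) ^ N) * ((N + 1 : ℝ) ^ N * E ^ N) ^ 23 := by
          rw [hG]; gcongr
      _ = _ := by
          rw [hE]
          generalize Real.exp (A + H * (R * Hω + S * Hg)) = e1
          generalize v = v1
          generalize DD = D1
          generalize (N + 1 : ℝ) = n1
          simp only [mul_pow, ← pow_mul]
          ring
  have hlog := Real.log_le_log (by positivity) hkey2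
  have hN1 : (0 : ℝ) < (N : ℝ) + 1 := by linarith
  rw [Real.log_pow, Real.log_pow, Real.log_mul (by positivity) (by positivity),
    Real.log_mul (by positivity) (by positivity), Real.log_mul (by positivity) (by positivity),
    Real.log_mul (by positivity) (by positivity), Real.log_pow, Real.log_pow,
    Real.log_pow, Real.log_exp, Real.log_pow, Real.log_exp] at hlog
  have hgauss : ((∑ j ∈ Finset.range N, j : ℕ) : ℝ) = N * ((N - 1) / 2) := by
    have := Finset.sum_range_id_mul_two N
    have h2 : ((∑ j ∈ Finset.range N, j : ℕ) : ℝ) * 2 = N * ((N - 1 : ℕ) : ℝ) := by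
      exact_mod_cast this
    rw [Nat.cast_sub (by omega : 1 ≤ N)] at h2
    push_cast at h2 ⊢
    linarith
  rw [hgauss, mul_assoc] at hlog
  have hlog2 := le_of_mul_le_mul_left hlog hNr
  push_cast at hlog2
  linarith

/-- `Encl x p` says that `x`, scaled by `2 ^ 400`, lies between the two integers of `p`. -/
def Encl (x : ℝ) (p : ℤ × ℤ) : Prop := (p.1 : ℝ) ≤ x * 2 ^ 400 ∧ x * 2 ^ 400 ≤ (p.2 : ℝ)

namespace Encl

/-- Interval addition. -/
def add (p q : ℤ × ℤ) : ℤ × ℤ := (p.1 + q.1, p.2 + q.2)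

/-- Interval negation. -/
def neg (p : ℤ × ℤ) : ℤ × ℤ := (-p.2, -p.1)

/-- Multiplication of an interval by an integer. -/
def smul (c : ℤ) (p : ℤ × ℤ) : ℤ × ℤ :=
  if 0 ≤ c then (c * p.1, c * p.2) else (c * p.2, c * p.1)

/-- Interval multiplication, rounded outwards. -/
def mul (p q : ℤ × ℤ) : ℤ × ℤ :=
  (min (min (p.1 * q.1) (p.1 * q.2)) (min (p.2 * q.1) (p.2 * q.2)) / 2 ^ 400,
    max (max (p.1 * q.1) (p.1 * q.2)) (max (p.2 * q.1) (p.2 * q.2)) / 2 ^ 400 + 1)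

theorem of_add {x y : ℝ} {p q : ℤ × ℤ} (hx : Encl x p) (hy : Encl y q) :
    Encl (x + y) (add p q) := by
  obtain ⟨h1, h2⟩ := hx
  obtain ⟨h3, h4⟩ := hy
  constructor <;> simp only [add] <;> push_cast <;> linarith

theorem of_neg {x : ℝ} {p : ℤ × ℤ} (hx : Encl x p) : Encl (-x) (neg p) := by
  obtain ⟨h1, h2⟩ := hx
  constructor <;> simp only [neg] <;> push_cast <;> linarith

theorem of_smul {x : ℝ} {p : ℤ × ℤ} (c : ℤ) (hx : Encl x p) : Encl (c * x) (smul c p) := by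
  obtain ⟨h1, h2⟩ := hx
  unfold smul
  split_ifs with h
  · have hc : (0 : ℝ) ≤ c := by exact_mod_cast h
    constructor <;> push_cast <;> rw [mul_assoc] <;> exact mul_le_mul_of_nonneg_left ‹_› hc
  · have hc : (c : ℝ) ≤ 0 := by exact_mod_cast (not_le.1 h).le
    constructor <;> push_cast <;> rw [mul_assoc] <;> exact mul_le_mul_of_nonpos_left ‹_› hc

theorem mul_mem_Icc {a b c d x y : ℝ} (hx : a ≤ x) (hx' : x ≤ b) (hy : c ≤ y) (hy' : y ≤ d) :
    min (min (a * c) (a * d)) (min (b * c) (b * d)) ≤ x * y ∧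
      x * y ≤ max (max (a * c) (a * d)) (max (b * c) (b * d)) := by
  have key : ∀ z : ℝ, min (z * c) (z * d) ≤ z * y ∧ z * y ≤ max (z * c) (z * d) := by
    intro z
    rcases le_total 0 z with hz | hz
    · exact ⟨min_le_of_left_le (by gcongr), le_max_of_le_right (by gcongr)⟩
    · exact ⟨min_le_of_right_le (mul_le_mul_of_nonpos_left hy' hz),
        le_max_of_le_left (mul_le_mul_of_nonpos_left hy hz)⟩
  have key2 : min (a * y) (b * y) ≤ x * y ∧ x * y ≤ max (a * y) (b * y) := by
    rcases le_total 0 y with hz | hz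
    · exact ⟨min_le_of_left_le (by gcongr), le_max_of_le_right (by gcongr)⟩
    · exact ⟨min_le_of_right_le (mul_le_mul_of_nonpos_right hx' hz),
        le_max_of_le_left (mul_le_mul_of_nonpos_right hx hz)⟩
  exact ⟨(min_le_min (key a).1 (key b).1).trans key2.1,
    key2.2.trans (max_le_max (key a).2 (key b).2)⟩

theorem of_mul {x y : ℝ} {p q : ℤ × ℤ} (hx : Encl x p) (hy : Encl y q) :
    Encl (x * y) (mul p q) := by
  have h := mul_mem_Icc hx.1 hx.2 hy.1 hy.2
  have hxy : x * y * 2 ^ 400 = x * 2 ^ 400 * (y * 2 ^ 400) / 2 ^ 400 := by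
    field_simp
  have hS : (0 : ℝ) < 2 ^ 400 := by positivity
  constructor
  · simp only [mul]
    rw [hxy, le_div_iff₀ hS]
    refine le_trans ?_ h.1
    have := Int.ediv_mul_le (min (min (p.1 * q.1) (p.1 * q.2)) (min (p.2 * q.1) (p.2 * q.2)))
      (show (2 : ℤ) ^ 400 ≠ 0 by positivity)
    have h2 : ((min (min (p.1 * q.1) (p.1 * q.2)) (min (p.2 * q.1) (p.2 * q.2)) / 2 ^ 400 : ℤ) : ℝ) *
        2 ^ 400 ≤ ((min (min (p.1 * q.1) (p.1 * q.2)) (min (p.2 * q.1) (p.2 * q.2)) : ℤ) : ℝ) := by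
      exact_mod_cast this
    simpa only [Int.cast_min, Int.cast_mul] using h2
  · simp only [mul]
    rw [hxy, div_le_iff₀ hS]
    refine h.2.trans ?_
    have := (Int.lt_ediv_add_one_mul_self
      (max (max (p.1 * q.1) (p.1 * q.2)) (max (p.2 * q.1) (p.2 * q.2)))
      (show (0 : ℤ) < 2 ^ 400 by positivity)).le
    have h2 : ((max (max (p.1 * q.1) (p.1 * q.2)) (max (p.2 * q.1) (p.2 * q.2)) : ℤ) : ℝ) ≤
        ((max (max (p.1 * q.1) (p.1 * q.2)) (max (p.2 * q.1) (p.2 * q.2)) / 2 ^ 400 + 1 : ℤ) : ℝ) *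
        2 ^ 400 := by
      exact_mod_cast this
    simpa only [Int.cast_max, Int.cast_mul] using h2

theorem of_int (n : ℤ) : Encl n (n * 2 ^ 400, n * 2 ^ 400) := by
  constructor <;> push_cast <;> exact le_rfl

/-- Lower approximation to `∑ k < m, z ^ (2 * k) / (2 * (i + k) + 1)`, scaled by `2 ^ 400`. -/
def seriesDn (w : ℕ) : ℕ → ℕ → ℕ
  | 0, _ => 0
  | m + 1, i => 2 ^ 400 / (2 * i + 1) + w * seriesDn w m (i + 1) / 2 ^ 400

/-- Upper approximation to `∑ k < m, z ^ (2 * k) / (2 * (i + k) + 1)`, scaled by `2 ^ 400`. -/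
def seriesUp (w : ℕ) : ℕ → ℕ → ℕ
  | 0, _ => 0
  | m + 1, i => 2 ^ 400 / (2 * i + 1) + w * seriesUp w m (i + 1) / 2 ^ 400 + 2

theorem natCast_div_le (a b : ℕ) : ((a / b : ℕ) : ℝ) ≤ a / b := Nat.cast_div_le

theorem le_natCast_div_add_one (a b : ℕ) : (a / b : ℝ) ≤ ((a / b : ℕ) : ℝ) + 1 := by
  rcases Nat.eq_zero_or_pos b with rfl | hb
  · simp
  · have hb' : (0 : ℝ) < b := by exact_mod_cast hb
    rw [div_le_iff₀ hb']
    have := (Nat.lt_mul_of_div_lt (Nat.lt_succ_self (a / b)) hb).le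
    rw [mul_comm] at this
    rw [mul_comm]
    calc (a : ℝ) ≤ ((b * (a / b + 1) : ℕ) : ℝ) := by exact_mod_cast (by linarith)
      _ = _ := by push_cast; ring

theorem seriesDn_le {w : ℕ} {t : ℝ} (ht : (w : ℝ) ≤ t * 2 ^ 400) (m i : ℕ) :
    (seriesDn w m i : ℝ) ≤ 2 ^ 400 * ∑ k ∈ Finset.range m, t ^ k / (2 * (i + k : ℕ) + 1) := by
  induction m generalizing i with
  | zero => simp [seriesDn]
  | succ m ih =>
    have hw : (0 : ℝ) ≤ w := Nat.cast_nonneg _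
    rw [seriesDn, Finset.sum_range_succ']
    push_cast
    have h1 := natCast_div_le (2 ^ 400) (2 * i + 1)
    have h2 := natCast_div_le (w * seriesDn w m (i + 1)) (2 ^ 400)
    have h3 := ih (i + 1)
    push_cast at h1 h2 h3
    have h4 : (w : ℝ) * seriesDn w m (i + 1) / 2 ^ 400 ≤
        t * (2 ^ 400 * ∑ k ∈ Finset.range m, t ^ k / (2 * (i + 1 + k) + 1)) := by
      rw [div_le_iff₀ (by positivity)]
      calc _ ≤ (t * 2 ^ 400) * (2 ^ 400 * ∑ k ∈ Finset.range m, t ^ k / (2 * (i + 1 + k : ℝ) + 1)) :=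
            mul_le_mul ht h3 (Nat.cast_nonneg _) (hw.trans ht)
        _ = _ := by ring
    have h5 : ∑ k ∈ Finset.range m, t ^ (k + 1) / (2 * (i + (k + 1) : ℝ) + 1) =
        t * ∑ k ∈ Finset.range m, t ^ k / (2 * (i + 1 + k : ℝ) + 1) := by
      rw [Finset.mul_sum]
      refine Finset.sum_congr rfl fun k _ => ?_
      rw [pow_succ', mul_div_assoc]
      congr 3
      ring
    rw [h5, mul_add, pow_zero, add_zero]
    have h6 : (2 : ℝ) ^ 400 * (1 / (2 * i + 1)) = 2 ^ 400 / (2 * i + 1) := by ring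
    rw [h6]
    linarith

theorem le_seriesUp {w : ℕ} {t : ℝ} (ht0 : 0 ≤ t) (ht : t * 2 ^ 400 ≤ w) (m i : ℕ) :
    2 ^ 400 * ∑ k ∈ Finset.range m, t ^ k / (2 * (i + k : ℕ) + 1) ≤ (seriesUp w m i : ℝ) := by
  induction m generalizing i with
  | zero => simp [seriesUp]
  | succ m ih =>
    rw [seriesUp, Finset.sum_range_succ']
    push_cast
    have h1 := le_natCast_div_add_one (2 ^ 400) (2 * i + 1)
    have h2 := le_natCast_div_add_one (w * seriesUp w m (i + 1)) (2 ^ 400)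
    have h3 := ih (i + 1)
    push_cast at h1 h2 h3
    have h4 : t * (2 ^ 400 * ∑ k ∈ Finset.range m, t ^ k / (2 * (i + 1 + k) + 1)) ≤
        (w : ℝ) * seriesUp w m (i + 1) / 2 ^ 400 := by
      rw [le_div_iff₀ (by positivity)]
      calc _ = (t * 2 ^ 400) * (2 ^ 400 * ∑ k ∈ Finset.range m, t ^ k / (2 * (i + 1 + k : ℝ) + 1)) := by
            ring
        _ ≤ _ := mul_le_mul ht h3 (by positivity) (by positivity)
    have h5 : ∑ k ∈ Finset.range m, t ^ (k + 1) / (2 * (i + (k + 1) : ℝ) + 1) =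
        t * ∑ k ∈ Finset.range m, t ^ k / (2 * (i + 1 + k : ℝ) + 1) := by
      rw [Finset.mul_sum]
      refine Finset.sum_congr rfl fun k _ => ?_
      rw [pow_succ', mul_div_assoc]
      congr 3
      ring
    rw [h5, mul_add, pow_zero, add_zero]
    have h6 : (2 : ℝ) ^ 400 * (1 / (2 * i + 1)) = 2 ^ 400 / (2 * i + 1) := by ring
    rw [h6]
    linarith

/-- Lower approximation to `log ((1 + n / d) / (1 - n / d))`, scaled by `2 ^ 400`. -/
def artanhDn (n d : ℕ) : ℕ :=
  2 * ((2 ^ 400 * n / d) * seriesDn ((2 ^ 400 * n / d) * (2 ^ 400 * n / d) / 2 ^ 400) 130 0 / 2 ^ 400)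

/-- Upper approximation to `log ((1 + n / d) / (1 - n / d))`, scaled by `2 ^ 400`. -/
def artanhUp (n d : ℕ) : ℕ :=
  2 * ((2 ^ 400 * n / d + 1) *
    seriesUp ((2 ^ 400 * n / d + 1) * (2 ^ 400 * n / d + 1) / 2 ^ 400 + 1) 130 0 / 2 ^ 400 + 2)

theorem sum_odd_eq (z : ℝ) (m : ℕ) :
    ∑ k ∈ Finset.range m, z ^ (2 * k + 1) / (2 * k + 1) =
      z * ∑ k ∈ Finset.range m, (z ^ 2) ^ k / (2 * (0 + k : ℕ) + 1) := by
  rw [Finset.mul_sum]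
  refine Finset.sum_congr rfl fun k _ => ?_
  rw [zero_add, pow_succ', pow_mul, mul_div_assoc]

set_option exponentiation.threshold 2000 in
theorem third_pow_le : (1 / 3 : ℝ) ^ (2 * 130 + 1) / (8 / 9) ≤ 1 / 2 ^ 400 := by norm_num

theorem artanhDn_le {n d : ℕ} {z : ℝ} (hz : z = n / d) (hz1 : z ≤ 1 / 3) :
    (artanhDn n d : ℝ) ≤ Real.log ((1 + z) / (1 - z)) * 2 ^ 400 := by
  have hz0 : 0 ≤ z := by rw [hz]; positivity
  have h1 := Real.sum_range_le_log_div hz0 (by linarith) 130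
  rw [sum_odd_eq] at h1
  have hq : ((2 ^ 400 * n / d : ℕ) : ℝ) ≤ z * 2 ^ 400 := by
    refine (natCast_div_le _ _).trans (le_of_eq ?_)
    push_cast
    rw [hz]
    ring
  unfold artanhDn
  generalize 2 ^ 400 * n / d = q at hq
  have hw : ((q * q / 2 ^ 400 : ℕ) : ℝ) ≤ z ^ 2 * 2 ^ 400 := by
    refine (natCast_div_le _ _).trans ?_
    push_cast
    rw [div_le_iff₀ (by positivity)]
    calc _ ≤ (z * 2 ^ 400) * (z * 2 ^ 400) := by gcongr
      _ = _ := by ring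
  have hs := seriesDn_le hw 130 0
  generalize seriesDn _ 130 0 = s at hs
  have h3 := natCast_div_le (q * s) (2 ^ 400)
  have h4 : ((q * s : ℕ) : ℝ) / (2 ^ 400 : ℕ) ≤
      z * (2 ^ 400 * ∑ k ∈ Finset.range 130, (z ^ 2) ^ k / (2 * (0 + k : ℕ) + 1)) := by
    rw [div_le_iff₀ (by positivity)]
    calc ((q * s : ℕ) : ℝ) = q * s := by push_cast; rfl
      _ ≤ (z * 2 ^ 400) * (2 ^ 400 *
          ∑ k ∈ Finset.range 130, (z ^ 2) ^ k / (2 * ((0 + k : ℕ) : ℝ) + 1)) :=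
        mul_le_mul hq hs (by positivity) (by positivity)
      _ = _ := by push_cast; ring
  generalize ∑ k ∈ Finset.range 130, (z ^ 2) ^ k / (2 * ((0 + k : ℕ) : ℝ) + 1) = T at *
  have h5 := mul_le_mul_of_nonneg_right h1 (show (0 : ℝ) ≤ 2 ^ 400 by positivity)
  have h6 := h3.trans h4
  rw [Nat.cast_mul, Nat.cast_ofNat]
  generalize (2 : ℝ) ^ 400 = C at h5 h6 ⊢
  linarith

theorem le_artanhUp {n d : ℕ} {z : ℝ} (hz : z = n / d) (hz1 : z ≤ 1 / 3) :
    Real.log ((1 + z) / (1 - z)) * 2 ^ 400 ≤ (artanhUp n d : ℝ) := by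
  have hz0 : 0 ≤ z := by rw [hz]; positivity
  have h1 := Real.log_div_le_sum_range_add hz0 (by linarith) 130
  rw [sum_odd_eq] at h1
  have hrem : z ^ (2 * 130 + 1) / (1 - z ^ 2) ≤ 1 / 2 ^ 400 := by
    have h2 : 8 / 9 ≤ 1 - z ^ 2 := by nlinarith
    calc _ ≤ (1 / 3 : ℝ) ^ (2 * 130 + 1) / (8 / 9) := by gcongr
      _ ≤ _ := third_pow_le
  have hq : z * 2 ^ 400 ≤ ((2 ^ 400 * n / d + 1 : ℕ) : ℝ) := by
    rw [Nat.cast_add, Nat.cast_one]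
    refine le_trans (le_of_eq ?_) (le_natCast_div_add_one _ _)
    push_cast
    rw [hz]
    ring
  unfold artanhUp
  generalize 2 ^ 400 * n / d + 1 = q at hq
  have hw : z ^ 2 * 2 ^ 400 ≤ ((q * q / 2 ^ 400 + 1 : ℕ) : ℝ) := by
    rw [Nat.cast_add, Nat.cast_one]
    refine le_trans ?_ (le_natCast_div_add_one _ _)
    push_cast
    rw [le_div_iff₀ (by positivity)]
    calc _ = (z * 2 ^ 400) * (z * 2 ^ 400) := by ring
      _ ≤ _ := by gcongr
  have hs := le_seriesUp (by positivity) hw 130 0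
  generalize seriesUp _ 130 0 = s at hs
  have h3 := le_natCast_div_add_one (q * s) (2 ^ 400)
  have h4 : z * (2 ^ 400 * ∑ k ∈ Finset.range 130, (z ^ 2) ^ k / (2 * (0 + k : ℕ) + 1)) ≤
      ((q * s : ℕ) : ℝ) / (2 ^ 400 : ℕ) := by
    rw [le_div_iff₀ (by positivity)]
    calc _ = (z * 2 ^ 400) * (2 ^ 400 *
          ∑ k ∈ Finset.range 130, (z ^ 2) ^ k / (2 * ((0 + k : ℕ) : ℝ) + 1)) := by push_cast; ring
      _ ≤ q * s := mul_le_mul hq hs (by positivity) (by positivity)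
      _ = _ := by push_cast; ring
  generalize ∑ k ∈ Finset.range 130, (z ^ 2) ^ k / (2 * ((0 + k : ℕ) : ℝ) + 1) = T at *
  rw [le_div_iff₀ (by positivity)] at hrem
  have h5 := mul_le_mul_of_nonneg_right h1 (show (0 : ℝ) ≤ 2 ^ 400 by positivity)
  have h6 := h4.trans h3
  rw [Nat.cast_mul, Nat.cast_ofNat, Nat.cast_add, Nat.cast_ofNat]
  rw [add_mul] at h5
  generalize z ^ (2 * 130 + 1) / (1 - z ^ 2) * 2 ^ 400 = D at h5 hrem
  generalize (2 : ℝ) ^ 400 = C at h5 h6 ⊢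
  linarith

/-- An interval for the logarithm of `n / 2 ^ 400`. -/
def logNat (n : ℕ) : ℤ × ℤ :=
  add (smul ((n.log2 : ℤ) - 400) (artanhDn 1 3, artanhUp 1 3))
    (artanhDn (n - 2 ^ n.log2) (n + 2 ^ n.log2), artanhUp (n - 2 ^ n.log2) (n + 2 ^ n.log2))

theorem of_logNat {n : ℕ} (hn : 0 < n) : Encl (Real.log (n / 2 ^ 400)) (logNat n) := by
  have hlow : 2 ^ n.log2 ≤ n := Nat.log2_self_le hn.ne'
  have hupp : n < 2 ^ (n.log2 + 1) := Nat.lt_log2_self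
  unfold logNat
  generalize n.log2 = e at *
  have hlow' : (2 : ℝ) ^ e ≤ n := by exact_mod_cast hlow
  have hupp' : (n : ℝ) ≤ 2 * 2 ^ e := by
    rw [← pow_succ']
    exact_mod_cast hupp.le
  have he : (0 : ℝ) < 2 ^ e := by positivity
  have hlog : Real.log (n / 2 ^ 400) = ((e : ℤ) - 400 : ℤ) * Real.log 2 + Real.log (n / 2 ^ e) := by
    have hn' : (n : ℝ) ≠ 0 := by exact_mod_cast hn.ne'
    rw [Real.log_div hn' (by positivity), Real.log_div hn' (by positivity), Real.log_pow,
      Real.log_pow]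
    push_cast
    ring
  rw [hlog]
  refine of_add (of_smul _ ?_) ?_
  · have h : (1 / 3 : ℝ) = (1 : ℕ) / (3 : ℕ) := by norm_num
    have h2 : (1 + 1 / 3) / (1 - 1 / 3 : ℝ) = 2 := by norm_num
    have h3 := artanhDn_le h le_rfl
    have h4 := le_artanhUp h le_rfl
    rw [h2] at h3 h4
    exact ⟨by exact_mod_cast h3, by exact_mod_cast h4⟩
  · have h : ((n - 2 ^ e) / (n + 2 ^ e) : ℝ) = (n - 2 ^ e : ℕ) / (n + 2 ^ e : ℕ) := by
      rw [Nat.cast_sub hlow]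
      push_cast
      rfl
    have h2 : (1 + (n - 2 ^ e) / (n + 2 ^ e)) / (1 - (n - 2 ^ e) / (n + 2 ^ e) : ℝ) = n / 2 ^ e := by
      have : (0 : ℝ) < n + 2 ^ e := by positivity
      field_simp
      ring
    have h1 : ((n - 2 ^ e) / (n + 2 ^ e) : ℝ) ≤ 1 / 3 := by
      rw [div_le_iff₀ (by positivity)]
      linarith
    have h3 := artanhDn_le h h1
    have h4 := le_artanhUp h h1
    rw [h2] at h3 h4
    exact ⟨by exact_mod_cast h3, by exact_mod_cast h4⟩

/-- An interval for `log |x|` computed from an interval for `x` that avoids zero. -/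
def logAbs (p : ℤ × ℤ) : ℤ × ℤ :=
  if 0 < p.1 then ((logNat p.1.toNat).1, (logNat p.2.toNat).2)
  else ((logNat (-p.2).toNat).1, (logNat (-p.1).toNat).2)

/-- Whether an interval avoids zero. -/
def avoidsZero (p : ℤ × ℤ) : Bool := decide (0 < p.1) || decide (p.2 < 0)

theorem of_logAbs_of_pos {x : ℝ} {p : ℤ × ℤ} (hx : Encl x p) (h : 0 < p.1) :
    Encl (Real.log x) ((logNat p.1.toNat).1, (logNat p.2.toNat).2) := by
  obtain ⟨h1, h2⟩ := hx
  have hS : (0 : ℝ) < 2 ^ 400 := by positivity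
  have h0 : (0 : ℝ) < p.1 := by exact_mod_cast h
  have h3 : ((p.1.toNat : ℕ) : ℝ) = p.1 := by exact_mod_cast Int.toNat_of_nonneg h.le
  have hp2 : (0 : ℝ) < p.2 := by linarith
  have hp2' : 0 < p.2 := by exact_mod_cast hp2
  have h4 : ((p.2.toNat : ℕ) : ℝ) = p.2 := by exact_mod_cast Int.toNat_of_nonneg hp2'.le
  have hxpos : 0 < x := by
    exact (pos_iff_pos_of_mul_pos (h0.trans_le h1)).2 hS
  have h5 := (of_logNat (n := p.1.toNat) (by omega)).1
  have h6 := (of_logNat (n := p.2.toNat) (by omega)).2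
  rw [h3] at h5
  rw [h4] at h6
  constructor
  · refine h5.trans (mul_le_mul_of_nonneg_right (Real.log_le_log (by positivity) ?_) hS.le)
    rwa [div_le_iff₀ hS]
  · refine le_trans (mul_le_mul_of_nonneg_right (Real.log_le_log hxpos ?_) hS.le) h6
    rwa [le_div_iff₀ hS]

theorem of_logAbs {x : ℝ} {p : ℤ × ℤ} (hx : Encl x p) (h : avoidsZero p = true) :
    Encl (Real.log |x|) (logAbs p) := by
  rw [Real.log_abs]
  unfold logAbs
  split_ifs with h0
  · exact of_logAbs_of_pos hx h0
  · have h1 : p.2 < 0 := by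
      simpa [avoidsZero, h0] using h
    have := of_logAbs_of_pos (of_neg hx) (by simpa [neg] using h1)
    rwa [Real.log_neg_eq_log] at this

end Encl

/-- The numerators of lower approximations, with denominator `2 ^ 400`, to the roots of the
quartic. -/
def rootNum : Fin 4 → ℤ :=
  ![-8849866534916381056174843993506409925642085970269889650426508640960714531704314455831502023917267273852061559552757703861,
    -1289538732948670518019097211029197424814421409361166630068366350550399712942442927669651416490834569138201158930919569180,
    7122119127337781634693219644349911432785261120516387515371569322111025382813245574518225528326836900946541776186236216498,
    26257535043309447246403994108212802786638598394577680380599239878265917459985082560649736091602505424966849490052168496926]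

/-- The dehomogenised quartic form. -/
def quartic {K : Type*} [Field K] (x : K) : K := x ^ 4 - 9 * x ^ 3 - 21 * x ^ 2 + 88 * x + 48

theorem exists_mem_Icc_eq_zero {g : ℝ → ℝ} (hg : Continuous g) {a b : ℝ} (hab : a ≤ b)
    (h : g a * g b ≤ 0) : ∃ x ∈ Set.Icc a b, g x = 0 := by
  rcases le_total (g a) 0 with ha | ha
  · rcases le_total 0 (g b) with hb | hb
    · exact intermediate_value_Icc hab hg.continuousOn ⟨ha, hb⟩
    · rcases ha.eq_or_lt with h0 | h0
      · exact ⟨a, Set.left_mem_Icc.2 hab, h0⟩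
      · exact ⟨b, Set.right_mem_Icc.2 hab, by nlinarith⟩
  · rcases le_total (g b) 0 with hb | hb
    · exact intermediate_value_Icc' hab hg.continuousOn ⟨hb, ha⟩
    · rcases ha.eq_or_lt with h0 | h0
      · exact ⟨a, Set.left_mem_Icc.2 hab, h0.symm⟩
      · exact ⟨b, Set.right_mem_Icc.2 hab, by nlinarith⟩

/-- The homogenised quartic with denominator `2 ^ 400`. -/
def quarticNum (a : ℤ) : ℤ :=
  a ^ 4 - 9 * a ^ 3 * 2 ^ 400 - 21 * a ^ 2 * 2 ^ 800 + 88 * a * 2 ^ 1200 + 48 * 2 ^ 1600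

theorem quartic_div (a : ℤ) : quartic ((a : ℝ) / 2 ^ 400) = ((quarticNum a : ℤ) : ℝ) / (2 : ℝ) ^ 1600 := by
  rw [show (1600 : ℕ) = 400 * 4 from rfl, pow_mul]
  simp only [quartic, quarticNum]
  rw [show (800 : ℕ) = 400 * 2 from rfl, show (1200 : ℕ) = 400 * 3 from rfl,
    show (1600 : ℕ) = 400 * 4 from rfl, pow_mul, pow_mul, pow_mul]
  have h : (0 : ℝ) < 2 ^ 400 := by positivity
  push_cast
  generalize (2 : ℝ) ^ 400 = S at *
  field_simp

theorem quarticNum_sign (i : Fin 4) : quarticNum (rootNum i) * quarticNum (rootNum i + 1) ≤ 0 := by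
  revert i
  decide +kernel

theorem exists_root (i : Fin 4) :
    ∃ x : ℝ, Encl x (rootNum i, rootNum i + 1) ∧ quartic x = 0 := by
  have hS : (0 : ℝ) < 2 ^ 400 := by positivity
  have hcont : Continuous fun x : ℝ => quartic x := by
    unfold quartic
    fun_prop
  obtain ⟨x, hx, h0⟩ := exists_mem_Icc_eq_zero hcont
    (a := (rootNum i : ℝ) / 2 ^ 400) (b := ((rootNum i + 1 : ℤ) : ℝ) / 2 ^ 400)
    (by gcongr; omega) (by
      rw [quartic_div, quartic_div, div_mul_div_comm]
      have h : (quarticNum (rootNum i) : ℝ) * quarticNum (rootNum i + 1) ≤ 0 := by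
        exact_mod_cast quarticNum_sign i
      exact div_nonpos_of_nonpos_of_nonneg h (by positivity))
  exact ⟨x, ⟨(div_le_iff₀ hS).1 hx.1, (le_div_iff₀ hS).1 hx.2⟩, h0⟩

/-- The four real roots of the quartic. -/
noncomputable def rt (i : Fin 4) : ℝ := (exists_root i).choose

theorem encl_rt (i : Fin 4) : Encl (rt i) (rootNum i, rootNum i + 1) :=
  (exists_root i).choose_spec.1

theorem quartic_rt (i : Fin 4) : quartic (rt i) = 0 := (exists_root i).choose_spec.2

/-- A field element given by its integer coordinates on `1`, `a`, `a ^ 2` and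
`(4 + 7 * a + 11 * a ^ 2 + a ^ 3) / 16`. -/
def ev {K : Type*} [Field K] (a : K) (v : ℤ × ℤ × ℤ × ℤ) : K :=
  v.1 + v.2.1 * a + v.2.2.1 * a ^ 2 + v.2.2.2 * ((4 + 7 * a + 11 * a ^ 2 + a ^ 3) / 16)

/-- Multiplication of coordinate vectors. -/
def mulVec (u v : ℤ × ℤ × ℤ × ℤ) : ℤ × ℤ × ℤ × ℤ :=
  (u.1 * v.1 - 4 * (u.2.1 * v.2.2.1 + u.2.2.1 * v.2.1) - 8 * (u.2.1 * v.2.2.2 + u.2.2.2 * v.2.1)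
      - 84 * (u.2.2.1 * v.2.2.1) - 112 * (u.2.2.1 * v.2.2.2 + u.2.2.2 * v.2.2.1)
      - 154 * (u.2.2.2 * v.2.2.2),
    u.1 * v.2.1 + u.2.1 * v.1 - 7 * (u.2.1 * v.2.2.1 + u.2.2.1 * v.2.1)
      - 14 * (u.2.1 * v.2.2.2 + u.2.2.2 * v.2.1) - 151 * (u.2.2.1 * v.2.2.1)
      - 204 * (u.2.2.1 * v.2.2.2 + u.2.2.2 * v.2.2.1) - 282 * (u.2.2.2 * v.2.2.2),
    u.1 * v.2.2.1 + u.2.2.1 * v.1 + u.2.1 * v.2.1 - 11 * (u.2.1 * v.2.2.1 + u.2.2.1 * v.2.1)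
      - 12 * (u.2.1 * v.2.2.2 + u.2.2.2 * v.2.1) - 78 * (u.2.2.1 * v.2.2.1)
      - 122 * (u.2.2.1 * v.2.2.2 + u.2.2.2 * v.2.2.1) - 174 * (u.2.2.2 * v.2.2.2),
    u.1 * v.2.2.2 + u.2.2.2 * v.1 + 16 * (u.2.1 * v.2.2.1 + u.2.2.1 * v.2.1)
      + 20 * (u.2.1 * v.2.2.2 + u.2.2.2 * v.2.1) + 144 * (u.2.2.1 * v.2.2.1)
      + 208 * (u.2.2.1 * v.2.2.2 + u.2.2.2 * v.2.2.1) + 290 * (u.2.2.2 * v.2.2.2))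

theorem ev_mulVec {K : Type*} [Field K] [CharZero K] {a : K} (ha : quartic a = 0)
    (u v : ℤ × ℤ × ℤ × ℤ) : ev a (mulVec u v) = ev a u * ev a v := by
  obtain ⟨u0, u1, u2, u3⟩ := u
  obtain ⟨v0, v1, v2, v3⟩ := v
  simp only [ev, mulVec, quartic] at *
  push_cast
  linear_combination (-((u1*v3+u3*v1)/16 + u2*v2 + (u2*v3+u3*v2)*(5/4+a/16)
    + u3*v3*(435/256+31/256*a+a^2/256) : K)) * ha

theorem ev_one {K : Type*} [Field K] (a : K) : ev a (1, 0, 0, 0) = 1 := by simp [ev]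

theorem map_ev {K L : Type*} [Field K] [Field L] (φ : K →+* L) (a : K) (v : ℤ × ℤ × ℤ × ℤ) :
    φ (ev a v) = ev (φ a) v := by
  simp [ev, map_ofNat φ]

theorem map_quartic {K L : Type*} [Field K] [Field L] (φ : K →+* L) (a : K) :
    φ (quartic a) = quartic (φ a) := by
  simp [quartic, map_ofNat φ]

theorem isIntegral_of_quartic {K : Type*} [Field K] {a : K} (ha : quartic a = 0) :
    IsIntegral ℤ a := by
  refine ⟨Polynomial.X ^ 4 + (-9 * Polynomial.X ^ 3 - 21 * Polynomial.X ^ 2 + 88 * Polynomial.X + 48),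
    ?_, ?_⟩
  · refine Polynomial.monic_X_pow_add ?_
    compute_degree!
  · simp only [quartic] at ha
    simp only [Polynomial.eval₂_add, Polynomial.eval₂_sub, Polynomial.eval₂_mul,
      Polynomial.eval₂_pow, Polynomial.eval₂_X, Polynomial.eval₂_neg, Polynomial.eval₂_ofNat]
    linear_combination ha

theorem isIntegral_ev {K : Type*} [Field K] [CharZero K] {a : K} (ha : quartic a = 0)
    (v : ℤ × ℤ × ℤ × ℤ) : IsIntegral ℤ (ev a v) := by
  have h1 := isIntegral_of_quartic ha
  have hInt : ∀ n : ℤ, IsIntegral ℤ (n : K) := fun n => isIntegral_algebraMap (R := ℤ) (x := n)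
  have h3 : IsIntegral ℤ (ev a (0, 0, 0, 1)) := by
    have h := fun u v => ev_mulVec ha u v
    set d := ev a (0, 0, 0, 1) with hd
    have h2 := h (0, 0, 0, 1) (0, 0, 0, 1)
    have h4 := h (mulVec (0, 0, 0, 1) (0, 0, 0, 1)) (mulVec (0, 0, 0, 1) (0, 0, 0, 1))
    have h3 := h (mulVec (0, 0, 0, 1) (0, 0, 0, 1)) (0, 0, 0, 1)
    rw [← hd] at h2 h3
    rw [h2] at h3 h4
    refine ⟨Polynomial.X ^ 4 + (-154 * Polynomial.X ^ 3 + 1806 * Polynomial.X ^ 2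
      - 5224 * Polynomial.X + 952), ?_, ?_⟩
    · refine Polynomial.monic_X_pow_add ?_
      compute_degree!
    · simp only [Polynomial.eval₂_add, Polynomial.eval₂_sub, Polynomial.eval₂_mul,
        Polynomial.eval₂_pow, Polynomial.eval₂_X, Polynomial.eval₂_neg, Polynomial.eval₂_ofNat]
      have h5 : d ^ 4 = ev a (mulVec (mulVec (0, 0, 0, 1) (0, 0, 0, 1))
        (mulVec (0, 0, 0, 1) (0, 0, 0, 1))) := by rw [h4]; ring
      have h6 : d ^ 3 = ev a (mulVec (mulVec (0, 0, 0, 1) (0, 0, 0, 1)) (0, 0, 0, 1)) := by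
        rw [h3]; ring
      have h7 : d ^ 2 = ev a (mulVec (0, 0, 0, 1) (0, 0, 0, 1)) := by rw [h2]; ring
      rw [h5, h6, h7, hd]
      simp only [ev, mulVec]
      push_cast
      ring
  have h : ev a v = v.1 + v.2.1 * a + v.2.2.1 * a ^ 2 + v.2.2.2 * ev a (0, 0, 0, 1) := by
    simp [ev]
  rw [h]
  exact (((hInt _).add ((hInt _).mul h1)).add ((hInt _).mul (h1.pow 2))).add ((hInt _).mul h3)

/-- The quartic factors completely over a field containing four distinct roots. -/
theorem quartic_eq_prod {K : Type*} [Field K] {r : Fin 4 → K} (hr : ∀ i, quartic (r i) = 0)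
    (hinj : Function.Injective r) (x y : K) :
    x ^ 4 - 9 * x ^ 3 * y - 21 * x ^ 2 * y ^ 2 + 88 * x * y ^ 3 + 48 * y ^ 4 =
      ∏ i, (x - r i * y) := by
  have hne : ∀ i j, i ≠ j → r i - r j ≠ 0 := fun i j h => sub_ne_zero.2 (hinj.ne h)
  have h01 := hne 0 1 (by decide)
  have h02 := hne 0 2 (by decide)
  have h12 := hne 1 2 (by decide)
  have h03 := hne 0 3 (by decide)
  have h13 := hne 1 3 (by decide)
  have h23 := hne 2 3 (by decide)
  have e0 := hr 0
  have e1 := hr 1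
  have e2 := hr 2
  have e3 := hr 3
  rw [Fin.prod_univ_four]
  generalize r 0 = a at *
  generalize r 1 = b at *
  generalize r 2 = c at *
  generalize r 3 = d at *
  simp only [quartic] at *
  have step : ∀ u v : K, u - v ≠ 0 → u ^ 4 - 9 * u ^ 3 - 21 * u ^ 2 + 88 * u + 48 = 0 →
      v ^ 4 - 9 * v ^ 3 - 21 * v ^ 2 + 88 * v + 48 = 0 →
      u ^ 3 + u ^ 2 * v + u * v ^ 2 + v ^ 3 - 9 * (u ^ 2 + u * v + v ^ 2) - 21 * (u + v) + 88 = 0 := by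
    intro u v h hu hv
    refine mul_left_cancel₀ h ?_
    linear_combination hu - hv
  have f01 := step a b h01 e0 e1
  have f02 := step a c h02 e0 e2
  have f03 := step a d h03 e0 e3
  have step2 : ∀ u v : K, u - v ≠ 0 →
      a ^ 3 + a ^ 2 * u + a * u ^ 2 + u ^ 3 - 9 * (a ^ 2 + a * u + u ^ 2) - 21 * (a + u) + 88 = 0 →
      a ^ 3 + a ^ 2 * v + a * v ^ 2 + v ^ 3 - 9 * (a ^ 2 + a * v + v ^ 2) - 21 * (a + v) + 88 = 0 →
      a ^ 2 + u ^ 2 + v ^ 2 + a * u + a * v + u * v - 9 * (a + u + v) - 21 = 0 := by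
    intro u v h hu hv
    refine mul_left_cancel₀ h ?_
    linear_combination hu - hv
  have g12 := step2 b c h12 f01 f02
  have g13 := step2 b d h13 f01 f03
  have k : a + b + c + d - 9 = 0 := by
    refine mul_left_cancel₀ h23 ?_
    linear_combination g12 - g13
  linear_combination y ^ 4 * e0 + f01 * (x - a * y) * y ^ 3 + g12 * (x - a * y) * (x - b * y) * y ^ 2
    + k * (x - a * y) * (x - b * y) * (x - c * y) * y

/-- A matrix with an approximate left inverse: bounds for the solution of a linear system. -/
theorem abs_le_of_approx_inverse {n : ℕ} {M P : Matrix (Fin n) (Fin n) ℝ} {e D : ℝ}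
    (he : ∀ s t, |(P * M) s t - (1 : Matrix (Fin n) (Fin n) ℝ) s t| ≤ e) {b V C : Fin n → ℝ}
    (hV : ∀ i, |(M.mulVec b) i| ≤ V i) (hC : ∀ s, ∑ i, |P s i| * V i ≤ C s)
    (hne : n * e < 1) (hD : ∑ s, C s ≤ (1 - n * e) * D) (he0 : 0 ≤ e) (s : Fin n) :
    |b s| ≤ C s + e * D := by
  have h1 : ∀ s, |b s| ≤ C s + e * ∑ t, |b t| := by
    intro s
    have h2 : b s = ∑ i, P s i * (M.mulVec b) i -
        ∑ t, ((P * M) s t - (1 : Matrix (Fin n) (Fin n) ℝ) s t) * b t := by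
      have h3 : ∑ i, P s i * (M.mulVec b) i = ((P * M).mulVec b) s := by
        rw [← Matrix.mulVec_mulVec]
        rfl
      have h4 : b s = ((1 : Matrix (Fin n) (Fin n) ℝ).mulVec b) s := by rw [Matrix.one_mulVec]
      simp only [sub_mul, Finset.sum_sub_distrib]
      rw [h3]
      conv_lhs => rw [h4]
      simp only [Matrix.mulVec, dotProduct]
      ring
    rw [h2]
    refine (abs_sub _ _).trans (add_le_add ?_ ?_)
    · refine (Finset.abs_sum_le_sum_abs _ _).trans (le_trans (Finset.sum_le_sum fun i _ => ?_) (hC s))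
      rw [abs_mul]
      exact mul_le_mul_of_nonneg_left (hV i) (abs_nonneg _)
    · rw [Finset.mul_sum]
      refine (Finset.abs_sum_le_sum_abs _ _).trans (Finset.sum_le_sum fun i _ => ?_)
      rw [abs_mul]
      exact mul_le_mul_of_nonneg_right (he s i) (abs_nonneg _)
  have h2 : ∑ t, |b t| ≤ ∑ s, C s + n * (e * ∑ t, |b t|) := by
    calc _ ≤ ∑ s, (C s + e * ∑ t, |b t|) := Finset.sum_le_sum fun s _ => h1 s
      _ = _ := by simp [Finset.sum_add_distrib]
  have h3 : ∑ t, |b t| ≤ D := by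
    refine le_of_mul_le_mul_left (a := 1 - n * e) ?_ (by linarith)
    linarith
  exact (h1 s).trans (by gcongr)

theorem mulVec_surjective_of_approx_inverse {n : ℕ} {M P : Matrix (Fin n) (Fin n) ℝ} {e : ℝ}
    (he : ∀ s t, |(P * M) s t - (1 : Matrix (Fin n) (Fin n) ℝ) s t| ≤ e) (hne : n * e < 1)
    (he0 : 0 ≤ e) : Function.Injective M.mulVec ∧ Function.Surjective M.mulVec := by
  have h : ∀ b, M.mulVec b = 0 → b = 0 := by
    intro b hb
    funext s
    have := abs_le_of_approx_inverse he (b := b) (V := 0) (C := 0) (D := 0)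
      (fun i => by simp [hb]) (by simp) hne (by simp) he0 s
    simpa using this
  have hinj : Function.Injective M.mulVecLin := by
    rw [injective_iff_map_eq_zero]
    exact h
  exact ⟨hinj, LinearMap.injective_iff_surjective.1 hinj⟩

namespace Encl

/-- An interval for a quarter of the basis element `(4 + 7 * a + 11 * a ^ 2 + a ^ 3) / 16`. -/
def delta (p : ℤ × ℤ) : ℤ × ℤ :=
  let q := add (4 * 2 ^ 400, 4 * 2 ^ 400) (add (smul 7 p) (add (smul 11 (mul p p)) (mul (mul p p) p)))
  (q.1 / 16, q.2 / 16 + 1)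

/-- An interval for the value at the `i`-th root of the element with coordinates `v`. -/
def evI (i : Fin 4) (v : ℤ × ℤ × ℤ × ℤ) : ℤ × ℤ :=
  let p := (rootNum i, rootNum i + 1)
  add (v.1 * 2 ^ 400, v.1 * 2 ^ 400)
    (add (smul v.2.1 p) (add (smul v.2.2.1 (mul p p)) (smul v.2.2.2 (delta p))))

theorem of_delta {x : ℝ} {p : ℤ × ℤ} (hx : Encl x p) :
    Encl ((4 + 7 * x + 11 * x ^ 2 + x ^ 3) / 16) (delta p) := by
  have h := of_add (of_int 4) (of_add (of_smul 7 hx) (of_add (of_smul 11 (of_mul hx hx))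
    (of_mul (of_mul hx hx) hx)))
  simp only [delta]
  generalize add (4 * 2 ^ 400, 4 * 2 ^ 400) (add (smul 7 p) (add (smul 11 (mul p p))
    (mul (mul p p) p))) = q at *
  obtain ⟨h1, h2⟩ := h
  have h3 : ((q.1 / 16 : ℤ) : ℝ) * 16 ≤ q.1 := by
    exact_mod_cast Int.ediv_mul_le q.1 (by norm_num)
  have h4 : (q.2 : ℝ) ≤ ((q.2 / 16 + 1 : ℤ) : ℝ) * 16 := by
    exact_mod_cast (by omega : q.2 ≤ (q.2 / 16 + 1) * 16)
  push_cast at h1 h2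
  constructor
  · generalize (2 : ℝ) ^ 400 = C at *
    linarith
  · generalize (2 : ℝ) ^ 400 = C at *
    linarith

theorem of_ev (i : Fin 4) (v : ℤ × ℤ × ℤ × ℤ) : Encl (ev (rt i) v) (evI i v) := by
  have hx := encl_rt i
  have h := of_add (of_int v.1) (of_add (of_smul v.2.1 hx) (of_add
    (of_smul v.2.2.1 (of_mul hx hx)) (of_smul v.2.2.2 (of_delta hx))))
  have h1 : ev (rt i) v = v.1 + (v.2.1 * rt i + (v.2.2.1 * (rt i * rt i) +
      v.2.2.2 * ((4 + 7 * rt i + 11 * rt i ^ 2 + rt i ^ 3) / 16))) := by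
    simp only [ev]
    ring
  rw [h1]
  exact h

theorem le_of_snd_le {x : ℝ} {p : ℤ × ℤ} (hx : Encl x p) {a : ℤ} {b : ℕ} (hb : 0 < b)
    (h : p.2 * b ≤ a * 2 ^ 400) : x ≤ a / b := by
  have hb' : (0 : ℝ) < b := by exact_mod_cast hb
  rw [le_div_iff₀ hb']
  have h1 : (p.2 : ℝ) * b ≤ a * 2 ^ 400 := by exact_mod_cast h
  have h2 := mul_le_mul_of_nonneg_right hx.2 hb'.le
  have hS : (0 : ℝ) < 2 ^ 400 := by positivity
  generalize (2 : ℝ) ^ 400 = C at *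
  refine le_of_mul_le_mul_right (a := C) ?_ hS
  linarith

theorem le_of_le_fst {x : ℝ} {p : ℤ × ℤ} (hx : Encl x p) {a : ℤ} {b : ℕ} (hb : 0 < b)
    (h : a * 2 ^ 400 ≤ p.1 * b) : (a / b : ℝ) ≤ x := by
  have hb' : (0 : ℝ) < b := by exact_mod_cast hb
  rw [div_le_iff₀ hb']
  have h1 : (a : ℝ) * 2 ^ 400 ≤ p.1 * b := by exact_mod_cast h
  have h2 := mul_le_mul_of_nonneg_right hx.1 hb'.le
  have hS : (0 : ℝ) < 2 ^ 400 := by positivity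
  generalize (2 : ℝ) ^ 400 = C at *
  refine le_of_mul_le_mul_right (a := C) ?_ hS
  linarith

/-- Decidable lower and upper bounds `a / b ≤ x ≤ c / b` certified by an interval. -/
def within (p : ℤ × ℤ) (a c : ℤ) (b : ℕ) : Bool :=
  decide (0 < b) && decide (a * 2 ^ 400 ≤ p.1 * b) && decide (p.2 * b ≤ c * 2 ^ 400)

theorem of_within {x : ℝ} {p : ℤ × ℤ} (hx : Encl x p) {a c : ℤ} {b : ℕ}
    (h : within p a c b = true) : (a / b : ℝ) ≤ x ∧ x ≤ c / b := by
  simp only [within, Bool.and_eq_true, decide_eq_true_eq] at h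
  exact ⟨le_of_le_fst hx h.1.1 h.1.2, le_of_snd_le hx h.1.1 h.2⟩

end Encl

theorem rt_injective : Function.Injective rt := by
  have h1 : ∀ i j, rootNum i + 1 < rootNum j → rt i < rt j := by
    intro i j h
    have h2 := (encl_rt i).2.trans_lt ((by exact_mod_cast h : ((rootNum i + 1 : ℤ) : ℝ) <
      ((rootNum j : ℤ) : ℝ)).trans_le (encl_rt j).1)
    have hS : (0 : ℝ) < 2 ^ 400 := by positivity
    exact lt_of_mul_lt_mul_right h2 hS.le
  have h2 : ∀ i j, i ≠ j → rootNum i + 1 < rootNum j ∨ rootNum j + 1 < rootNum i := by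
    decide +kernel
  intro i j hij
  by_contra h
  rcases h2 i j h with h | h
  · exact (h1 _ _ h).ne hij
  · exact (h1 _ _ h).ne' hij

open Polynomial in
/-- The quartic as a polynomial with rational coefficients. -/
noncomputable def quarticPoly : ℚ[X] := X ^ 4 - 9 * X ^ 3 - 21 * X ^ 2 + 88 * X + 48

theorem aeval_quarticPoly {K : Type*} [Field K] [Algebra ℚ K] (x : K) :
    Polynomial.aeval x quarticPoly = quartic x := by
  simp [quarticPoly, quartic, map_ofNat]

theorem quarticPoly_ne_zero : quarticPoly ≠ 0 := by
  intro h
  have := aeval_quarticPoly (K := ℚ) 0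
  rw [h] at this
  norm_num [quartic] at this

theorem splits_quarticPoly : (quarticPoly.map (algebraMap ℚ ℝ)).Splits := by
  have h : quarticPoly.map (algebraMap ℚ ℝ) =
      ∏ i, (Polynomial.X - Polynomial.C (rt i)) := by
    refine Polynomial.funext fun x => ?_
    rw [Polynomial.eval_map_algebraMap, aeval_quarticPoly, Polynomial.eval_prod]
    have := quartic_eq_prod quartic_rt rt_injective x 1
    simp only [quartic]
    simpa using this
  rw [h]
  exact Polynomial.Splits.prod fun i _ => Polynomial.Splits.X_sub_C _

/-- The subfield of `ℝ` generated by the roots of the quartic. -/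
noncomputable def rootField : IntermediateField ℚ ℝ :=
  IntermediateField.adjoin ℚ (quarticPoly.rootSet ℝ)

instance : Polynomial.IsSplittingField ℚ rootField quarticPoly :=
  IntermediateField.adjoin_rootSet_isSplittingField splits_quarticPoly

instance : FiniteDimensional ℚ rootField :=
  Polynomial.IsSplittingField.finiteDimensional rootField quarticPoly

instance : NumberField rootField where

instance : IsGalois ℚ rootField where
  to_normal := Normal.of_isSplittingField quarticPoly

theorem rt_mem (i : Fin 4) : rt i ∈ rootField := by
  refine IntermediateField.subset_adjoin ℚ _ ?_
  rw [Polynomial.mem_rootSet]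
  exact ⟨quarticPoly_ne_zero, by rw [aeval_quarticPoly, quartic_rt]⟩

/-- The roots of the quartic as elements of their splitting field. -/
noncomputable def rtL (i : Fin 4) : rootField := ⟨rt i, rt_mem i⟩

@[simp]
theorem algebraMap_rtL (i : Fin 4) : algebraMap rootField ℝ (rtL i) = rt i := rfl

theorem quartic_rtL (i : Fin 4) : quartic (rtL i) = 0 := by
  refine (algebraMap rootField ℝ).injective ?_
  rw [map_quartic, algebraMap_rtL, quartic_rt, map_zero]

theorem rtL_injective : Function.Injective rtL := fun _ _ h =>
  rt_injective (congrArg (algebraMap rootField ℝ) h)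

theorem exists_eq_rtL {x : rootField} (hx : quartic x = 0) : ∃ i, x = rtL i := by
  have h := quartic_eq_prod quartic_rtL rtL_injective x 1
  have h0 : ∏ i, (x - rtL i * 1) = 0 := by
    rw [← h, ← hx]
    simp only [quartic]
    ring
  obtain ⟨i, -, hi⟩ := Finset.prod_eq_zero_iff.1 h0
  exact ⟨i, by linear_combination hi⟩

/-- Automorphisms of the splitting field permute the roots. -/
theorem exists_perm (σ : rootField ≃ₐ[ℚ] rootField) :
    ∃ π : Equiv.Perm (Fin 4), ∀ i, σ (rtL i) = rtL (π i) := by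
  have h : ∀ i, ∃ j, σ (rtL i) = rtL j := fun i => exists_eq_rtL (by
    have := map_quartic (σ : rootField →+* rootField) (rtL i)
    rw [quartic_rtL, map_zero] at this
    exact this.symm)
  choose f hf using h
  have hinj : Function.Injective f := fun i j hij => by
    have : σ (rtL i) = σ (rtL j) := by rw [hf, hf, hij]
    exact rtL_injective (σ.injective this)
  exact ⟨Equiv.ofBijective f (Finite.injective_iff_bijective.1 hinj), hf⟩

theorem algEquiv_ext_rtL {σ τ : rootField ≃ₐ[ℚ] rootField} (h : ∀ i, σ (rtL i) = τ (rtL i)) :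
    σ = τ := by
  have hadj := Polynomial.IsSplittingField.adjoin_rootSet rootField quarticPoly
  have h1 : (σ : rootField →ₐ[ℚ] rootField) = τ := by
    refine AlgHom.ext_of_adjoin_eq_top hadj fun x hx => ?_
    rw [Polynomial.mem_rootSet] at hx
    obtain ⟨i, rfl⟩ := exists_eq_rtL (by rw [← aeval_quarticPoly]; exact hx.2)
    exact h i
  ext x
  exact congrArg Subtype.val (DFunLike.congr_fun h1 x)

theorem card_aut_le : Fintype.card (rootField ≃ₐ[ℚ] rootField) ≤ 24 := by
  choose π hπ using exists_perm
  have hinj : Function.Injective π := fun σ τ h =>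
    algEquiv_ext_rtL fun i => by rw [hπ, hπ, h]
  refine (Fintype.card_le_of_injective π hinj).trans ?_
  simp [Fintype.card_perm, Nat.factorial]

theorem map_ev_rtL {σ : rootField ≃ₐ[ℚ] rootField} {π : Equiv.Perm (Fin 4)}
    (h : ∀ i, σ (rtL i) = rtL (π i)) (i : Fin 4) (v : ℤ × ℤ × ℤ × ℤ) :
    σ (ev (rtL i) v) = ev (rtL (π i)) v := by
  rw [← h]
  exact map_ev (σ : rootField →+* rootField) (rtL i) v

theorem algebraMap_ev_rtL (i : Fin 4) (v : ℤ × ℤ × ℤ × ℤ) :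
    algebraMap rootField ℝ (ev (rtL i) v) = ev (rt i) v :=
  map_ev (algebraMap rootField ℝ) (rtL i) v

/-- A symmetric product of algebraic integers is an integer. -/
theorem exists_int_prod_ev (v : ℤ × ℤ × ℤ × ℤ) : ∃ n : ℤ, ∏ i, ev (rt i) v = n := by
  set x : rootField := ∏ i, ev (rtL i) v with hx
  have hInt : IsIntegral ℤ x := IsIntegral.prod _ fun i _ => isIntegral_ev (quartic_rtL i) v
  have hfix : ∀ σ : rootField ≃ₐ[ℚ] rootField, σ x = x := by
    intro σ
    obtain ⟨π, hπ⟩ := exists_perm σ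
    rw [hx, map_prod]
    simp only [map_ev_rtL hπ]
    exact Equiv.prod_comp π fun i => ev (rtL i) v
  obtain ⟨q, hq⟩ := (IsGalois.mem_range_algebraMap_iff_fixed x).2 hfix
  have hq' : IsIntegral ℤ q := by
    rw [← hq] at hInt
    exact (isIntegral_algebraMap_iff (algebraMap ℚ rootField).injective).1 hInt
  obtain ⟨n, hn⟩ := IsIntegrallyClosed.isIntegral_iff.1 hq'
  refine ⟨n, ?_⟩
  have h1 : algebraMap rootField ℝ x = ∏ i, ev (rt i) v := by
    rw [hx, map_prod]
    simp only [algebraMap_ev_rtL]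
  rw [← h1, ← hq, ← hn]
  simp

theorem prod_ev_eq {v : ℤ × ℤ × ℤ × ℤ} {n : ℤ}
    (h : Encl.within (Encl.mul (Encl.mul (Encl.evI 0 v) (Encl.evI 1 v))
      (Encl.mul (Encl.evI 2 v) (Encl.evI 3 v))) (2 * n - 1) (2 * n + 1) 2 = true) :
    ∏ i, ev (rt i) v = n := by
  obtain ⟨k, hk⟩ := exists_int_prod_ev v
  have h1 := Encl.of_within (Encl.of_mul (Encl.of_mul (Encl.of_ev 0 v) (Encl.of_ev 1 v))
    (Encl.of_mul (Encl.of_ev 2 v) (Encl.of_ev 3 v))) h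
  rw [hk]
  rw [Fin.prod_univ_four] at hk
  rw [← mul_assoc, hk] at h1
  push_cast at h1
  have h2 : (2 * n - 1 : ℝ) ≤ 2 * k := by linarith [h1.1]
  have h3 : (2 * k : ℝ) ≤ 2 * n + 1 := by linarith [h1.2]
  have h4 : 2 * n - 1 ≤ 2 * k := by exact_mod_cast h2
  have h5 : 2 * k ≤ 2 * n + 1 := by exact_mod_cast h3
  have : k = n := by omega
  rw [this]

/-- Three independent units. -/
def eps : Fin 3 → ℤ × ℤ × ℤ × ℤ := ![(1, 2, 0, 0), (-33, -28, -16, 29), (5049, 10822, 4135, -3835)]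

/-- The inverses of the units `eps`. -/
def epsInv : Fin 3 → ℤ × ℤ × ℤ × ℤ :=
  ![(737, -186, -164, 128), (-87, -182, -62, 59), (97059, 141533, -227254, 155207)]

theorem mulVec_eps_epsInv (t : Fin 3) : mulVec (eps t) (epsInv t) = (1, 0, 0, 0) := by
  revert t
  decide +kernel

theorem ev_eps_mul_ev_epsInv {K : Type*} [Field K] [CharZero K] {a : K} (ha : quartic a = 0)
    (t : Fin 3) : ev a (eps t) * ev a (epsInv t) = 1 := by
  rw [← ev_mulVec ha, mulVec_eps_epsInv, ev_one]

theorem ev_eps_ne_zero {K : Type*} [Field K] [CharZero K] {a : K} (ha : quartic a = 0)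
    (t : Fin 3) : ev a (eps t) ≠ 0 := left_ne_zero_of_mul_eq_one (ev_eps_mul_ev_epsInv ha t)

theorem exists_ev_eq_pow {K : Type*} [Field K] [CharZero K] (v : ℤ × ℤ × ℤ × ℤ) (n : ℕ) :
    ∃ c : ℤ × ℤ × ℤ × ℤ, ∀ a : K, quartic a = 0 → ev a c = ev a v ^ n := by
  induction n with
  | zero => exact ⟨(1, 0, 0, 0), fun a _ => by simp [ev_one]⟩
  | succ n ih =>
    obtain ⟨c, hc⟩ := ih
    exact ⟨mulVec c v, fun a ha => by rw [ev_mulVec ha, hc a ha, pow_succ]⟩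

theorem exists_ev_eq_zpow {K : Type*} [Field K] [CharZero K] (t : Fin 3) (n : ℤ) :
    ∃ c : ℤ × ℤ × ℤ × ℤ, ∀ a : K, quartic a = 0 → ev a c = ev a (eps t) ^ n := by
  obtain ⟨n, rfl | rfl⟩ := n.eq_nat_or_neg
  · simpa using exists_ev_eq_pow (eps t) n
  · obtain ⟨c, hc⟩ := exists_ev_eq_pow (K := K) (epsInv t) n
    refine ⟨c, fun a ha => ?_⟩
    rw [hc a ha, zpow_neg, zpow_natCast, ← inv_pow,
      eq_inv_of_mul_eq_one_right (ev_eps_mul_ev_epsInv ha t)]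

theorem exists_ev_eq_prod_zpow (K : Type*) [Field K] [CharZero K] (n : Fin 3 → ℤ) :
    ∃ c : ℤ × ℤ × ℤ × ℤ, ∀ a : K, quartic a = 0 → ev a c = ∏ t, ev a (eps t) ^ n t := by
  choose c hc using fun t => exists_ev_eq_zpow (K := K) t (n t)
  refine ⟨mulVec (mulVec (c 0) (c 1)) (c 2), fun a ha => ?_⟩
  rw [ev_mulVec ha, ev_mulVec ha, hc 0 a ha, hc 1 a ha, hc 2 a ha, Fin.prod_univ_three]

theorem abs_prod_ev_eps (t : Fin 3) : |∏ i, ev (rt i) (eps t)| = 1 := by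
  have h : ∀ t : Fin 3, (Encl.within (Encl.mul (Encl.mul (Encl.evI 0 (eps t)) (Encl.evI 1 (eps t)))
      (Encl.mul (Encl.evI 2 (eps t)) (Encl.evI 3 (eps t)))) (2 * 1 - 1) (2 * 1 + 1) 2 ||
      Encl.within (Encl.mul (Encl.mul (Encl.evI 0 (eps t)) (Encl.evI 1 (eps t)))
      (Encl.mul (Encl.evI 2 (eps t)) (Encl.evI 3 (eps t)))) (2 * -1 - 1) (2 * -1 + 1) 2) = true := by
    decide +kernel
  have h1 := h t
  rw [Bool.or_eq_true] at h1
  rcases h1 with h1 | h1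
  · rw [prod_ev_eq h1]
    simp
  · rw [prod_ev_eq h1]
    simp

/-- The logarithms of the absolute values of the embeddings of the units. -/
noncomputable def unitLog (t : Fin 3) (i : Fin 4) : ℝ := Real.log |ev (rt i) (eps t)|

/-- Intervals for `unitLog`. -/
def unitLogI (t : Fin 3) (i : Fin 4) : ℤ × ℤ := Encl.logAbs (Encl.evI i (eps t))

theorem encl_unitLog (t : Fin 3) (i : Fin 4) : Encl (unitLog t i) (unitLogI t i) := by
  refine Encl.of_logAbs (Encl.of_ev i (eps t)) ?_
  revert t i
  decide +kernel

theorem sum_unitLog (t : Fin 3) : ∑ i, unitLog t i = 0 := by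
  simp only [unitLog]
  rw [← Real.log_prod (fun i _ => abs_ne_zero.2 (ev_eps_ne_zero (quartic_rt i) t)),
    ← Finset.abs_prod, abs_prod_ev_eps, Real.log_one]

/-- Simultaneous approximation by the pigeonhole principle. -/
theorem exists_simultaneous_approx (X : Fin 3 → ℝ) :
    ∃ k : ℕ, 0 < k ∧ k ≤ 343 ∧ ∃ a : Fin 3 → ℤ, ∀ t, |k * X t - a t| ≤ 1 / 7 := by
  let f : Fin 344 → Fin 3 → Fin 7 := fun k t => ⟨⌊7 * Int.fract (k * X t)⌋₊, by
    rw [Nat.floor_lt (by positivity)]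
    have := Int.fract_lt_one ((k : ℕ) * X t)
    push_cast
    linarith⟩
  obtain ⟨k, l, hkl, hf⟩ := Fintype.exists_ne_map_eq_of_card_lt f (by simp)
  wlog h : k < l generalizing k l
  · exact this l k hkl.symm hf.symm (lt_of_le_of_ne (not_lt.1 h) hkl.symm)
  refine ⟨l - k, by omega, by omega, fun t => ⌊l * X t⌋ - ⌊k * X t⌋, fun t => ?_⟩
  have h1 : ⌊7 * Int.fract (k * X t)⌋₊ = ⌊7 * Int.fract (l * X t)⌋₊ :=
    congrArg Fin.val (congrFun hf t)
  have hk := Int.floor_add_fract (k * X t)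
  have hl := Int.floor_add_fract (l * X t)
  have a1 := Nat.floor_le (a := 7 * Int.fract (k * X t)) (by positivity)
  have a2 := Nat.lt_floor_add_one (7 * Int.fract (k * X t))
  have b1 := Nat.floor_le (a := 7 * Int.fract (l * X t)) (by positivity)
  have b2 := Nat.lt_floor_add_one (7 * Int.fract (l * X t))
  rw [h1] at a1 a2
  rw [Nat.cast_sub (by omega)]
  push_cast
  rw [abs_le]
  constructor <;> linarith

/-- The basis of the ring of integers. -/
def basisVec : Fin 4 → ℤ × ℤ × ℤ × ℤ := ![(1, 0, 0, 0), (0, 1, 0, 0), (0, 0, 1, 0), (0, 0, 0, 1)]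

/-- Numerators of an approximate inverse of the matrix of embeddings of the basis. -/
def basisInv : Fin 4 → Fin 4 → ℤ :=
  ![![-406388, 9054032, 1433494, -81138], ![-592602, -2285782, 3028354, -149970],
    ![951518, -2014828, 1154786, -91475], ![-649855, 1572596, -1071609, 148868]]

/-- Numerators of an approximate inverse of the matrix of logarithms of units. -/
def unitInv : Fin 3 → Fin 3 → ℤ :=
  ![![-741414, -1775118, -312912], ![-1013877, -596399, -1176609], ![-484324, -45480, 294026]]

/-- The approximate inverse of the matrix of embeddings of the basis. -/
noncomputable def basisMatInv : Matrix (Fin 4) (Fin 4) ℝ :=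
  Matrix.of fun s i => (basisInv s i : ℝ) / 10 ^ 7

/-- The matrix of embeddings of the basis. -/
noncomputable def basisMat : Matrix (Fin 4) (Fin 4) ℝ := Matrix.of fun i t => ev (rt i) (basisVec t)

/-- The approximate inverse of the matrix of logarithms of units. -/
noncomputable def unitMatInv : Matrix (Fin 3) (Fin 3) ℝ :=
  Matrix.of fun s i => (unitInv s i : ℝ) / 10 ^ 7

/-- The matrix of logarithms of units. -/
noncomputable def unitMat : Matrix (Fin 3) (Fin 3) ℝ := Matrix.of fun i t => unitLog t i.castSucc

theorem basisMatInv_mul (s t : Fin 4) :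
    |(basisMatInv * basisMat) s t - (1 : Matrix (Fin 4) (Fin 4) ℝ) s t| ≤ 1 / 10 ^ 5 := by
  have h : ∀ s t : Fin 4, Encl.within (Encl.add (Encl.add (Encl.add
      (Encl.smul (basisInv s 0) (Encl.evI 0 (basisVec t)))
      (Encl.smul (basisInv s 1) (Encl.evI 1 (basisVec t))))
      (Encl.smul (basisInv s 2) (Encl.evI 2 (basisVec t))))
      (Encl.smul (basisInv s 3) (Encl.evI 3 (basisVec t))))
      ((if s = t then 10 ^ 7 else 0) - 100) ((if s = t then 10 ^ 7 else 0) + 100) 1 = true := by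
    decide +kernel
  have h1 := Encl.of_within (Encl.of_add (Encl.of_add (Encl.of_add
      (Encl.of_smul (basisInv s 0) (Encl.of_ev 0 (basisVec t)))
      (Encl.of_smul (basisInv s 1) (Encl.of_ev 1 (basisVec t))))
      (Encl.of_smul (basisInv s 2) (Encl.of_ev 2 (basisVec t))))
      (Encl.of_smul (basisInv s 3) (Encl.of_ev 3 (basisVec t)))) (h s t)
  have h2 : (((if s = t then 10 ^ 7 else 0 : ℤ)) : ℝ) =
      10 ^ 7 * (1 : Matrix (Fin 4) (Fin 4) ℝ) s t := by
    rw [Matrix.one_apply]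
    split_ifs <;> norm_num
  push_cast at h1 h2
  rw [h2] at h1
  simp only [basisMatInv, basisMat, Matrix.mul_apply, Matrix.of_apply, Fin.sum_univ_four]
  rw [abs_le]
  constructor <;> linarith [h1.1, h1.2]

theorem unitMatInv_mul (s t : Fin 3) :
    |(unitMatInv * unitMat) s t - (1 : Matrix (Fin 3) (Fin 3) ℝ) s t| ≤ 1 / 10 ^ 5 := by
  have h : ∀ s t : Fin 3, Encl.within (Encl.add (Encl.add
      (Encl.smul (unitInv s 0) (unitLogI t 0))
      (Encl.smul (unitInv s 1) (unitLogI t 1)))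
      (Encl.smul (unitInv s 2) (unitLogI t 2)))
      ((if s = t then 10 ^ 7 else 0) - 100) ((if s = t then 10 ^ 7 else 0) + 100) 1 = true := by
    decide +kernel
  have h1 := Encl.of_within (Encl.of_add (Encl.of_add
      (Encl.of_smul (unitInv s 0) (encl_unitLog t 0))
      (Encl.of_smul (unitInv s 1) (encl_unitLog t 1)))
      (Encl.of_smul (unitInv s 2) (encl_unitLog t 2))) (h s t)
  have h2 : (((if s = t then 10 ^ 7 else 0 : ℤ)) : ℝ) =
      10 ^ 7 * (1 : Matrix (Fin 3) (Fin 3) ℝ) s t := by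
    rw [Matrix.one_apply]
    split_ifs <;> norm_num
  push_cast at h1 h2
  rw [h2] at h1
  simp only [unitMatInv, unitMat, Matrix.mul_apply, Matrix.of_apply, Fin.sum_univ_three]
  have e0 : unitLog t (Fin.castSucc 0) = unitLog t 0 := rfl
  have e1 : unitLog t (Fin.castSucc 1) = unitLog t 1 := rfl
  have e2 : unitLog t (Fin.castSucc 2) = unitLog t 2 := rfl
  rw [e0, e1, e2, abs_le]
  constructor <;> linarith [h1.1, h1.2]

/-- Numerators over `10 ^ 9` of lower approximations to the embeddings of the basis. -/
def basisNum : Fin 4 → Fin 3 → ℤ :=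
  ![![-3427192160, 11745646095, 4309823483],
    ![-499385728, 249386104, 195187949],
    ![2758106094, 7607149230, 7997919303],
    ![10168471791, 103397818569, 141497069262]]

theorem basisNum_spec (i : Fin 4) (t : Fin 3) : (basisNum i t : ℝ) / 10 ^ 9 ≤
    ev (rt i) (basisVec t.succ) ∧ ev (rt i) (basisVec t.succ) ≤ ((basisNum i t : ℝ) + 1) / 10 ^ 9 := by
  have h : ∀ (i : Fin 4) (t : Fin 3), Encl.within (Encl.evI i (basisVec t.succ)) (basisNum i t)
      (basisNum i t + 1) (10 ^ 9) = true := by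
    decide +kernel
  have h1 := Encl.of_within (Encl.of_ev i (basisVec t.succ)) (h i t)
  norm_num at h1 ⊢
  exact h1

/-- Bounds, in thousandths, for the embeddings of the units in the fundamental domain. -/
def boxBound : Fin 4 → ℕ := ![18952, 7224, 14533, 4683]

/-- The numerator over `10 ^ 9` of an approximation to an embedding. -/
def evNum (i : Fin 4) (c : ℤ × ℤ × ℤ × ℤ) : ℤ :=
  c.1 * 10 ^ 9 + c.2.1 * basisNum i 0 + c.2.2.1 * basisNum i 1 + c.2.2.2 * basisNum i 2

/-- A vector is `1` or `-1` or is not a unit in the fundamental domain. -/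
def BoxTest (c : ℤ × ℤ × ℤ × ℤ) : Prop :=
  boxBound 0 * 10 ^ 6 + 14 < (evNum 0 c).natAbs ∨ boxBound 1 * 10 ^ 6 + 14 < (evNum 1 c).natAbs ∨
    boxBound 2 * 10 ^ 6 + 14 < (evNum 2 c).natAbs ∨ boxBound 3 * 10 ^ 6 + 14 < (evNum 3 c).natAbs ∨
    ((evNum 0 c).natAbs + 14) * ((evNum 1 c).natAbs + 14) * ((evNum 2 c).natAbs + 14) *
      ((evNum 3 c).natAbs + 14) < 10 ^ 36 ∨
    10 ^ 36 < ((evNum 0 c).natAbs - 14) * ((evNum 1 c).natAbs - 14) *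
      ((evNum 2 c).natAbs - 14) * ((evNum 3 c).natAbs - 14) ∨
    c = (1, 0, 0, 0) ∨ c = (-1, 0, 0, 0)

instance : DecidablePred BoxTest := fun c => by
  unfold BoxTest
  infer_instance

theorem boxTest_all : ((List.range 19).all fun a => (List.range 15).all fun b =>
    (List.range 9).all fun c => (List.range 7).all fun d =>
      decide (BoxTest ((a : ℤ) - 9, (b : ℤ) - 7, (c : ℤ) - 4, (d : ℤ) - 3))) = true := by
  decide +kernel

theorem boxTest_of_mem {c : ℤ × ℤ × ℤ × ℤ} (h0 : |c.1| ≤ 9) (h1 : |c.2.1| ≤ 7)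
    (h2 : |c.2.2.1| ≤ 4) (h3 : |c.2.2.2| ≤ 3) : BoxTest c := by
  obtain ⟨c0, c1, c2, c3⟩ := c
  simp only [abs_le] at h0 h1 h2 h3
  have h := boxTest_all
  simp only [List.all_eq_true, List.mem_range, decide_eq_true_eq] at h
  have h4 := h (c0 + 9).toNat (by omega) (c1 + 7).toNat (by omega) (c2 + 4).toNat (by omega)
    (c3 + 3).toNat (by omega)
  have e0 : ((c0 + 9).toNat : ℤ) - 9 = c0 := by omega
  have e1 : ((c1 + 7).toNat : ℤ) - 7 = c1 := by omega
  have e2 : ((c2 + 4).toNat : ℤ) - 4 = c2 := by omega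
  have e3 : ((c3 + 3).toNat : ℤ) - 3 = c3 := by omega
  rwa [e0, e1, e2, e3] at h4

theorem ev_eq_sum (a : ℝ) (c : ℤ × ℤ × ℤ × ℤ) : ev a c = c.1 + c.2.1 * ev a (basisVec 1) +
    c.2.2.1 * ev a (basisVec 2) + c.2.2.2 * ev a (basisVec 3) := by
  simp [ev, basisVec]

theorem abs_mul_sub_le {c x a b n : ℝ} (hn : 0 ≤ n) (hc : |c| ≤ n) (h : a ≤ x ∧ x ≤ a + b) :
    |c * x - c * a| ≤ n * b := by
  rw [← mul_sub, abs_mul]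
  exact mul_le_mul hc (abs_le.2 ⟨by linarith [h.1, h.2], by linarith [h.2]⟩) (abs_nonneg _) hn

theorem abs_ev_sub_evNum_le {c : ℤ × ℤ × ℤ × ℤ} (h1 : |c.2.1| ≤ 7)
    (h2 : |c.2.2.1| ≤ 4) (h3 : |c.2.2.2| ≤ 3) (i : Fin 4) :
    |ev (rt i) c * 10 ^ 9 - evNum i c| ≤ 14 := by
  have b1 := basisNum_spec i 0
  have b2 := basisNum_spec i 1
  have b3 := basisNum_spec i 2
  have h1' : |(c.2.1 : ℝ)| ≤ 7 := by exact_mod_cast h1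
  have h2' : |(c.2.2.1 : ℝ)| ≤ 4 := by exact_mod_cast h2
  have h3' : |(c.2.2.2 : ℝ)| ≤ 3 := by exact_mod_cast h3
  rw [show (0 : Fin 3).succ = 1 from rfl, div_le_iff₀ (by norm_num), le_div_iff₀ (by norm_num)] at b1
  rw [show (1 : Fin 3).succ = 2 from rfl, div_le_iff₀ (by norm_num), le_div_iff₀ (by norm_num)] at b2
  rw [show (2 : Fin 3).succ = 3 from rfl, div_le_iff₀ (by norm_num), le_div_iff₀ (by norm_num)] at b3
  have a1 := abs_le.1 (abs_mul_sub_le (by norm_num) h1' b1)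
  have a2 := abs_le.1 (abs_mul_sub_le (by norm_num) h2' b2)
  have a3 := abs_le.1 (abs_mul_sub_le (by norm_num) h3' b3)
  rw [ev_eq_sum]
  simp only [evNum]
  push_cast
  rw [abs_le]
  constructor <;> linarith [a1.1, a1.2, a2.1, a2.2, a3.1, a3.2]

theorem prod_le_prod_four {a b : Fin 4 → ℝ} (h0 : ∀ i, 0 ≤ a i) (h : ∀ i, a i ≤ b i) :
    a 0 * a 1 * a 2 * a 3 ≤ b 0 * b 1 * b 2 * b 3 := by
  rw [← Fin.prod_univ_four, ← Fin.prod_univ_four]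
  exact Finset.prod_le_prod (fun i _ => h0 i) fun i _ => h i

/-- The only units in the fundamental domain are `1` and `-1`. -/
theorem eq_one_of_mem_box {c : ℤ × ℤ × ℤ × ℤ} (h0 : |c.1| ≤ 9) (h1 : |c.2.1| ≤ 7)
    (h2 : |c.2.2.1| ≤ 4) (h3 : |c.2.2.2| ≤ 3) (hE : ∀ i, |ev (rt i) c| ≤ boxBound i / 1000)
    (hN : |∏ i, ev (rt i) c| = 1) : c = (1, 0, 0, 0) ∨ c = (-1, 0, 0, 0) := by
  have ha : ∀ i, |(|ev (rt i) c| * 10 ^ 9 - ((evNum i c).natAbs : ℝ))| ≤ 14 := by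
    intro i
    have h := abs_ev_sub_evNum_le h1 h2 h3 i
    rw [Nat.cast_natAbs, Int.cast_abs, ← abs_of_pos (show (0 : ℝ) < 10 ^ 9 by norm_num), ← abs_mul]
    exact (abs_abs_sub_abs_le _ _).trans (by simpa using h)
  have hN' : |ev (rt 0) c| * 10 ^ 9 * (|ev (rt 1) c| * 10 ^ 9) * (|ev (rt 2) c| * 10 ^ 9) *
      (|ev (rt 3) c| * 10 ^ 9) = 10 ^ 36 := by
    rw [Fin.prod_univ_four, abs_mul, abs_mul, abs_mul] at hN
    linear_combination (10 : ℝ) ^ 36 * hN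
  have hb : ∀ i, ¬ (boxBound i * 10 ^ 6 + 14 < (evNum i c).natAbs) := by
    intro i hi
    have hi' : (boxBound i * 10 ^ 6 + 14 : ℝ) < (evNum i c).natAbs := by exact_mod_cast hi
    have := (abs_le.1 (ha i)).1
    have := hE i
    linarith
  have hlt : ¬ (((evNum 0 c).natAbs + 14) * ((evNum 1 c).natAbs + 14) * ((evNum 2 c).natAbs + 14) *
      ((evNum 3 c).natAbs + 14) < 10 ^ 36) := by
    intro h
    have h' : (((evNum 0 c).natAbs + 14 : ℝ) * ((evNum 1 c).natAbs + 14) *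
      ((evNum 2 c).natAbs + 14) * ((evNum 3 c).natAbs + 14)) < 10 ^ 36 := by exact_mod_cast h
    have := prod_le_prod_four (a := fun i => |ev (rt i) c| * 10 ^ 9)
      (b := fun i => ((evNum i c).natAbs + 14 : ℝ)) (fun i => by positivity)
      fun i => by linarith [(abs_le.1 (ha i)).2]
    linarith
  have hgt : ¬ (10 ^ 36 < ((evNum 0 c).natAbs - 14) * ((evNum 1 c).natAbs - 14) *
      ((evNum 2 c).natAbs - 14) * ((evNum 3 c).natAbs - 14)) := by
    intro h
    have h' : (10 : ℝ) ^ 36 < (((evNum 0 c).natAbs - 14 : ℕ) : ℝ) * (((evNum 1 c).natAbs - 14 : ℕ) : ℝ)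
      * (((evNum 2 c).natAbs - 14 : ℕ) : ℝ) * (((evNum 3 c).natAbs - 14 : ℕ) : ℝ) := by
      exact_mod_cast h
    have := prod_le_prod_four (b := fun i => |ev (rt i) c| * 10 ^ 9)
      (a := fun i => (((evNum i c).natAbs - 14 : ℕ) : ℝ)) (fun i => by positivity)
      fun i => by
        rcases le_total 14 (evNum i c).natAbs with h5 | h5
        · rw [Nat.cast_sub h5]
          push_cast
          linarith [(abs_le.1 (ha i)).1]
        · rw [Nat.sub_eq_zero_of_le h5]
          push_cast
          positivity
    linarith
  have h := boxTest_of_mem h0 h1 h2 h3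
  rcases h with h | h | h | h | h | h | h | h
  · exact absurd h (hb 0)
  · exact absurd h (hb 1)
  · exact absurd h (hb 2)
  · exact absurd h (hb 3)
  · exact absurd h hlt
  · exact absurd h hgt
  · exact .inl h
  · exact .inr h

/-- The coordinates of a vector as real numbers. -/
def coord (v : ℤ × ℤ × ℤ × ℤ) : Fin 4 → ℝ := ![v.1, v.2.1, v.2.2.1, v.2.2.2]

theorem basisMat_mulVec_coord (v : ℤ × ℤ × ℤ × ℤ) (i : Fin 4) :
    basisMat.mulVec (coord v) i = ev (rt i) v := by
  rw [ev_eq_sum]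
  simp only [basisMat, Matrix.mulVec, dotProduct, Matrix.of_apply, Fin.sum_univ_four, coord]
  simp [basisVec, ev]
  ring

theorem abs_coord_le {v : ℤ × ℤ × ℤ × ℤ} (hE : ∀ i, |ev (rt i) v| ≤ boxBound i / 1000) :
    |v.1| ≤ 9 ∧ |v.2.1| ≤ 7 ∧ |v.2.2.1| ≤ 4 ∧ |v.2.2.2| ≤ 3 := by
  have h := abs_le_of_approx_inverse (D := 26) basisMatInv_mul (b := coord v)
    (V := fun i => boxBound i / 1000) (C := ![9.433, 7.247, 4.981, 3.996])
    (fun i => by rw [basisMat_mulVec_coord]; exact hE i)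
    (fun s => by
      simp only [basisMatInv, Matrix.of_apply, Fin.sum_univ_four, abs_div]
      fin_cases s <;> norm_num [basisInv, boxBound] <;> simp only [Matrix.cons_val] <;> norm_num)
    (by norm_num) (by simp only [Fin.sum_univ_four, Matrix.cons_val]; norm_num) (by norm_num)
  have h0 := h 0
  have h1 := h 1
  have h2 := h 2
  have h3 := h 3
  simp only [coord, Matrix.cons_val] at h0 h1 h2 h3
  refine ⟨?_, ?_, ?_, ?_⟩ <;> rw [← Int.lt_add_one_iff] <;> rify <;> linarith

namespace Encl

/-- An upper bound for the numerator of the absolute value. -/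
def absUp (p : ℤ × ℤ) : ℤ := max (-p.1) p.2

theorem abs_le_absUp {x : ℝ} {p : ℤ × ℤ} (hx : Encl x p) : |x| * 2 ^ 400 ≤ absUp p := by
  have h := abs_mul x (2 ^ 400)
  rw [abs_of_pos (show (0 : ℝ) < 2 ^ 400 by positivity)] at h
  rw [← h, abs_le]
  have h1 := le_max_left (-p.1) p.2
  have h2 := le_max_right (-p.1) p.2
  have h1' : -(p.1 : ℝ) ≤ absUp p := by exact_mod_cast h1
  have h2' : (p.2 : ℝ) ≤ absUp p := by exact_mod_cast h2
  exact ⟨by linarith [hx.1], hx.2.trans h2'⟩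

/-- An interval for a rational number. -/
def ratI (a : ℤ) (b : ℕ) : ℤ × ℤ := (a * 2 ^ 400 / b, a * 2 ^ 400 / b + 1)

theorem of_rat (a : ℤ) {b : ℕ} (hb : 0 < b) : Encl (a / b) (ratI a b) := by
  have hb' : (0 : ℝ) < b := by exact_mod_cast hb
  have hb2 : (0 : ℤ) < b := by exact_mod_cast hb
  have h1 := Int.ediv_mul_le (a * 2 ^ 400) hb2.ne'
  have h2 := Int.lt_ediv_add_one_mul_self (a * 2 ^ 400) hb2
  have h1' : ((a * 2 ^ 400 / b : ℤ) : ℝ) * b ≤ a * 2 ^ 400 := by exact_mod_cast h1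
  have h2' : (a * 2 ^ 400 : ℝ) ≤ ((a * 2 ^ 400 / b + 1 : ℤ) : ℝ) * b := by exact_mod_cast h2.le
  constructor
  · rw [div_mul_eq_mul_div, le_div_iff₀ hb']
    exact h1'
  · rw [div_mul_eq_mul_div, div_le_iff₀ hb']
    exact h2'

end Encl

theorem sum_abs_unitLog_le (i : Fin 4) :
    ∑ t, |unitLog t i| ≤ 7 * Real.log (boxBound i / 1000) := by
  have h : ∀ i, Encl.avoidsZero (Encl.ratI (boxBound i) 1000) = true ∧
      Encl.absUp (unitLogI 0 i) + Encl.absUp (unitLogI 1 i) + Encl.absUp (unitLogI 2 i) ≤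
      7 * (Encl.logAbs (Encl.ratI (boxBound i) 1000)).1 := by
    decide +kernel
  have h1 := (Encl.of_logAbs (Encl.of_rat (boxBound i) (b := 1000) (by norm_num)) (h i).1).1
  have h2 : ((Encl.absUp (unitLogI 0 i) + Encl.absUp (unitLogI 1 i) +
    Encl.absUp (unitLogI 2 i) : ℤ) : ℝ) ≤
      ((7 * (Encl.logAbs (Encl.ratI (boxBound i) 1000)).1 : ℤ) : ℝ) := by exact_mod_cast (h i).2
  have h3 := fun t => Encl.abs_le_absUp (encl_unitLog t i)
  rw [abs_of_nonneg (by positivity)] at h1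
  push_cast at h1 h2
  rw [Fin.sum_univ_three]
  have hS : (0 : ℝ) < 2 ^ 400 := by positivity
  refine le_of_mul_le_mul_right ?_ hS
  have e0 := h3 0
  have e1 := h3 1
  have e2 := h3 2
  generalize (2 : ℝ) ^ 400 = C at *
  linarith

theorem sum_mul_abs_le {X l : Fin 3 → ℝ} {c : ℝ} (h : ∀ t, |X t| ≤ c) :
    |∑ t, X t * l t| ≤ c * ∑ t, |l t| := by
  rw [Finset.mul_sum]
  refine (Finset.abs_sum_le_sum_abs _ _).trans (Finset.sum_le_sum fun t _ => ?_)
  rw [abs_mul]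
  exact mul_le_mul_of_nonneg_right (h t) (abs_nonneg _)

theorem exists_unitLog_coords {L : Fin 4 → ℝ} (hL : ∑ i, L i = 0) :
    ∃ X : Fin 3 → ℝ, (∀ i, L i = ∑ t, X t * unitLog t i) ∧
      ∀ B, 0 ≤ B → (∀ i, |L i| ≤ B) → ∀ t, |X t| ≤ B / 2 := by
  obtain ⟨X, hX⟩ := (mulVec_surjective_of_approx_inverse unitMatInv_mul (by norm_num)
    (by norm_num)).2 fun i => L i.castSucc
  have h1 : ∀ i : Fin 3, L i.castSucc = ∑ t, X t * unitLog t i.castSucc := fun i => by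
    have := congrFun hX i
    simp only [unitMat, Matrix.mulVec, dotProduct, Matrix.of_apply] at this
    rw [← this]
    exact Finset.sum_congr rfl fun t _ => mul_comm _ _
  refine ⟨X, fun i => ?_, fun B hB0 hB s => ?_⟩
  · induction i using Fin.lastCases with
    | cast i => exact h1 i
    | last =>
      have h2 := sum_unitLog
      simp only [Fin.sum_univ_castSucc (n := 3)] at h2 hL
      rw [eq_neg_of_add_eq_zero_right hL]
      simp only [fun t => eq_neg_of_add_eq_zero_right (h2 t), h1, mul_neg, Finset.sum_neg_distrib,
        Finset.mul_sum]
      rw [Finset.sum_comm]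
  · have h2 : ∀ s, ∑ i, |unitMatInv s i| * B ≤ 3 / 10 * B := fun s => by
      simp only [unitMatInv, Matrix.of_apply, Fin.sum_univ_three, abs_div]
      fin_cases s <;> norm_num [unitInv] <;> simp only [Matrix.cons_val] <;> norm_num <;> linarith
    have := abs_le_of_approx_inverse (D := B) unitMatInv_mul (b := X) (V := fun _ => B)
      (C := fun _ => 3 / 10 * B) (fun i => by rw [hX]; exact hB _) h2 (by norm_num)
      (by norm_num [Fin.sum_univ_three]; linarith) (by norm_num) s
    linarith

/-- A power of each unit, with exponent at most `343`, agrees up to sign with a product of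
powers of the units `eps`. -/
theorem exists_log_unit_eq {c : ℤ × ℤ × ℤ × ℤ} (hN : |∏ i, ev (rt i) c| = 1) :
    ∃ k : ℕ, 0 < k ∧ k ≤ 343 ∧ ∃ a : Fin 3 → ℤ,
      (∀ i, k * Real.log |ev (rt i) c| = ∑ t, a t * unitLog t i) ∧
      ∀ B, 1 ≤ B → (∀ i, |(Real.log |ev (rt i) c|)| ≤ B) → ∀ t, |(a t : ℝ)| ≤ k * B := by
  have hne : ∀ i, ev (rt i) c ≠ 0 := fun i h => by
    rw [Finset.prod_eq_zero (Finset.mem_univ i) h] at hN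
    norm_num at hN
  have hsum : ∑ i, Real.log |ev (rt i) c| = 0 := by
    rw [← Real.log_prod (fun i _ => abs_ne_zero.2 (hne i)), ← Finset.abs_prod, hN, Real.log_one]
  obtain ⟨X, hX, hXB⟩ := exists_unitLog_coords hsum
  obtain ⟨k, hk, hk', a, ha⟩ := exists_simultaneous_approx X
  obtain ⟨e, he⟩ := exists_ev_eq_prod_zpow ℝ fun t => -a t
  obtain ⟨p, hp⟩ := exists_ev_eq_pow (K := ℝ) c k
  set v := mulVec p e with hv
  have hev : ∀ i, ev (rt i) v = ev (rt i) c ^ k * ∏ t, ev (rt i) (eps t) ^ (-a t) := fun i => by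
    rw [hv, ev_mulVec (quartic_rt i), hp _ (quartic_rt i), he _ (quartic_rt i)]
  have hu : ∀ i t, ev (rt i) (eps t) ^ (-a t) ≠ 0 := fun i t =>
    zpow_ne_zero _ (ev_eps_ne_zero (quartic_rt i) t)
  have hlog : ∀ i, Real.log |ev (rt i) v| = ∑ t, (k * X t - a t) * unitLog t i := fun i => by
    rw [hev, abs_mul, Real.log_mul (abs_ne_zero.2 (pow_ne_zero _ (hne i)))
      (abs_ne_zero.2 (Finset.prod_ne_zero_iff.2 fun t _ => hu i t)), Finset.abs_prod,
      Real.log_prod (fun t _ => abs_ne_zero.2 (hu i t)), abs_pow, Real.log_pow, hX]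
    simp only [abs_zpow, Real.log_zpow, sub_mul, Finset.sum_sub_distrib, Finset.mul_sum]
    simp only [unitLog, Int.cast_neg, neg_mul, Finset.sum_neg_distrib, mul_assoc]
    ring
  have hvne : ∀ i, ev (rt i) v ≠ 0 := fun i => by
    rw [hev]
    exact mul_ne_zero (pow_ne_zero _ (hne i)) (Finset.prod_ne_zero_iff.2 fun t _ => hu i t)
  have hpos : ∀ i, (0 : ℝ) < boxBound i / 1000 := fun i => by
    fin_cases i <;> norm_num [boxBound]
  have hE : ∀ i, |ev (rt i) v| ≤ boxBound i / 1000 := fun i => by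
    rw [← Real.log_le_log_iff (abs_pos.2 (hvne i)) (hpos i), hlog]
    refine (le_abs_self _).trans ((sum_mul_abs_le ha).trans ?_)
    linarith [sum_abs_unitLog_le i]
  have hNv : |∏ i, ev (rt i) v| = 1 := by
    rw [Finset.prod_congr rfl fun i _ => hev i, Finset.prod_mul_distrib, Finset.prod_pow,
      Finset.prod_comm, abs_mul, abs_pow, hN, one_pow, one_mul, Finset.abs_prod]
    refine Finset.prod_eq_one fun t _ => ?_
    rw [Finset.prod_zpow, abs_zpow, abs_prod_ev_eps, one_zpow]
  obtain ⟨b0, b1, b2, b3⟩ := abs_coord_le hE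
  have hlog0 : ∀ i, Real.log |ev (rt i) v| = 0 := by
    rcases eq_one_of_mem_box b0 b1 b2 b3 hE hNv with h | h <;> intro i <;> rw [h] <;> simp [ev]
  refine ⟨k, hk, hk', a, fun i => ?_, fun B hB1 hB t => ?_⟩
  · have := hlog i
    rw [hlog0] at this
    rw [hX, Finset.mul_sum, eq_comm, ← sub_eq_zero, ← Finset.sum_sub_distrib, ← neg_eq_zero,
      ← Finset.sum_neg_distrib, this]
    exact Finset.sum_congr rfl fun t _ => by ring
  · have h1 := abs_le.1 (ha t)
    have h2 := abs_le.1 (hXB B (by linarith) hB t)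
    have h3 : (1 : ℝ) ≤ k := by exact_mod_cast hk
    have h4 : |(k : ℝ) * X t| ≤ k * (B / 2) := by
      rw [abs_mul, abs_of_pos (by linarith)]
      exact mul_le_mul_of_nonneg_left (hXB B (by linarith) hB t) (by linarith)
    have h5 := abs_le.1 h4
    have h6 : 1 ≤ k * B := by nlinarith
    rw [abs_le]
    constructor <;> linarith [h5.1, h5.2, h1.1, h1.2]

theorem rt_zero_bounds : -3.4272 ≤ rt 0 ∧ rt 0 ≤ -3.4271 := by
  have h := Encl.of_within (a := -34272) (c := -34271) (b := 10 ^ 4) (encl_rt 0) (by decide +kernel)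
  norm_num at h ⊢
  exact h

theorem rt_one_bounds : -0.4994 ≤ rt 1 ∧ rt 1 ≤ -0.4993 := by
  have h := Encl.of_within (a := -4994) (c := -4993) (b := 10 ^ 4) (encl_rt 1) (by decide +kernel)
  norm_num at h ⊢
  exact h

theorem rt_two_bounds : 2.7581 ≤ rt 2 ∧ rt 2 ≤ 2.7582 := by
  have h := Encl.of_within (a := 27581) (c := 27582) (b := 10 ^ 4) (encl_rt 2) (by decide +kernel)
  norm_num at h ⊢
  exact h

theorem rt_three_bounds : 10.1684 ≤ rt 3 ∧ rt 3 ≤ 10.1685 := by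
  have h := Encl.of_within (a := 101684) (c := 101685) (b := 10 ^ 4) (encl_rt 3) (by decide +kernel)
  norm_num at h ⊢
  exact h

theorem abs_sub_rt_bounds :
    (2.9276 ≤ |rt 1 - rt 0| ∧ |rt 1 - rt 0| ≤ 2.928) ∧
    (6.185 ≤ |rt 2 - rt 0| ∧ |rt 2 - rt 0| ≤ 6.186) ∧
    (13.595 ≤ |rt 3 - rt 0| ∧ |rt 3 - rt 0| ≤ 13.596) ∧
    (3.257 ≤ |rt 2 - rt 1| ∧ |rt 2 - rt 1| ≤ 3.258) ∧
    (10.667 ≤ |rt 3 - rt 1| ∧ |rt 3 - rt 1| ≤ 10.668) ∧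
    (7.41 ≤ |rt 3 - rt 2| ∧ |rt 3 - rt 2| ≤ 7.411) := by
  obtain ⟨a1, a2⟩ := rt_zero_bounds
  obtain ⟨b1, b2⟩ := rt_one_bounds
  obtain ⟨c1, c2⟩ := rt_two_bounds
  obtain ⟨d1, d2⟩ := rt_three_bounds
  norm_num at a1 a2 b1 b2 c1 c2 d1 d2
  rw [abs_of_pos (a := rt 1 - rt 0) (by linarith), abs_of_pos (a := rt 2 - rt 0) (by linarith),
    abs_of_pos (a := rt 3 - rt 0) (by linarith), abs_of_pos (a := rt 2 - rt 1) (by linarith),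
    abs_of_pos (a := rt 3 - rt 1) (by linarith), abs_of_pos (a := rt 3 - rt 2) (by linarith)]
  norm_num
  refine ⟨⟨?_, ?_⟩, ⟨?_, ?_⟩, ⟨?_, ?_⟩, ⟨?_, ?_⟩, ⟨?_, ?_⟩, ⟨?_, ?_⟩⟩ <;> linarith

theorem abs_sub_rt_mem {i j : Fin 4} (h : i ≠ j) : 2.9 ≤ |rt i - rt j| ∧ |rt i - rt j| ≤ 13.6 := by
  obtain ⟨h1, h2, h3, h4, h5, h6⟩ := abs_sub_rt_bounds
  norm_num at h1 h2 h3 h4 h5 h6 ⊢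
  fin_cases i <;> fin_cases j <;> simp only [Fin.mk_zero, Fin.mk_one, Fin.reduceFinMk] at h ⊢ <;>
    first
    | exact absurd rfl h
    | (constructor <;> linarith)
    | (rw [abs_sub_comm]; constructor <;> linarith)

/-- The products of the distances from a root to the others. -/
theorem le_prod_abs_sub_rt (j : Fin 4) : 100 ≤ ∏ i ∈ Finset.univ.erase j, |rt i - rt j| := by
  obtain ⟨h1, h2, h3, h4, h5, h6⟩ := abs_sub_rt_bounds
  have key : ∀ {a b c u v w : ℝ}, 0 ≤ u → 0 ≤ v → 0 ≤ w → u ≤ a → v ≤ b → w ≤ c → 100 ≤ u * v * w →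
      100 ≤ a * b * c := fun hu hv hw h1 h2 h3 h =>
    h.trans (mul_le_mul (mul_le_mul h1 h2 hv (hu.trans h1)) h3 hw (by
      exact mul_nonneg (hu.trans h1) (hv.trans h2)))
  have e0 : (Finset.univ.erase (0 : Fin 4)) = {1, 2, 3} := by decide
  have e1 : (Finset.univ.erase (1 : Fin 4)) = {0, 2, 3} := by decide
  have e2 : (Finset.univ.erase (2 : Fin 4)) = {0, 1, 3} := by decide
  have e3 : (Finset.univ.erase (3 : Fin 4)) = {0, 1, 2} := by decide
  have s10 := abs_sub_comm (rt 1) (rt 0)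
  have s20 := abs_sub_comm (rt 2) (rt 0)
  have s30 := abs_sub_comm (rt 3) (rt 0)
  have s21 := abs_sub_comm (rt 2) (rt 1)
  have s31 := abs_sub_comm (rt 3) (rt 1)
  have s32 := abs_sub_comm (rt 3) (rt 2)
  fin_cases j
  · change 100 ≤ ∏ i ∈ Finset.univ.erase (0 : Fin 4), |rt i - rt 0|
    rw [e0, Finset.prod_insert (by decide), Finset.prod_insert (by decide), Finset.prod_singleton,
      ← mul_assoc]
    exact key (by norm_num) (by norm_num) (by norm_num) h1.1 h2.1 h3.1 (by norm_num)
  · change 100 ≤ ∏ i ∈ Finset.univ.erase (1 : Fin 4), |rt i - rt 1|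
    rw [e1, Finset.prod_insert (by decide), Finset.prod_insert (by decide), Finset.prod_singleton,
      ← mul_assoc, ← s10]
    exact key (by norm_num) (by norm_num) (by norm_num) h1.1 h4.1 h5.1 (by norm_num)
  · change 100 ≤ ∏ i ∈ Finset.univ.erase (2 : Fin 4), |rt i - rt 2|
    rw [e2, Finset.prod_insert (by decide), Finset.prod_insert (by decide), Finset.prod_singleton,
      ← mul_assoc, ← s20, ← s21]
    exact key (by norm_num) (by norm_num) (by norm_num) h2.1 h4.1 h6.1 (by norm_num)
  · change 100 ≤ ∏ i ∈ Finset.univ.erase (3 : Fin 4), |rt i - rt 3|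
    rw [e3, Finset.prod_insert (by decide), Finset.prod_insert (by decide), Finset.prod_singleton,
      ← mul_assoc, ← s30, ← s31, ← s32]
    exact key (by norm_num) (by norm_num) (by norm_num) h3.1 h5.1 h6.1 (by norm_num)

theorem abs_log_one_add_le {z : ℝ} (hz : |z| ≤ 1 / 2) : |Real.log (1 + z)| ≤ 2 * |z| := by
  have h := abs_le.1 hz
  have hpos : 0 < 1 + z := by linarith
  have h1 := Real.log_le_sub_one_of_pos hpos
  have h2 := Real.one_sub_inv_le_log_of_pos hpos
  have h3 : -(2 * |z|) ≤ 1 - (1 + z)⁻¹ := by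
    rw [show 1 - (1 + z)⁻¹ = z / (1 + z) by field_simp; ring, le_div_iff₀ hpos]
    rcases abs_cases z with ⟨e, _⟩ | ⟨e, _⟩ <;> rw [e] <;> nlinarith
  rw [abs_le]
  exact ⟨h3.trans h2, by linarith [le_abs_self z, abs_nonneg z]⟩

/-- The factors at the roots other than the nearest one. -/
structure IsNearest (x y : ℤ) (j : Fin 4) : Prop where
  le_abs : ∀ i, i ≠ j → |rt i - rt j| * |(y : ℝ)| / 2 ≤ |(x : ℝ) - rt i * y|
  abs_mul_le : |(x : ℝ) - rt j * y| * |(y : ℝ)| ^ 3 ≤ 3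

theorem exists_isNearest {x y : ℤ} (hy : y ≠ 0) (hF : |∏ i, ((x : ℝ) - rt i * y)| ≤ 36) :
    ∃ j, IsNearest x y j := by
  obtain ⟨j, -, hj⟩ := Finset.exists_min_image Finset.univ (fun i => |(x : ℝ) - rt i * y|)
    Finset.univ_nonempty
  have h1 : ∀ i, i ≠ j → |rt i - rt j| * |(y : ℝ)| / 2 ≤ |(x : ℝ) - rt i * y| := by
    intro i _
    rw [← abs_mul]
    have h2 : (rt i - rt j) * (y : ℝ) = (x - rt j * y) - (x - rt i * y) := by ring
    rw [h2]
    have := abs_sub (x - rt j * y : ℝ) (x - rt i * y)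
    linarith [hj i (Finset.mem_univ i)]
  refine ⟨j, h1, ?_⟩
  rw [← Finset.mul_prod_erase _ _ (Finset.mem_univ j), abs_mul, Finset.abs_prod] at hF
  have hy0 : 0 < |(y : ℝ)| := abs_pos.2 (by exact_mod_cast hy)
  have h3 : ∏ i ∈ Finset.univ.erase j, (|rt i - rt j| * |(y : ℝ)| / 2) ≤
      ∏ i ∈ Finset.univ.erase j, |(x : ℝ) - rt i * y| :=
    Finset.prod_le_prod (fun i _ => by positivity) fun i hi => h1 i (Finset.ne_of_mem_erase hi)
  have h4 : ∏ i ∈ Finset.univ.erase j, (|rt i - rt j| * |(y : ℝ)| / 2) =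
      (∏ i ∈ Finset.univ.erase j, |rt i - rt j|) * (|(y : ℝ)| ^ 3 / 8) := by
    simp only [mul_div_assoc]
    rw [Finset.prod_mul_distrib, Finset.prod_const, Finset.card_erase_of_mem (Finset.mem_univ j)]
    simp only [Finset.card_univ, Fintype.card_fin]
    ring
  rw [h4] at h3
  have h5 : 100 * (|(y : ℝ)| ^ 3 / 8) ≤ ∏ i ∈ Finset.univ.erase j, |(x : ℝ) - rt i * y| :=
    (mul_le_mul_of_nonneg_right (le_prod_abs_sub_rt j) (by positivity)).trans h3
  have h6 := (mul_le_mul_of_nonneg_left h5 (abs_nonneg ((x : ℝ) - rt j * y))).trans hF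
  linarith

theorem IsNearest.abs_log_sub_le {x y : ℤ} {j : Fin 4} (h : IsNearest x y j) (hy : 2 ≤ |y|)
    {i : Fin 4} (hi : i ≠ j) : |Real.log (|(x : ℝ) - rt i * y|) - Real.log (|(y : ℝ)|) -
      Real.log (|rt i - rt j|)| ≤ 3 / (y : ℝ) ^ 4 := by
  have hy' : (2 : ℝ) ≤ |(y : ℝ)| := by exact_mod_cast hy
  have hy0 : (y : ℝ) ≠ 0 := fun h0 => by
    rw [h0] at hy'
    norm_num at hy'
  have hd := abs_sub_rt_mem hi
  norm_num at hd
  have hd0 : rt i - rt j ≠ 0 := fun h0 => by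
    rw [h0] at hd
    norm_num at hd
  have hz : |(x : ℝ) - rt j * y| / (|rt i - rt j| * |(y : ℝ)|) ≤ 3 / 2 / (y : ℝ) ^ 4 := by
    have e : (y : ℝ) ^ 4 = |(y : ℝ)| ^ 4 := by rw [← abs_pow, abs_of_nonneg (by positivity)]
    rw [e, div_le_div_iff₀ (by positivity) (by positivity)]
    have h2 := h.abs_mul_le
    calc _ = (|(x : ℝ) - rt j * y| * |(y : ℝ)| ^ 3) * |(y : ℝ)| := by ring
      _ ≤ 3 * |(y : ℝ)| := by gcongr
      _ ≤ _ := by nlinarith [hd.1]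
  set z : ℝ := -(((x : ℝ) - rt j * y) / ((rt i - rt j) * y)) with hzdef
  have hzabs : |z| ≤ 3 / 2 / (y : ℝ) ^ 4 := by
    rw [hzdef, abs_neg, abs_div, abs_mul]
    exact hz
  have hy4 : (16 : ℝ) ≤ (y : ℝ) ^ 4 := by
    have e : (y : ℝ) ^ 4 = |(y : ℝ)| ^ 4 := by rw [← abs_pow, abs_of_nonneg (by positivity)]
    rw [e]
    have := pow_le_pow_left₀ (by norm_num) hy' 4
    linarith
  have hz2 : |z| ≤ 1 / 2 := hzabs.trans (by
    rw [div_le_iff₀ (by positivity)]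
    linarith)
  have h1z : 0 < 1 + z := by linarith [(abs_le.1 hz2).1]
  have h5 : |(x : ℝ) - rt i * y| = |(y : ℝ)| * |rt i - rt j| * (1 + z) := by
    rw [← abs_of_pos h1z, ← abs_mul, ← abs_mul, ← abs_neg, hzdef]
    congr 1
    field_simp
    ring
  rw [h5, Real.log_mul (by positivity) h1z.ne', Real.log_mul (by positivity) (by positivity)]
  have h6 := abs_log_one_add_le hz2
  rw [show Real.log |(y : ℝ)| + Real.log |rt i - rt j| + Real.log (1 + z) - Real.log |(y : ℝ)| -
    Real.log |rt i - rt j| = Real.log (1 + z) by ring]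
  refine h6.trans ?_
  calc _ ≤ 2 * (3 / 2 / (y : ℝ) ^ 4) := by gcongr
    _ = _ := by ring

/-- Coordinates of the elements whose associates have to be considered. -/
def reprVec : Fin 15 → ℤ × ℤ × ℤ × ℤ :=
  ![(1, 0, 0, 0),
    (5, 7, 2, -2),
    (3, -11, 12, -8),
    (-66, -116, 179, -122),
    (-13, -3, 10, -7),
    (41, -10, -9, 7),
    (93, -22, -22, 17),
    (-229, -334, 536, -366),
    (13, 28, 10, -8),
    (-19, -39, -16, 17),
    (-1, -2, 3, -2),
    (3, 26, 11, -10),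
    (177, 368, 140, -130),
    (-7, -10, -6, 10),
    (-77, -208, 299, -203)]

/-- Logarithms of the representatives. -/
noncomputable def reprLog (m : Fin 15) (i : Fin 4) : ℝ := Real.log |ev (rt i) (reprVec m)|

/-- Intervals for `reprLog`. -/
def reprLogI (m : Fin 15) (i : Fin 4) : ℤ × ℤ := Encl.logAbs (Encl.evI i (reprVec m))

theorem encl_reprLog (m : Fin 15) (i : Fin 4) : Encl (reprLog m i) (reprLogI m i) := by
  refine Encl.of_logAbs (Encl.of_ev i (reprVec m)) ?_
  revert m i
  decide +kernel

theorem ev_reprVec_ne_zero (m : Fin 15) (i : Fin 4) : ev (rt i) (reprVec m) ≠ 0 := by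
  intro h
  have h1 := Encl.of_ev i (reprVec m)
  have h2 : ∀ (m : Fin 15) (i : Fin 4), 0 < (Encl.evI i (reprVec m)).1 ∨ (Encl.evI i (reprVec m)).2 < 0 := by
    decide +kernel
  rw [h] at h1
  obtain ⟨h3, h4⟩ := h1
  rw [zero_mul] at h3 h4
  norm_cast at h3 h4
  have := h2 m i
  omega

theorem abs_reprLog_le (m : Fin 15) (i : Fin 4) : |reprLog m i| ≤ 20 := by
  have h : ∀ (m : Fin 15) (i : Fin 4), Encl.within (reprLogI m i) (-20) 20 1 = true := by
    decide +kernel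
  have := Encl.of_within (encl_reprLog m i) (h m i)
  norm_num at this
  exact abs_le.2 this

/-- Logarithms of the differences of roots. -/
noncomputable def diffLog (i j : Fin 4) : ℝ := Real.log |rt i - rt j|

/-- Intervals for the logarithms of the differences of roots. -/
def diffLogI (i j : Fin 4) : ℤ × ℤ :=
  if i = j then (0, 0)
  else Encl.logAbs (Encl.add (rootNum i, rootNum i + 1) (Encl.neg (rootNum j, rootNum j + 1)))

theorem encl_diffLog (i j : Fin 4) : Encl (diffLog i j) (diffLogI i j) := by
  have h : ∀ i j : Fin 4, i ≠ j → Encl.avoidsZero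
      (Encl.add (rootNum i, rootNum i + 1) (Encl.neg (rootNum j, rootNum j + 1))) = true := by
    decide +kernel
  unfold diffLog diffLogI
  split_ifs with hij
  · simp [hij, Encl]
  · rw [sub_eq_add_neg]
    exact Encl.of_logAbs (Encl.of_add (encl_rt i) (Encl.of_neg (encl_rt j))) (h i j hij)

namespace Encl

/-- An interval for an integral linear combination. -/
def lin (p : Fin 4 → ℤ) (I : Fin 4 → ℤ × ℤ) : ℤ × ℤ :=
  add (add (smul (p 0) (I 0)) (smul (p 1) (I 1))) (add (smul (p 2) (I 2)) (smul (p 3) (I 3)))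

theorem of_lin (p : Fin 4 → ℤ) {X : Fin 4 → ℝ} {I : Fin 4 → ℤ × ℤ} (h : ∀ i, Encl (X i) (I i)) :
    Encl (∑ i, p i * X i) (lin p I) := by
  have := of_add (of_add (of_smul (p 0) (h 0)) (of_smul (p 1) (h 1)))
    (of_add (of_smul (p 2) (h 2)) (of_smul (p 3) (h 3)))
  rw [Fin.sum_univ_four, add_assoc (_ + _)]
  exact this

end Encl

/-- An interval for the inhomogeneous term of the reduction. -/
def thetaI (p : Fin 4 → ℤ) (j : Fin 4) (m : Fin 15) : ℤ × ℤ :=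
  Encl.lin p fun i => Encl.add (diffLogI i j) (Encl.neg (reprLogI m i))

/-- Intervals for `unitLog`, sharper than `unitLogI` at the places where the unit is small. -/
def sharpLogI (t : Fin 3) (i : Fin 4) : ℤ × ℤ :=
  if Encl.absUp (Encl.evI i (eps t)) < 2 ^ 400 then Encl.neg (Encl.logAbs (Encl.evI i (epsInv t)))
  else unitLogI t i

theorem encl_sharpLog (t : Fin 3) (i : Fin 4) : Encl (unitLog t i) (sharpLogI t i) := by
  have h : ∀ (t : Fin 3) (i : Fin 4), Encl.avoidsZero (Encl.evI i (epsInv t)) = true := by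
    decide +kernel
  unfold sharpLogI
  split_ifs with h0
  · have h1 := eq_inv_of_mul_eq_one_left (ev_eps_mul_ev_epsInv (quartic_rt i) t)
    rw [unitLog, h1, abs_inv, Real.log_inv]
    exact Encl.of_neg (Encl.of_logAbs (Encl.of_ev i (epsInv t)) (h t i))
  · exact encl_unitLog t i

/-- An interval for the defect of the linear relation with coefficients `p` and values `D * n`. -/
def defectI (p : Fin 4 → ℤ) (D : ℤ) (n : Fin 3 → ℤ) (t : Fin 3) : ℤ × ℤ :=
  Encl.add (Encl.lin p (sharpLogI t)) (-(D * n t) * 2 ^ 400, -(D * n t) * 2 ^ 400)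

/-- A bound for the error term of the reduction when `y₀ ≤ |y|` and `log |y| ≤ Y`. -/
def errorUp (p : Fin 4 → ℤ) (D : ℤ) (n : Fin 3 → ℤ) (y₀ Y : ℕ) : ℤ :=
  3 * (|p 0| + |p 1| + |p 2| + |p 3|) * 2 ^ 400 / y₀ ^ 4 + 1 + (3 * Y + 72) *
    (Encl.absUp (defectI p D n 0) + Encl.absUp (defectI p D n 1) + Encl.absUp (defectI p D n 2))

/-- Evaluation of a function at a natural number, arranged so that the argument is reduced first. -/
def callByValue {α : Type*} (n : ℕ) (f : ℕ → α) : α := Nat.casesOn n (f 0) fun k => f (k + 1)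

theorem callByValue_eq {α : Type*} (n : ℕ) (f : ℕ → α) : callByValue n f = f n := by
  cases n <;> rfl

/-- No multiple of `M` lies between `k * a` and `k * (a + w)`, for `1 ≤ k ≤ 343`. -/
def avoidsMultiples (M a w : ℕ) : Bool :=
  callByValue M fun M => callByValue a fun a => callByValue w fun w =>
    decide (∀ k : Fin 343, 0 < ((k : ℕ) + 1) * a % M ∧ ((k : ℕ) + 1) * a % M + ((k : ℕ) + 1) * w < M)

theorem avoidsMultiples_iff {M a w : ℕ} : avoidsMultiples M a w = true ↔
    ∀ k : Fin 343, 0 < ((k : ℕ) + 1) * a % M ∧ ((k : ℕ) + 1) * a % M + ((k : ℕ) + 1) * w < M := by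
  simp only [avoidsMultiples, callByValue_eq, decide_eq_true_eq]

/-- The conditions under which the coefficients `p` exclude solutions in a range. -/
def excludes (j : Fin 4) (p : Fin 4 → ℤ) (D : ℕ) (n : Fin 3 → ℤ) (y₀ Y : ℕ) : Bool :=
  decide (p j = 0) && decide (p 0 + p 1 + p 2 + p 3 = 0) &&
    callByValue (errorUp p D n y₀ Y).toNat fun e => decide (∀ m,
      avoidsMultiples (D * 2 ^ 400) (((thetaI p j m).1 - e) % (D * 2 ^ 400)).toNat
        ((thetaI p j m).2 - (thetaI p j m).1 + 2 * e).toNat = true)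

/-- Coefficients of linear relations for the reduction of huge solutions. -/
def hugeCoeff : Fin 4 → Fin 4 → ℤ :=
  ![![0,
      -345886103007616673592004538685175131944210619565080772115140373264428094549629542268276406876167484162127938284157647233732,
      -321127654055302941526416715920050687388134499388027539778096243678789536684633091344993122884964967142990976834056846944584,
      667013757062919615118421254605225819332345118953108311893236616943217631234262633613269529761132451305118915118214494178316],
    ![-48251037398736223673786272527541927229433661046461573531295339926258703322347690198732975788514263092227097667587219294908,
      0,
      -502781347704693256651538243239341074445212876721912350114037444194110608749908730826229720025390418019614714622463571947835,
      551032385103429480325324515766883001674646537768373923645332784120369312072256421024962695813904681111841812290050791242743],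
    ![658302588031331532720909608254040219753708762400573308503635195030051539570822219666255817731666898635683736554306564099368,
      -963232491542559406847047975635693700288706984192174261605987477432877418665483655824080975475922259675069091406447220406196,
      0,
      304929903511227874126138367381653480534998221791600953102352282402825879094661436157825157744255361039385354852140656306828],
    ![-208302619799712656950837067914273366108467692752295176585117036246997787804924352268881876463567996580497831578518667893367,
      1149842144843947979148760211965560992865965530694411732123578675858860877688532330757143182559216623130639824938713746185424,
      -941539525044235322197923144051287626757497837942116555538461639611863089883607978488261306095648626550141993360195078292057,
      0]]

/-- Approximate values of the linear relations with coefficients `hugeCoeff`. -/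
def hugeValue : Fin 4 → Fin 3 → ℤ :=
  ![![375757060431767198903868899115996881778, 617352002570743745062115902590996453345, -490367401856623364655121332761563281751],
    ![65877307890905429870172380077300790528, 762987805546516742016936948148090471227, -460713382274264549359189118622333071846],
    ![855207702946654653901637704522366759332, -313669372452202750521443567821743266975, -1382159872566053217459519836025710619418],
    ![-983898644583403668064025600595479734314, 1014846251347120659474159317142392486443, -188200480559216600545103946848674945801]]

/-- Coefficients of linear relations for the reduction of large solutions. -/
def largeCoeff : Fin 4 → Fin 4 → ℤ :=
  ![![0, -205371341981080267, -424222532848324764, 629593874829405031],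
    ![-304578528736976126, 0, 442690525460551178, -138111996723575052],
    ![-55657080449348037, 162478929794827117, 0, -106821849345479080],
    ![-1329475798085391778, 1144792589121139187, 184683208964252591, 0]]

/-- Approximate values of the linear relations with coefficients `largeCoeff`. -/
def largeValue : Fin 4 → Fin 3 → ℤ :=
  ![![25081, 69452, -53790],
    ![-1312, -26211, 91249],
    ![-15142, -1247, 15226],
    ![-96756, 75926, 263675]]

theorem excludes_large (j : Fin 4) :
    excludes j (largeCoeff j) (10 ^ 14) (largeValue j) 1000 31 = true := by
  revert j
  decide +kernel

theorem excludes_huge (j : Fin 4) :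
    excludes j (hugeCoeff j) (10 ^ 85) (hugeValue j) (10 ^ 13) (10 ^ 67) = true := by
  revert j
  decide +kernel

/-- The elements `x - α y` are products of a representative and a unit. -/
structure IsAssociated (x y : ℤ) (m : Fin 15) (c : ℤ × ℤ × ℤ × ℤ) : Prop where
  eq_mul : ∀ i, (x : ℝ) - rt i * y = ev (rt i) (reprVec m) * ev (rt i) c
  abs_prod : |∏ i, ev (rt i) c| = 1

theorem ne_zero_of_abs_prod {c : ℤ × ℤ × ℤ × ℤ} (h : |∏ i, ev (rt i) c| = 1) (i : Fin 4) :
    ev (rt i) c ≠ 0 := fun h0 => by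
  rw [Finset.prod_eq_zero (Finset.mem_univ i) h0] at h
  norm_num at h

theorem sum_log_eq_zero {c : ℤ × ℤ × ℤ × ℤ} (h : |∏ i, ev (rt i) c| = 1) :
    ∑ i, Real.log |ev (rt i) c| = 0 := by
  rw [← Real.log_prod (fun i _ => abs_ne_zero.2 (ne_zero_of_abs_prod h i)), ← Finset.abs_prod, h,
    Real.log_one]

/-- A bound for one entry of a vector with sum zero in terms of the others. -/
theorem abs_le_of_sum_eq_zero {L : Fin 4 → ℝ} (h : ∑ i, L i = 0) {j : Fin 4} {b : ℝ}
    (hb : ∀ i, i ≠ j → |L i| ≤ b) : |L j| ≤ 3 * b := by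
  rw [← Finset.add_sum_erase _ _ (Finset.mem_univ j)] at h
  rw [eq_neg_of_add_eq_zero_left h, abs_neg]
  refine (Finset.abs_sum_le_sum_abs _ _).trans ?_
  refine (Finset.sum_le_card_nsmul _ _ b fun i hi => hb i (Finset.ne_of_mem_erase hi)).trans ?_
  rw [Finset.card_erase_of_mem (Finset.mem_univ j)]
  simp

section

variable {x y : ℤ} {j : Fin 4} {m : Fin 15} {c : ℤ × ℤ × ℤ × ℤ}

theorem abs_diffLog_le {i : Fin 4} (h : i ≠ j) : |diffLog i j| ≤ 3 := by
  obtain ⟨h1, h2⟩ := abs_sub_rt_mem h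
  norm_num at h1 h2
  have h3 : (0 : ℝ) ≤ diffLog i j := Real.log_nonneg (by linarith)
  rw [abs_of_nonneg h3, diffLog, Real.log_le_iff_le_exp (by linarith)]
  have h4 : (2.7 : ℝ) ^ 3 ≤ Real.exp 3 := by
    have : Real.exp 3 = Real.exp 1 ^ 3 := by rw [← Real.exp_nat_mul]; norm_num
    rw [this]
    exact pow_le_pow_left₀ (by norm_num) (by linarith [Real.exp_one_gt_d9]) 3
  norm_num at h4
  linarith

theorem IsNearest.abs_log_assoc_sub_le (h : IsNearest x y j) (hy : 2 ≤ |y|)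
    (ha : IsAssociated x y m c) {i : Fin 4} (hi : i ≠ j) :
    |Real.log |ev (rt i) c| - (Real.log |(y : ℝ)| + (diffLog i j - reprLog m i))| ≤
      3 / (y : ℝ) ^ 4 := by
  have h1 := h.abs_log_sub_le hy hi
  rw [ha.eq_mul, abs_mul, Real.log_mul (abs_ne_zero.2 (ev_reprVec_ne_zero m i))
    (abs_ne_zero.2 (ne_zero_of_abs_prod ha.abs_prod i))] at h1
  convert h1 using 2
  rw [diffLog, reprLog]
  ring

theorem IsNearest.abs_log_assoc_le (h : IsNearest x y j) (hy : 2 ≤ |y|)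
    (ha : IsAssociated x y m c) (i : Fin 4) :
    |(Real.log |ev (rt i) c|)| ≤ 3 * (Real.log |(y : ℝ)| + 24) := by
  have hy' : (2 : ℝ) ≤ |(y : ℝ)| := by exact_mod_cast hy
  have hlog : 0 ≤ Real.log |(y : ℝ)| := Real.log_nonneg (by linarith)
  have hy4 : 3 / (y : ℝ) ^ 4 ≤ 1 := by
    have e : (y : ℝ) ^ 4 = |(y : ℝ)| ^ 4 := by rw [← abs_pow, abs_of_nonneg (by positivity)]
    rw [e, div_le_one (by positivity)]
    have := pow_le_pow_left₀ (by norm_num) hy' 4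
    linarith
  have key : ∀ i, i ≠ j → |(Real.log |ev (rt i) c|)| ≤ Real.log |(y : ℝ)| + 24 := by
    intro i hi
    have h1 := abs_le.1 (h.abs_log_assoc_sub_le hy ha hi)
    have h2 := abs_le.1 (abs_diffLog_le hi)
    have h3 := abs_le.1 (abs_reprLog_le m i)
    rw [abs_le]
    constructor <;> linarith
  by_cases hi : i = j
  · rw [hi]
    exact abs_le_of_sum_eq_zero (sum_log_eq_zero ha.abs_prod) key
  · linarith [key i hi]

end

theorem Encl.fst_le_snd {x : ℝ} {p : ℤ × ℤ} (h : Encl x p) : p.1 ≤ p.2 := by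
  exact_mod_cast h.1.trans h.2

/-- An interval that avoids all multiples of `M`, in the sense of `avoidsMultiples`. -/
theorem not_mem_of_avoidsMultiples {M : ℕ} {lo hi : ℤ} (hM : 0 < M) (hle : lo ≤ hi)
    (h : avoidsMultiples M (lo % M).toNat (hi - lo).toNat = true) {k : ℕ} (hk : 0 < k)
    (hk' : k ≤ 343) (z : ℤ) : ¬ (k * lo ≤ M * z ∧ M * z ≤ k * hi) := by
  have h1 := avoidsMultiples_iff.1 h ⟨k - 1, by omega⟩
  simp only [Nat.sub_add_cancel hk] at h1
  have hM' : (M : ℤ) ≠ 0 := by exact_mod_cast hM.ne'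
  have e1 : (((lo % M).toNat : ℕ) : ℤ) = lo % M := Int.toNat_of_nonneg (Int.emod_nonneg _ hM')
  have e2 : (((hi - lo).toNat : ℕ) : ℤ) = hi - lo := Int.toNat_of_nonneg (by omega)
  generalize (lo % M).toNat = a at *
  generalize (hi - lo).toNat = w at *
  obtain ⟨h2, h3⟩ := h1
  rintro ⟨h4, h5⟩
  have e3 := Int.emod_add_mul_ediv lo M
  rw [← e1] at e3
  have e4 := Nat.mod_add_div (k * a) M
  generalize k * a % M = r at *
  generalize k * a / M = q at *
  zify at h2 h3 e4
  generalize lo / (M : ℤ) = q' at *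
  have e5 : (k : ℤ) * lo = r + M * (q + k * q') := by rw [← e3, mul_add, ← e4]; ring
  have e6 : (k : ℤ) * hi = k * lo + k * w := by rw [e2]; ring
  rw [e6, e5] at h5
  rw [e5] at h4
  generalize (q : ℤ) + k * q' = s at *
  have hMpos : (0 : ℤ) < M := by exact_mod_cast hM
  have h6 : (M : ℤ) * s < M * z := by linarith
  have h7 : (M : ℤ) * z < M * (s + 1) := by linarith
  have h8 := lt_of_mul_lt_mul_left h6 hMpos.le
  have h9 := lt_of_mul_lt_mul_left h7 hMpos.le
  omega

theorem encl_theta (p : Fin 4 → ℤ) (j : Fin 4) (m : Fin 15) :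
    Encl (∑ i, p i * (diffLog i j - reprLog m i)) (thetaI p j m) :=
  Encl.of_lin p fun i => by
    rw [sub_eq_add_neg]
    exact Encl.of_add (encl_diffLog i j) (Encl.of_neg (encl_reprLog m i))

theorem encl_defect (p : Fin 4 → ℤ) (D : ℤ) (n : Fin 3 → ℤ) (t : Fin 3) :
    Encl (∑ i, p i * unitLog t i - D * n t) (defectI p D n t) := by
  have := Encl.of_add (Encl.of_lin p (encl_sharpLog t)) (Encl.of_int (-(D * n t)))
  rw [sub_eq_add_neg, defectI]
  convert this using 2
  push_cast
  ring

theorem error_le_errorUp {p : Fin 4 → ℤ} {D : ℤ} {n : Fin 3 → ℤ} {y₀ Y : ℕ} (hy₀ : 0 < y₀)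
    {η B : ℝ} (hη : η ≤ 3 / (y₀ : ℝ) ^ 4) (hB0 : 0 ≤ B) (hB : B ≤ 3 * Y + 72) :
    ((∑ i, |(p i : ℝ)|) * η + B * ∑ t, |∑ i, p i * unitLog t i - D * n t|) * 2 ^ 400 ≤
      errorUp p D n y₀ Y := by
  have h1 : ∀ t, |∑ i, p i * unitLog t i - D * n t| * 2 ^ 400 ≤
      Encl.absUp (defectI p D n t) := fun t => Encl.abs_le_absUp (encl_defect p D n t)
  have h2 : (∑ t, |∑ i, p i * unitLog t i - D * n t|) * 2 ^ 400 ≤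
      (Encl.absUp (defectI p D n 0) : ℝ) + Encl.absUp (defectI p D n 1) +
        Encl.absUp (defectI p D n 2) := by
    rw [Fin.sum_univ_three, add_mul, add_mul]
    exact add_le_add (add_le_add (h1 0) (h1 1)) (h1 2)
  have h3 : 0 ≤ (∑ t, |∑ i, p i * unitLog t i - D * n t|) * (2 : ℝ) ^ 400 := by positivity
  have h4 := mul_le_mul hB h2 h3 (hB0.trans hB)
  have hy : (0 : ℤ) < y₀ ^ 4 := by positivity
  have hyR : (0 : ℝ) < (y₀ : ℝ) ^ 4 := by positivity
  set s : ℤ := |p 0| + |p 1| + |p 2| + |p 3| with hs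
  have h5 : ∑ i, |(p i : ℝ)| = s := by
    rw [Fin.sum_univ_four, hs]
    push_cast
    rfl
  have hs0 : (0 : ℝ) ≤ s := by
    rw [← h5]
    positivity
  have h6 := (Int.lt_ediv_add_one_mul_self (3 * s * 2 ^ 400) hy).le
  have h7 : (3 * s * 2 ^ 400 : ℝ) ≤ ((3 * s * 2 ^ 400 / y₀ ^ 4 + 1 : ℤ) : ℝ) * (y₀ : ℝ) ^ 4 := by
    exact_mod_cast h6
  have h8 : (∑ i, |(p i : ℝ)|) * η * 2 ^ 400 ≤ ((3 * s * 2 ^ 400 / y₀ ^ 4 + 1 : ℤ) : ℝ) := by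
    rw [h5]
    rw [← div_le_iff₀ hyR] at h7
    refine le_trans ?_ h7
    calc s * η * 2 ^ 400 ≤ s * (3 / (y₀ : ℝ) ^ 4) * 2 ^ 400 := by gcongr
      _ = _ := by ring
  unfold errorUp
  rw [← hs]
  push_cast at h8 ⊢
  generalize (2 : ℝ) ^ 400 = C at *
  linarith

theorem false_of_excludes {x y : ℤ} {j : Fin 4} {m : Fin 15} {c : ℤ × ℤ × ℤ × ℤ}
    {p : Fin 4 → ℤ} {D : ℕ} {n : Fin 3 → ℤ} {y₀ Y : ℕ} (h : excludes j p D n y₀ Y = true)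
    (hD : 0 < D) (hnear : IsNearest x y j) (ha : IsAssociated x y m c) (hy₀ : 2 ≤ y₀)
    (hy : (y₀ : ℤ) ≤ |y|) (hY : Real.log |(y : ℝ)| ≤ Y) : False := by
  simp only [excludes, callByValue_eq, Bool.and_eq_true, decide_eq_true_eq] at h
  obtain ⟨⟨hpj, hp⟩, h⟩ := h
  have hy2 : 2 ≤ |y| := le_trans (by exact_mod_cast hy₀) hy
  have hy2' : (2 : ℝ) ≤ |(y : ℝ)| := by exact_mod_cast hy2
  have hlog : 0 ≤ Real.log |(y : ℝ)| := Real.log_nonneg (by linarith)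
  obtain ⟨k, hk, hk', a, hka, haB⟩ := exists_log_unit_eq ha.abs_prod
  set B := 3 * (Real.log |(y : ℝ)| + 24) with hBdef
  have haB := haB B (by linarith) (hnear.abs_log_assoc_le hy2 ha)
  set τ : Fin 4 → ℝ := fun i => Real.log |ev (rt i) c| -
    (Real.log |(y : ℝ)| + (diffLog i j - reprLog m i)) with hτ
  set η := 3 / (y : ℝ) ^ 4 with hη
  have hη0 : 0 ≤ η := by positivity
  have hηle : η ≤ 3 / (y₀ : ℝ) ^ 4 := by
    have e : (y : ℝ) ^ 4 = |(y : ℝ)| ^ 4 := by rw [← abs_pow, abs_of_nonneg (by positivity)]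
    have h1 : (y₀ : ℝ) ≤ |(y : ℝ)| := by exact_mod_cast hy
    have h2 : (0 : ℝ) < y₀ := by exact_mod_cast (by omega : 0 < y₀)
    rw [hη, e]
    gcongr
  have hpτ : |∑ i, p i * τ i| ≤ (∑ i, |(p i : ℝ)|) * η := by
    rw [Finset.sum_mul]
    refine (Finset.abs_sum_le_sum_abs _ _).trans (Finset.sum_le_sum fun i _ => ?_)
    rw [abs_mul]
    by_cases hi : i = j
    · rw [hi, hpj]
      simp
    · exact mul_le_mul_of_nonneg_left (hnear.abs_log_assoc_sub_le hy2 ha hi) (abs_nonneg _)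
  have hpR : ∑ i, (p i : ℝ) = 0 := by
    rw [Fin.sum_univ_four]
    exact_mod_cast hp
  set Θ := ∑ i, p i * (diffLog i j - reprLog m i) with hΘ
  set d : Fin 3 → ℝ := fun t => ∑ i, p i * unitLog t i - D * n t with hd
  have key : (k : ℝ) * Θ = D * ((∑ t, a t * n t : ℤ) : ℝ) + (∑ t, a t * d t - k * ∑ i, p i * τ i) := by
    have h1 : ∑ i, p i * (k * Real.log |ev (rt i) c|) = ∑ t, a t * ∑ i, p i * unitLog t i := by
      simp only [hka, Finset.mul_sum]
      rw [Finset.sum_comm]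
      exact Finset.sum_congr rfl fun t _ => Finset.sum_congr rfl fun i _ => by ring
    have h2 : ∑ i, p i * (k * Real.log |ev (rt i) c|) =
        k * Θ + k * ∑ i, p i * τ i + k * Real.log |(y : ℝ)| * ∑ i, (p i : ℝ) := by
      rw [hΘ, hτ, Finset.mul_sum, Finset.mul_sum, Finset.mul_sum, ← Finset.sum_add_distrib,
        ← Finset.sum_add_distrib]
      exact Finset.sum_congr rfl fun i _ => by ring
    have h3 : ∑ t, a t * d t = (∑ t, a t * ∑ i, p i * unitLog t i) - D * ((∑ t, a t * n t : ℤ) : ℝ) := by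
      rw [hd]
      push_cast
      rw [Finset.mul_sum, ← Finset.sum_sub_distrib]
      exact Finset.sum_congr rfl fun t _ => by ring
    rw [hpR, mul_zero, add_zero] at h2
    rw [h3, ← h1, h2]
    ring
  have herr : |∑ t, a t * d t - k * ∑ i, p i * τ i| ≤
      k * ((∑ i, |(p i : ℝ)|) * η + B * ∑ t, |d t|) := by
    have h1 := sum_mul_abs_le (l := d) haB
    have h2 : |(k : ℝ) * ∑ i, p i * τ i| ≤ k * ((∑ i, |(p i : ℝ)|) * η) := by
      rw [abs_mul, Nat.abs_cast]
      gcongr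
    have h3 := abs_sub (∑ t, a t * d t) (k * ∑ i, p i * τ i)
    linarith
  have hE := error_le_errorUp (p := p) (D := D) (n := n) (by omega : 0 < y₀) hηle
    (by positivity : 0 ≤ B) (by rw [hBdef]; linarith : B ≤ 3 * Y + 72)
  have hE0 : 0 ≤ errorUp p D n y₀ Y := by
    have : (0 : ℝ) ≤ errorUp p D n y₀ Y := le_trans (by positivity) hE
    exact_mod_cast this
  have hΘI := encl_theta p j m
  have hM : 0 < D * 2 ^ 400 := by positivity
  have e := Int.toNat_of_nonneg hE0
  generalize (errorUp p D n y₀ Y).toNat = E at h e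
  rw [← e] at hE
  have hle := hΘI.fst_le_snd
  refine not_mem_of_avoidsMultiples (M := D * 2 ^ 400) (lo := (thetaI p j m).1 - E)
    (hi := (thetaI p j m).2 + E) hM (by omega) ?_ hk hk' (∑ t, a t * n t) ?_
  · have := h m
    rwa [show (thetaI p j m).2 + (E : ℤ) - ((thetaI p j m).1 - E) =
      (thetaI p j m).2 - (thetaI p j m).1 + 2 * E by ring, Nat.cast_mul, Nat.cast_pow, Nat.cast_ofNat]
  · obtain ⟨h1, h2⟩ := hΘI
    rw [← hΘ] at h1 h2
    have hk0 : (0 : ℝ) ≤ k := Nat.cast_nonneg _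
    have h3 := abs_le.1 herr
    have h4 : (k : ℝ) * ((∑ i, |(p i : ℝ)|) * η + B * ∑ t, |d t|) * 2 ^ 400 ≤ k * E := by
      rw [mul_assoc]
      exact mul_le_mul_of_nonneg_left hE hk0
    have hC : (0 : ℝ) ≤ 2 ^ 400 := by positivity
    have h5 := mul_le_mul_of_nonneg_right h3.1 hC
    have h6 := mul_le_mul_of_nonneg_right h3.2 hC
    have h7 := mul_le_mul_of_nonneg_left h1 hk0
    have h8 := mul_le_mul_of_nonneg_left h2 hk0
    have key' := congrArg (· * (2 : ℝ) ^ 400) key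
    generalize ∑ t, a t * d t - k * ∑ i, p i * τ i = X at *
    generalize (∑ i, |(p i : ℝ)|) * η + B * ∑ t, |d t| = W at *
    generalize ∑ t, a t * n t = z at *
    have g1 : (k : ℝ) * ((thetaI p j m).1 - E) ≤ D * 2 ^ 400 * z := by
      generalize (2 : ℝ) ^ 400 = C at *
      nlinarith
    have g2 : (D : ℝ) * 2 ^ 400 * z ≤ k * ((thetaI p j m).2 + E) := by
      generalize (2 : ℝ) ^ 400 = C at *
      nlinarith
    exact ⟨by exact_mod_cast g1, by exact_mod_cast g2⟩

/-- There are no solutions with `1000 ≤ |y|` and `log |y| ≤ 10 ^ 67`. -/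
theorem false_of_isAssociated_of_log_le {x y : ℤ} {j : Fin 4} {m : Fin 15} {c : ℤ × ℤ × ℤ × ℤ}
    (hnear : IsNearest x y j) (ha : IsAssociated x y m c) (hy : 1000 ≤ |y|)
    (hY : Real.log |(y : ℝ)| ≤ 10 ^ 67) : False := by
  rcases le_total ((10 ^ 13 : ℤ)) |y| with h | h
  · exact false_of_excludes (excludes_huge j) (by norm_num) hnear ha (by norm_num) (by exact_mod_cast h)
      (by exact_mod_cast hY)
  · refine false_of_excludes (excludes_large j) (by norm_num) hnear ha (by norm_num)
      (by exact_mod_cast hy) ?_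
    have h0 : (0 : ℝ) < |(y : ℝ)| := by
      have : (0 : ℤ) < |y| := by linarith
      exact_mod_cast this
    have h1 : |(y : ℝ)| ≤ 10 ^ 13 := by exact_mod_cast h
    have h2 : |(y : ℝ)| ≤ 2 ^ 44 := h1.trans (by norm_num)
    have h3 := Real.log_le_log h0 h2
    rw [Real.log_pow] at h3
    have h4 := Real.log_two_lt_d9
    push_cast at h3 ⊢
    linarith

theorem log_fiftyfive_bounds : 4.007 ≤ Real.log 55 ∧ Real.log 55 ≤ 4.008 := by
  have h := Encl.of_within (a := 4007) (c := 4008) (b := 10 ^ 3)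
    (Encl.of_logAbs (Encl.of_rat 55 (b := 1) one_pos) (by decide +kernel)) (by decide +kernel)
  norm_num at h ⊢
  exact h

theorem log_le_twentysix {z : ℝ} (h0 : 0 < z) (hz : z ≤ 177000000000) : Real.log z ≤ 26 := by
  have h := Encl.of_within (a := 0) (c := 26) (b := 1)
    (Encl.of_logAbs (Encl.of_rat 177000000000 (b := 1) one_pos) (by decide +kernel))
    (by decide +kernel)
  norm_num at h
  exact (Real.log_le_log h0 hz).trans h.2

theorem log_le_div_add {z : ℝ} (h0 : 0 < z) : Real.log z ≤ z / 2 ^ 60 + 60 := by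
  have h1 := Real.log_le_sub_one_of_pos (show 0 < z / 2 ^ 60 by positivity)
  rw [Real.log_div h0.ne' (by positivity), Real.log_pow] at h1
  have h2 := Real.log_two_lt_d9
  push_cast at h1
  linarith

theorem abs_pow_sub_one_le {ξ s : ℝ} (h : |ξ - 1| ≤ s) (n : ℕ) (hn : n * s ≤ 1) :
    |ξ ^ n - 1| ≤ 2 * (n * s) := by
  have hs : 0 ≤ s := (abs_nonneg _).trans h
  have h1 : |ξ ^ n - 1| ≤ (1 + s) ^ n - 1 := by
    have hξ : |ξ| ≤ 1 + s := by
      have := abs_add_le (ξ - 1) 1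
      rw [sub_add_cancel, abs_one] at this
      linarith
    rw [← mul_geom_sum ξ n, ← mul_geom_sum (1 + s) n, abs_mul, add_sub_cancel_left]
    refine mul_le_mul h ?_ (abs_nonneg _) hs
    refine (Finset.abs_sum_le_sum_abs _ _).trans (Finset.sum_le_sum fun i _ => ?_)
    rw [abs_pow]
    exact pow_le_pow_left₀ (abs_nonneg _) hξ i
  have h2 : (1 + s) ^ n ≤ Real.exp (n * s) := by
    rw [Real.exp_nat_mul]
    exact pow_le_pow_left₀ (by linarith) (by linarith [Real.add_one_le_exp s]) n
  have h3 := Real.abs_exp_sub_one_le (x := n * s) (by rwa [abs_of_nonneg (by positivity)])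
  rw [abs_of_nonneg (show 0 ≤ (n : ℝ) * s by positivity)] at h3
  linarith [le_abs_self (Real.exp (n * s) - 1)]

theorem final_inequality {r R K N P : ℝ} {T w D : ℝ} (hr : 158 * 10 ^ 38 ≤ r) (hP : P = r * 10 ^ 32)
    (hR : R ≤ 25 / 10 ^ 8 * r) (hK : 31249 / 10 ^ 14 * P ≤ K)
    (hK' : K ≤ 3125 / 10 ^ 13 * P) (hN : N = K * 800) (hT : T ≤ 63 * 10 ^ 25) (hT0 : 0 ≤ T)
    (hD : D ≤ 26) (hw : |w| ≤ 8 / 10 ^ 13) :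
    25 * Real.log (N + 1) + Real.log 2 + 24 * (800 * 10 ^ 32 * D) +
      24 * (K * (1 + Real.log ((55 * P + K) / K))) + 800 * |w| * (55 * P) +
      23 * (800 * (R * (4 * T + 1) + 10 ^ 32 * (4 * T + 16 / 10 ^ 13 * r + 18))) <
      (N - 1) / 2 * Real.log 55 := by
  have hP0 : 0 < P := by rw [hP]; positivity
  have hK0 : 0 < K := by linarith
  have h1 := log_le_div_add (z := N + 1) (by rw [hN]; linarith)
  have h2 := Real.log_two_lt_d9
  have h3 : Real.log ((55 * P + K) / K) ≤ 26 := by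
    refine log_le_twentysix (by positivity) ?_
    rw [div_le_iff₀ hK0]
    linarith
  have h4 : K * (1 + Real.log ((55 * P + K) / K)) ≤ K * 27 :=
    mul_le_mul_of_nonneg_left (by linarith) hK0.le
  have h5 : 800 * |w| * (55 * P) ≤ 800 * (8 / 10 ^ 13) * (55 * P) := by gcongr
  have h6 : R * (4 * T + 1) ≤ 25 / 10 ^ 8 * r * (4 * (63 * 10 ^ 25) + 1) := by gcongr
  have h7 : (N - 1) / 2 * 4.007 ≤ (N - 1) / 2 * Real.log 55 :=
    mul_le_mul_of_nonneg_left log_fiftyfive_bounds.1 (by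
      rw [hN]
      have : 10 ^ 60 ≤ P := by rw [hP]; linarith
      linarith)
  generalize Real.log ((55 * P + K) / K) = l at *
  generalize Real.log 55 = l' at *
  generalize Real.log (N + 1) = l1 at *
  generalize Real.log 2 = l2 at *
  generalize K * (1 + l) = X at *
  generalize 800 * |w| * (55 * P) = X2 at *
  generalize R * (4 * T + 1) = X3 at *
  generalize (N - 1) / 2 * l' = X4 at *
  subst hN hP
  norm_num at *
  linarith

theorem exp_mul_pow_le_one {s P : ℝ} {N : ℕ} (hP : (N : ℝ) ≤ 25 / 10 ^ 8 * P)
    (hs : s + 500 + 4.008 * (25 / 10 ^ 8 * P) ≤ 0) : 10 ^ 40 * Real.exp s * 55 ^ N ≤ 1 := by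
  rw [← Real.log_nonpos_iff (by positivity), Real.log_mul (by positivity) (by positivity),
    Real.log_mul (by positivity) (by positivity), Real.log_exp, Real.log_pow, Real.log_pow]
  have h1 := log_fiftyfive_bounds.2
  have h2 : Real.log 10 ≤ 10 - 1 := Real.log_le_sub_one_of_pos (by norm_num)
  have h3 : (N : ℝ) * Real.log 55 ≤ 25 / 10 ^ 8 * P * 4.008 :=
    mul_le_mul hP h1 (Real.log_nonneg (by norm_num)) ((Nat.cast_nonneg _).trans hP)
  push_cast
  linarith

theorem false_of_close_power_of_large {L : Type*} [Field L] [NumberField L] [IsGalois ℚ L]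
    (φ : L →+* ℝ) (hcard : Fintype.card (L ≃ₐ[ℚ] L) ≤ 24) {ω g : L} {r d : ℕ} {w ξ T : ℝ}
    (hd : 1 ≤ d) (hω : IsIntegral ℤ ω) (hg : IsIntegral ℤ ((d : L) * g)) (hg0 : g ≠ 0)
    (hw0 : w ≠ 0) (hφω : φ ω = Real.exp w) (hφg : φ g = Real.exp (w * r) * ξ)
    (hσω : ∀ σ : L ≃ₐ[ℚ] L, |φ (σ ω)| ≤ Real.exp (4 * T + 1))
    (hσg : ∀ σ : L ≃ₐ[ℚ] L, |φ (σ g)| ≤ Real.exp (4 * T + 16 / 10 ^ 13 * r + 18))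
    (hr : (158 * 10 ^ 38 : ℝ) ≤ r) (hT : 166 * 10 ^ 24 ≤ T) (hT' : T ≤ 63 * 10 ^ 25)
    (hD : Real.log d ≤ 26) (hw : |w| ≤ 8 / 10 ^ 13)
    (hξ : |ξ - 1| ≤ 10 * Real.exp (-(4 * r * T))) : False := by
  have hr' : 158 * 10 ^ 38 ≤ r := by exact_mod_cast hr
  set R : ℕ := 25 * r / 10 ^ 8 with hR
  set K : ℕ := (R - 800) * 10 ^ 32 / 800 with hK
  have hR1 : R ≤ r := by omega
  have hR2 : 25 * r ≤ 10 ^ 8 * R + 10 ^ 8 := by omega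
  have hR3 : 10 ^ 8 * R ≤ 25 * r := by omega
  have hK1 : 800 * K ≤ (R - 800) * 10 ^ 32 := by omega
  have hK2 : (R - 800) * 10 ^ 32 ≤ 800 * K + 800 := by
    have h1 := Nat.div_add_mod ((R - 800) * 10 ^ 32) 800
    have h2 := Nat.mod_lt ((R - 800) * 10 ^ 32) (show 800 > 0 by norm_num)
    rw [← hK] at h1
    exact h1.symm.le.trans (Nat.add_le_add_left h2.le _)
  have hR2' : 25 * (r : ℝ) ≤ 10 ^ 8 * R + 10 ^ 8 := by exact_mod_cast hR2
  have hR3' : 10 ^ 8 * (R : ℝ) ≤ 25 * r := by exact_mod_cast hR3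
  have hsub : ((R - 800 : ℕ) : ℝ) = R - 800 := by
    rw [Nat.cast_sub (by omega)]
    norm_num
  have hK1' : 800 * (K : ℝ) ≤ (R - 800) * 10 ^ 32 := by
    rw [← hsub]
    exact_mod_cast hK1
  have hK2' : ((R : ℝ) - 800) * 10 ^ 32 ≤ 800 * K + 800 := by
    rw [← hsub]
    exact_mod_cast hK2
  have hK0 : 0 < K := by omega
  refine false_of_close_power φ hcard (R := R) (S := 10 ^ 32) (K := K) (H := 800) (N := K * 800)
    (Hω := 4 * T + 1) (Hg := 4 * T + 16 / 10 ^ 13 * r + 18) (ρ := 55) (ξ := ξ) hd hω hg hg0 hw0 hφω hφg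
    (by linarith) (by positivity) hσω hσg (by norm_num) hR1 hK0 (by norm_num) (by omega)
    (by norm_num) (by omega) rfl ?_ ?_
  · intro l hl q hq
    have hn : ((l * q : ℕ) : ℝ) ≤ 10 ^ 35 := by
      have : l * q ≤ 800 * 10 ^ 32 := Nat.mul_le_mul hl.le hq.le
      have h2 : l * q ≤ 10 ^ 35 := this.trans (by norm_num)
      exact_mod_cast h2
    have hN : ((K * 800 : ℕ) : ℝ) ≤ 25 / 10 ^ 8 * (r * 10 ^ 32) := by
      push_cast
      linarith
    have hs : -(4 * r * T) + 500 + 4.008 * (25 / 10 ^ 8 * ((r : ℝ) * 10 ^ 32)) ≤ 0 := by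
      have : 4 * (r : ℝ) * (166 * 10 ^ 24) ≤ 4 * r * T := by gcongr
      norm_num at this hr ⊢
      linarith
    have h1 := exp_mul_pow_le_one hN hs
    have h55 : (1 : ℝ) ≤ 55 ^ (K * 800) := one_le_pow₀ (by norm_num)
    generalize (55 : ℝ) ^ (K * 800) = Z at *
    have hE := Real.exp_pos (-(4 * r * T))
    generalize Real.exp (-(4 * r * T)) = E at *
    have h2 : ((l * q : ℕ) : ℝ) * (10 * E) ≤ 10 ^ 35 * (10 * E) := by gcongr
    have h3 : 10 ^ 40 * E ≤ 1 := (le_mul_of_one_le_right (by positivity) h55).trans h1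
    have h4 := abs_pow_sub_one_le hξ (l * q)
    generalize ((l * q : ℕ) : ℝ) * (10 * E) = A at *
    have h5 : |ξ ^ (l * q) - 1| ≤ 10 ^ 40 * E := by
      have h6 := h4 (by linarith)
      linarith
    exact (mul_le_mul_of_nonneg_right h5 (by linarith)).trans h1
  · have h := final_inequality (r := r) (R := R) (K := K) (N := ((K * 800 : ℕ) : ℝ)) (P := r * 10 ^ 32)
      (T := T) (w := w) (D := Real.log d) hr rfl (by linarith)
      (by linarith) (by linarith) (by push_cast; ring) hT' (by linarith) hD hw
    simp only [Nat.cast_pow, Nat.cast_ofNat] at h ⊢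
    exact h

/-- Exponents of a unit with almost equal absolute values at the places different from `j`. -/
def etaExp : Fin 4 → Fin 3 → ℤ :=
  ![![8451786907300151732279548, 78715861432492633301612371, 105576376196904067597388083],
    ![238494828420344079114652504, -22407935775066186119897379, -3007476133576952329255350],
    ![-26219060511393912181649899, 31898113102692920733443181, -23461977356132413294432487],
    ![-95486371407280378288982796, -94050108814384379426400937, -7956881729560533118179628]]

/-- Numerators of the common approximate logarithms of the units given by `etaExp`. -/
def etaNum : Fin 4 → ℤ :=
  ![620482720376682200485095766639625840050989, 558401300436607362091647988455587260676723,
    166175004753725957181158969385716008435713, 337473945911259699887425623619905284085353]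

/-- The logarithms of the units given by `etaExp`. -/
noncomputable def etaLog (j i : Fin 4) : ℝ := ∑ t, etaExp j t * unitLog t i

/-- The common approximate logarithm of the unit given by `etaExp j`. -/
noncomputable def etaSize (j : Fin 4) : ℝ := etaNum j / 10 ^ 15

/-- Intervals for `etaLog`. -/
def etaLogI (j i : Fin 4) : ℤ × ℤ :=
  Encl.add (Encl.add (Encl.smul (etaExp j 0) (sharpLogI 0 i)) (Encl.smul (etaExp j 1) (sharpLogI 1 i)))
    (Encl.smul (etaExp j 2) (sharpLogI 2 i))

theorem encl_etaLog (j i : Fin 4) : Encl (etaLog j i) (etaLogI j i) := by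
  rw [etaLog, Fin.sum_univ_three]
  exact Encl.of_add (Encl.of_add (Encl.of_smul _ (encl_sharpLog 0 i)) (Encl.of_smul _ (encl_sharpLog 1 i)))
    (Encl.of_smul _ (encl_sharpLog 2 i))

theorem etaLogI_spec : ∀ j i : Fin 4, i ≠ j →
    Encl.within (etaLogI j i) (etaNum j - 400) (etaNum j + 400) (10 ^ 15) = true ∧
    ∀ k, k ≠ j → i ≠ k →
      (etaLogI j i).2 < (etaLogI j k).1 ∨ (etaLogI j k).2 < (etaLogI j i).1 := by
  decide +kernel

theorem abs_etaLog_sub_le {j i : Fin 4} (h : i ≠ j) : |etaLog j i - etaSize j| ≤ 4 / 10 ^ 13 := by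
  have h1 := Encl.of_within (encl_etaLog j i) (etaLogI_spec j i h).1
  rw [etaSize, abs_le]
  push_cast at h1
  rw [sub_div, add_div] at h1
  constructor <;> linarith [h1.1, h1.2]

theorem etaLog_ne {j i k : Fin 4} (hi : i ≠ j) (hk : k ≠ j) (hik : i ≠ k) :
    etaLog j i ≠ etaLog j k := by
  intro h
  have hS : (0 : ℝ) < 2 ^ 400 := by positivity
  have h1 := encl_etaLog j i
  have h2 := encl_etaLog j k
  rw [h] at h1
  rcases (etaLogI_spec j i hi).2 k hk hik with h3 | h3
  · have h4 : (((etaLogI j i).2 : ℤ) : ℝ) < ((etaLogI j k).1 : ℤ) := by exact_mod_cast h3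
    exact absurd (h2.1.trans h1.2) (not_le.2 h4)
  · have h4 : (((etaLogI j k).2 : ℤ) : ℝ) < ((etaLogI j i).1 : ℤ) := by exact_mod_cast h3
    exact absurd (h1.1.trans h2.2) (not_le.2 h4)

theorem sum_etaLog (j : Fin 4) : ∑ i, etaLog j i = 0 := by
  simp only [etaLog]
  rw [Finset.sum_comm]
  simp only [← Finset.mul_sum, sum_unitLog, mul_zero, Finset.sum_const_zero]

theorem etaSize_bounds (j : Fin 4) : 166 * 10 ^ 24 ≤ etaSize j ∧ etaSize j ≤ 621 * 10 ^ 24 := by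
  have h : ∀ j, 166 * 10 ^ 39 ≤ etaNum j ∧ etaNum j ≤ 621 * 10 ^ 39 := by decide +kernel
  have h1 : (166 * 10 ^ 39 : ℝ) ≤ (etaNum j : ℝ) := by exact_mod_cast (h j).1
  have h2 : (etaNum j : ℝ) ≤ 621 * 10 ^ 39 := by exact_mod_cast (h j).2
  rw [etaSize, le_div_iff₀ (by norm_num), div_le_iff₀ (by norm_num)]
  constructor <;> linarith

/-- The unit given by `etaExp j` and its inverse. -/
theorem exists_eta (j : Fin 4) : ∃ e e' : ℤ × ℤ × ℤ × ℤ,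
    (∀ i, Real.log |ev (rt i) e| = etaLog j i) ∧ ∀ i, ev (rt i) e * ev (rt i) e' = 1 := by
  obtain ⟨e, he⟩ := exists_ev_eq_prod_zpow ℝ (etaExp j)
  obtain ⟨e', he'⟩ := exists_ev_eq_prod_zpow ℝ fun t => -etaExp j t
  refine ⟨e, e', fun i => ?_, fun i => ?_⟩
  · rw [he _ (quartic_rt i), Finset.abs_prod, Real.log_prod fun t _ =>
      abs_ne_zero.2 (zpow_ne_zero _ (ev_eps_ne_zero (quartic_rt i) t))]
    refine Finset.sum_congr rfl fun t _ => ?_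
    rw [abs_zpow, Real.log_zpow, unitLog]
  · rw [he _ (quartic_rt i), he' _ (quartic_rt i), ← Finset.prod_mul_distrib]
    refine Finset.prod_eq_one fun t _ => ?_
    rw [← zpow_add₀ (ev_eps_ne_zero (quartic_rt i) t), add_neg_cancel, zpow_zero]

/-- The derivative of the quartic at its roots. -/
def derivVec : ℤ × ℤ × ℤ × ℤ := (72, -70, -71, 64)

theorem prod_ev_derivVec : ∏ i, ev (rt i) derivVec = (4019825664 : ℤ) :=
  prod_ev_eq (by decide +kernel)

theorem ev_derivVec_eq_mul {K : Type*} [Field K] [CharZero K] {a b : K} (ha : quartic a = 0)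
    (hb : quartic b = 0) (hab : a ≠ b) :
    ev a derivVec = (a - b) * (3 * a ^ 2 + 2 * a * b + b ^ 2 - 18 * a - 9 * b - 21) := by
  have h : (a - b) * (a ^ 3 + a ^ 2 * b + a * b ^ 2 + b ^ 3 - 9 * (a ^ 2 + a * b + b ^ 2)
      - 21 * (a + b) + 88) = 0 := by
    have : quartic a - quartic b = 0 := by rw [ha, hb, sub_zero]
    rw [← this]
    simp only [quartic]
    ring
  have h1 := (mul_eq_zero.1 h).resolve_left (sub_ne_zero.2 hab)
  have h16 : (16 : K) ≠ 0 := by norm_num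
  simp only [ev, derivVec]
  push_cast
  field_simp
  linear_combination 16 * h1

theorem isIntegral_disc_div {i j : Fin 4} (hij : i ≠ j) :
    IsIntegral ℤ ((4019825664 : rootField) / (rtL i - rtL j)) := by
  have h : (4019825664 : rootField) = ∏ l, ev (rtL l) derivVec := by
    refine (algebraMap rootField ℝ).injective ?_
    rw [map_prod]
    simp only [algebraMap_ev_rtL]
    rw [prod_ev_derivVec, map_ofNat]
    norm_num
  have hne : rtL i ≠ rtL j := fun h => hij (rtL_injective h)
  rw [h, ← Finset.mul_prod_erase _ _ (Finset.mem_univ i),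
    ev_derivVec_eq_mul (quartic_rtL i) (quartic_rtL j) hne, mul_assoc,
    mul_div_cancel_left₀ _ (sub_ne_zero.2 hne)]
  have h1 := isIntegral_of_quartic (quartic_rtL i)
  have h2 := isIntegral_of_quartic (quartic_rtL j)
  have hInt : ∀ n : ℤ, IsIntegral ℤ (n : rootField) := fun n => isIntegral_algebraMap (R := ℤ) (x := n)
  refine IsIntegral.mul ?_ (IsIntegral.prod _ fun l _ => isIntegral_ev (quartic_rtL l) _)
  have h3 := (((((hInt 3).mul (h1.pow 2)).add (((hInt 2).mul h1).mul h2)).add (h2.pow 2)).sub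
    ((hInt 18).mul h1)).sub ((hInt 9).mul h2) |>.sub (hInt 21)
  push_cast at h3
  exact h3

theorem isIntegral_sub_rtL_mul (x y : ℤ) (i : Fin 4) :
    IsIntegral ℤ ((x : rootField) - rtL i * y) := by
  have hInt : ∀ n : ℤ, IsIntegral ℤ (n : rootField) := fun n => isIntegral_algebraMap (R := ℤ) (x := n)
  exact (hInt x).sub ((isIntegral_of_quartic (quartic_rtL i)).mul (hInt y))

theorem isIntegral_div_sub_rtL_mul {x y m : ℤ} (h : ∏ i, ((x : ℝ) - rt i * y) = m) (hm : m ≠ 0)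
    (k : Fin 4) : IsIntegral ℤ ((m : rootField) / ((x : rootField) - rtL k * y)) := by
  have hprod : (m : rootField) = ∏ i, ((x : rootField) - rtL i * y) := by
    refine (algebraMap rootField ℝ).injective ?_
    rw [map_prod, map_intCast, ← h]
    simp only [map_sub, map_mul, map_intCast, algebraMap_rtL]
  have hne : (x : rootField) - rtL k * y ≠ 0 := by
    intro h0
    rw [Finset.prod_eq_zero (Finset.mem_univ k) h0] at hprod
    exact hm (by exact_mod_cast hprod)
  rw [hprod, ← Finset.mul_prod_erase _ _ (Finset.mem_univ k), mul_div_cancel_left₀ _ hne]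
  exact IsIntegral.prod _ fun l _ => isIntegral_sub_rtL_mul x y l

theorem exists_pair (s : Fin 4 → Bool) (j : Fin 4) : ∃ i k, i ≠ k ∧ i ≠ j ∧ k ≠ j ∧ s i = s k := by
  revert s j
  decide +kernel

/-- A bound for differences of numbers whose sum is known and which are all but one controlled. -/
theorem sub_le_of_sum_eq {L : Fin 4 → ℝ} {j : Fin 4} {lo hi S B : ℝ} (h : ∑ i, L i = S)
    (hL : ∀ i, i ≠ j → lo ≤ L i ∧ L i ≤ hi) (h1 : 4 * hi - S ≤ B) (h2 : S - 4 * lo ≤ B)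
    (h3 : hi - lo ≤ B) {p q : Fin 4} (hpq : p ≠ q) : L p - L q ≤ B := by
  have hj : 3 * lo ≤ S - L j ∧ S - L j ≤ 3 * hi := by
    rw [← Finset.add_sum_erase _ _ (Finset.mem_univ j)] at h
    have hc : (Finset.univ.erase j).card = 3 := by
      rw [Finset.card_erase_of_mem (Finset.mem_univ j)]
      simp
    have ha := Finset.card_nsmul_le_sum (Finset.univ.erase j) L lo
      fun i hi => (hL i (Finset.ne_of_mem_erase hi)).1
    have hb := Finset.sum_le_card_nsmul (Finset.univ.erase j) L hi
      fun i hi => (hL i (Finset.ne_of_mem_erase hi)).2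
    rw [hc, nsmul_eq_mul] at ha hb
    push_cast at ha hb
    constructor <;> linarith
  rcases eq_or_ne p j with rfl | hp
  · linarith [hL q hpq.symm]
  · rcases eq_or_ne q j with rfl | hq
    · linarith [hL p hp]
    · linarith [hL p hp, hL q hq]

theorem etaLog_sub_le {j p q : Fin 4} (hpq : p ≠ q) :
    etaLog j p - etaLog j q ≤ 4 * etaSize j + 1 := by
  have hT := (etaSize_bounds j).1
  refine sub_le_of_sum_eq (j := j) (lo := etaSize j - 4 / 10 ^ 13) (hi := etaSize j + 4 / 10 ^ 13)
    (sum_etaLog j) (fun i hi => ?_) ?_ ?_ ?_ hpq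
  · have := abs_le.1 (abs_etaLog_sub_le hi)
    constructor <;> linarith
  all_goals linarith

section

variable {x y m : ℤ} {j : Fin 4} {r : ℕ}

theorem IsNearest.log_sub_etaLog_bounds (h : IsNearest x y j) (hy : 2 ≤ |y|)
    (hr : r * etaSize j ≤ Real.log |(y : ℝ)|) (hr' : Real.log |(y : ℝ)| ≤ (r + 1) * etaSize j)
    {i : Fin 4} (hi : i ≠ j) :
    -(4 / 10 ^ 13 * (r : ℝ)) - 4 ≤ Real.log |(x : ℝ) - rt i * y| - r * etaLog j i ∧
      Real.log |(x : ℝ) - rt i * y| - r * etaLog j i ≤ etaSize j + 4 + 4 / 10 ^ 13 * (r : ℝ) := by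
  have h1 := abs_le.1 (h.abs_log_sub_le hy hi)
  have h2 := abs_le.1 (abs_diffLog_le hi)
  rw [diffLog] at h2
  have hy' : (2 : ℝ) ≤ |(y : ℝ)| := by exact_mod_cast hy
  have hy4 : 3 / (y : ℝ) ^ 4 ≤ 1 := by
    have h5 : (2 : ℝ) ^ 4 ≤ |(y : ℝ)| ^ 4 := pow_le_pow_left₀ (by norm_num) hy' 4
    rw [← abs_pow, abs_of_nonneg (by positivity)] at h5
    rw [div_le_one (by linarith)]
    linarith
  have h3 : |r * (etaLog j i - etaSize j)| ≤ r * (4 / 10 ^ 13) := by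
    rw [abs_mul, Nat.abs_cast]
    exact mul_le_mul_of_nonneg_left (abs_etaLog_sub_le hi) (Nat.cast_nonneg r)
  have h4 := abs_le.1 h3
  rw [mul_sub] at h4
  rw [add_mul, one_mul] at hr'
  constructor <;> linarith [h1.1, h1.2, h2.1, h2.2, h4.1, h4.2]

theorem IsNearest.log_sub_etaLog_sub_le (h : IsNearest x y j) (hy : 2 ≤ |y|)
    (hF : ∏ i, ((x : ℝ) - rt i * y) = m) (hm : m ≠ 0) (hm36 : |m| ≤ 36)
    (hr : r * etaSize j ≤ Real.log |(y : ℝ)|) (hr' : Real.log |(y : ℝ)| ≤ (r + 1) * etaSize j)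
    {p q : Fin 4} (hpq : p ≠ q) :
    (Real.log |(x : ℝ) - rt p * y| - r * etaLog j p) -
      (Real.log |(x : ℝ) - rt q * y| - r * etaLog j q) ≤
      4 * etaSize j + 16 / 10 ^ 13 * r + 16 := by
  have hm' : (m : ℝ) ≠ 0 := by exact_mod_cast hm
  have hne : ∀ i, (x : ℝ) - rt i * y ≠ 0 := fun i h0 => by
    rw [Finset.prod_eq_zero (Finset.mem_univ i) h0] at hF
    exact hm' hF.symm
  have hT := (etaSize_bounds j).1
  have hsum : ∑ i, (Real.log |(x : ℝ) - rt i * y| - r * etaLog j i) = Real.log |(m : ℝ)| := by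
    rw [Finset.sum_sub_distrib, ← Finset.mul_sum, sum_etaLog, mul_zero, sub_zero,
      ← Real.log_prod fun i _ => abs_ne_zero.2 (hne i), ← Finset.abs_prod, hF]
  have hm1 : (1 : ℝ) ≤ |(m : ℝ)| := by exact_mod_cast Int.one_le_abs hm
  have hlog0 := Real.log_nonneg hm1
  have hlog1 : Real.log |(m : ℝ)| ≤ 6 := by
    have h36 : |(m : ℝ)| ≤ 2 ^ 6 := by
      have : |(m : ℝ)| ≤ 36 := by exact_mod_cast hm36
      linarith
    have h1 := Real.log_le_log (by linarith) h36
    rw [Real.log_pow] at h1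
    have h2 := Real.log_two_lt_d9
    push_cast at h1
    linarith
  refine sub_le_of_sum_eq (L := fun i => Real.log |(x : ℝ) - rt i * y| - r * etaLog j i) hsum
    (fun i hi => h.log_sub_etaLog_bounds hy hr hr' hi) ?_ ?_ ?_ hpq
  all_goals linarith [(Nat.cast_nonneg r : (0 : ℝ) ≤ r)]

theorem IsNearest.abs_ratio_sub_one_le (h : IsNearest x y j) (hy : 2 ≤ |y|) {i k : Fin 4}
    (hij : i ≠ j) (hkj : k ≠ j) (hik : i ≠ k) :
    |(rt k - rt j) * ((x : ℝ) - rt i * y) / ((rt i - rt j) * ((x : ℝ) - rt k * y)) - 1| ≤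
      10 * Real.exp (-(4 * Real.log |(y : ℝ)|)) := by
  have hy' : (2 : ℝ) ≤ |(y : ℝ)| := by exact_mod_cast hy
  have hy0 : (0 : ℝ) < |(y : ℝ)| := by linarith
  have h1 := h.le_abs k hkj
  have h2 := h.abs_mul_le
  have hd := abs_sub_rt_mem hij
  have hd' := abs_sub_rt_mem hkj
  have hd2 := abs_sub_rt_mem hik.symm
  have hexp : Real.exp (-(4 * Real.log |(y : ℝ)|)) = 1 / |(y : ℝ)| ^ 4 := by
    rw [show (4 : ℝ) * Real.log |(y : ℝ)| = (4 : ℕ) * Real.log |(y : ℝ)| by norm_num, Real.exp_neg,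
      Real.exp_nat_mul, Real.exp_log hy0, one_div]
  have hbk : 1.45 * |(y : ℝ)| ≤ |(x : ℝ) - rt k * y| := by
    refine le_trans ?_ h1
    nlinarith [hd'.1]
  have hbk0 : (x : ℝ) - rt k * y ≠ 0 := by
    rw [← abs_pos]
    linarith
  have hij0 : rt i - rt j ≠ 0 := sub_ne_zero.2 fun h0 => hij (rt_injective h0)
  have heq : (rt k - rt j) * ((x : ℝ) - rt i * y) / ((rt i - rt j) * ((x : ℝ) - rt k * y)) - 1 =
      (rt k - rt i) * ((x : ℝ) - rt j * y) / ((rt i - rt j) * ((x : ℝ) - rt k * y)) := by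
    field_simp
    ring
  rw [heq, hexp, abs_div, abs_mul, abs_mul, mul_one_div]
  generalize |(x : ℝ) - rt j * y| = bj at *
  generalize |(x : ℝ) - rt k * y| = bk at *
  generalize |(y : ℝ)| = Y at *
  generalize |rt k - rt i| = d1 at *
  generalize |rt i - rt j| = d2 at *
  norm_num at hd hd2 hbk
  rw [div_le_div_iff₀ (by nlinarith) (by positivity)]
  calc d1 * bj * Y ^ 4 = d1 * (bj * Y ^ 3) * Y := by ring
    _ ≤ 68 / 5 * 3 * Y := by
      have : d1 * (bj * Y ^ 3) ≤ 68 / 5 * 3 := (mul_le_mul_of_nonneg_left h2 (by linarith)).trans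
        (mul_le_mul_of_nonneg_right hd2.2 (by norm_num))
      exact mul_le_mul_of_nonneg_right this hy0.le
    _ ≤ 10 * (29 / 10 * (29 / 20 * Y)) := by linarith
    _ ≤ 10 * (d2 * bk) := by
      have : 29 / 10 * (29 / 20 * Y) ≤ d2 * bk := mul_le_mul hd.1 hbk (by positivity) (by linarith)
      linarith

end

theorem abs_ev_inv_pow_mul {j i k : Fin 4} {e e' : ℤ × ℤ × ℤ × ℤ}
    (he : ∀ i, Real.log |ev (rt i) e| = etaLog j i) (hee : ∀ i, ev (rt i) e * ev (rt i) e' = 1) :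
    |ev (rt k) e * ev (rt i) e'| = Real.exp (etaLog j k - etaLog j i) := by
  have h0 : ∀ i, ev (rt i) e ≠ 0 := fun i => left_ne_zero_of_mul_eq_one (hee i)
  rw [eq_inv_of_mul_eq_one_right (hee i), abs_mul, abs_inv, Real.exp_sub, ← he, ← he,
    Real.exp_log (abs_pos.2 (h0 k)), Real.exp_log (abs_pos.2 (h0 i)), div_eq_mul_inv]

/-- There are no solutions with `10 ^ 67 ≤ log |y|`. -/
theorem false_of_le_log {x y m : ℤ} {j : Fin 4} (hF : ∏ i, ((x : ℝ) - rt i * y) = m) (hm : m ≠ 0)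
    (hm36 : |m| ≤ 36) (hnear : IsNearest x y j) (hY : 10 ^ 67 ≤ Real.log |(y : ℝ)|) : False := by
  obtain ⟨hT, hT'⟩ := etaSize_bounds j
  have hT0 : 0 < etaSize j := by linarith
  have hy : 2 ≤ |y| := by
    by_contra h
    have h1 : |y| ≤ 1 := by omega
    have h2 : |(y : ℝ)| ≤ 1 := by exact_mod_cast h1
    have := Real.log_nonpos (abs_nonneg _) h2
    linarith
  set r : ℕ := ⌊Real.log |(y : ℝ)| / etaSize j⌋₊ with hrdef
  have hr1 : r * etaSize j ≤ Real.log |(y : ℝ)| := by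
    rw [← le_div_iff₀ hT0]
    exact Nat.floor_le (div_nonneg (by linarith) hT0.le)
  have hr2 : Real.log |(y : ℝ)| ≤ (r + 1) * etaSize j := by
    rw [← div_le_iff₀ hT0]
    exact (Nat.lt_floor_add_one _).le
  have hr3 : (158 * 10 ^ 38 : ℝ) ≤ r := by
    have h1 : ((r : ℝ) + 1) * etaSize j ≤ (r + 1) * (621 * 10 ^ 24) := by gcongr
    linarith
  clear_value r
  obtain ⟨e, e', he, hee⟩ := exists_eta j
  have hE0 : ∀ i, ev (rt i) e ≠ 0 := fun i => left_ne_zero_of_mul_eq_one (hee i)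
  obtain ⟨i, k, hik, hij, hkj, hs⟩ := exists_pair (fun i => decide (0 < ev (rt i) e)) j
  have hm' : (m : ℝ) ≠ 0 := by exact_mod_cast hm
  have hne : ∀ i, (x : ℝ) - rt i * y ≠ 0 := fun i h0 => by
    rw [Finset.prod_eq_zero (Finset.mem_univ i) h0] at hF
    exact hm' hF.symm
  have hrt : ∀ {i j}, i ≠ j → rt i - rt j ≠ 0 := fun h => sub_ne_zero.2 fun h0 => h (rt_injective h0)
  let G : Fin 4 → Fin 4 → Fin 4 → rootField := fun i j k =>
    (rtL k - rtL j) * ((x : rootField) - rtL i * y) * (ev (rtL k) e * ev (rtL i) e') ^ r /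
      ((rtL i - rtL j) * ((x : rootField) - rtL k * y))
  have hφG : ∀ i j k, algebraMap rootField ℝ (G i j k) =
      (rt k - rt j) * ((x : ℝ) - rt i * y) * (ev (rt k) e * ev (rt i) e') ^ r /
        ((rt i - rt j) * ((x : ℝ) - rt k * y)) := by
    intro i j k
    simp only [G, map_div₀, map_mul, map_sub, map_pow, map_intCast, algebraMap_rtL, algebraMap_ev_rtL]
  have hpos : 0 < ev (rt k) e * ev (rt i) e' := by
    rw [eq_inv_of_mul_eq_one_right (hee i), ← div_eq_mul_inv]
    by_cases hi0 : 0 < ev (rt i) e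
    · have hk0 : 0 < ev (rt k) e := by simpa [hi0] using hs
      exact div_pos hk0 hi0
    · have hk0 : ¬ 0 < ev (rt k) e := by simpa [hi0] using hs
      exact div_pos_of_neg_of_neg (lt_of_le_of_ne (not_lt.1 hk0) (hE0 k))
        (lt_of_le_of_ne (not_lt.1 hi0) (hE0 i))
  have hω : ev (rt k) e * ev (rt i) e' = Real.exp (etaLog j k - etaLog j i) := by
    rw [← abs_ev_inv_pow_mul he hee, abs_of_pos hpos]
  refine false_of_close_power_of_large (algebraMap rootField ℝ) card_aut_le (T := etaSize j)
    (ω := ev (rtL k) e * ev (rtL i) e') (g := G i j k) (r := r) (d := 4019825664 * m.natAbs)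
    (w := etaLog j k - etaLog j i)
    (ξ := (rt k - rt j) * ((x : ℝ) - rt i * y) / ((rt i - rt j) * ((x : ℝ) - rt k * y)))
    ?_ ?_ ?_ ?_ ?_ ?_ ?_ ?_ ?_ hr3 hT (by linarith) ?_ ?_ ?_
  · have : 0 < m.natAbs := Int.natAbs_pos.2 hm
    omega
  · exact (isIntegral_ev (quartic_rtL k) e).mul (isIntegral_ev (quartic_rtL i) e')
  · have h1 := isIntegral_disc_div hij
    have h2 := isIntegral_div_sub_rtL_mul hF hm k
    have h3 := isIntegral_sub_rtL_mul x y i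
    have h4 := ((isIntegral_ev (quartic_rtL k) e).mul (isIntegral_ev (quartic_rtL i) e')).pow r
    have h5 := (isIntegral_of_quartic (quartic_rtL k)).sub (isIntegral_of_quartic (quartic_rtL j))
    have h6 := (((h1.mul h2).mul h5).mul h3).mul h4
    have heq : ((4019825664 * m : ℤ) : rootField) * G i j k = 4019825664 / (rtL i - rtL j) *
        (m / ((x : rootField) - rtL k * y)) * (rtL k - rtL j) * ((x : rootField) - rtL i * y) *
        (ev (rtL k) e * ev (rtL i) e') ^ r := by
      simp only [G, div_eq_mul_inv, mul_inv]
      push_cast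
      ring
    rw [← heq] at h6
    have hd : ((4019825664 * m.natAbs : ℕ) : rootField) =
        ((4019825664 * (m.natAbs : ℤ) : ℤ) : rootField) := by
      rw [← Int.cast_natCast, Nat.cast_mul]
      rfl
    rw [hd]
    rcases Int.natAbs_eq m with hm2 | hm2
    · rwa [← hm2]
    · rw [show (m.natAbs : ℤ) = -m by omega, mul_neg, Int.cast_neg, neg_mul]
      exact h6.neg
  · intro h0
    have h1 := hφG i j k
    rw [h0, map_zero] at h1
    exact div_ne_zero (mul_ne_zero (mul_ne_zero (hrt hkj) (hne i)) (pow_ne_zero _ hpos.ne'))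
      (mul_ne_zero (hrt hij) (hne k)) h1.symm
  · exact sub_ne_zero.2 (etaLog_ne hkj hij hik.symm)
  · rw [map_mul, algebraMap_ev_rtL, algebraMap_ev_rtL, hω]
  · rw [hφG, hω, ← Real.exp_nat_mul, mul_comm (etaLog j k - etaLog j i)]
    ring
  · intro σ
    obtain ⟨π, hπ⟩ := exists_perm σ
    rw [map_mul, map_ev_rtL hπ, map_ev_rtL hπ, map_mul, algebraMap_ev_rtL, algebraMap_ev_rtL,
      abs_ev_inv_pow_mul he hee, Real.exp_le_exp]
    exact etaLog_sub_le fun h => hik (π.injective h).symm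
  · intro σ
    obtain ⟨π, hπ⟩ := exists_perm σ
    have hσ : σ (G i j k) = G (π i) (π j) (π k) := by
      simp only [G, map_div₀, map_mul, map_sub, map_pow, map_intCast, hπ, map_ev_rtL hπ]
    have hπi : π i ≠ π j := fun h => hij (π.injective h)
    have hπk : π k ≠ π j := fun h => hkj (π.injective h)
    have hL := hnear.log_sub_etaLog_sub_le hy hF hm hm36 hr1 hr2 (p := π i) (q := π k)
      fun h => hik (π.injective h)
    rw [hσ, hφG]
    generalize π i = i at *
    generalize π k = k at *
    generalize π j = l at *
    have hdi := abs_sub_rt_mem hπi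
    have hdk := abs_sub_rt_mem hπk
    have hratio : |rt k - rt l| / |rt i - rt l| ≤ Real.exp 2 := by
      have h1 : |rt k - rt l| / |rt i - rt l| ≤ 5 := by
        rw [div_le_iff₀ (by linarith [hdi.1])]
        linarith [hdi.1, hdk.2]
      have h2 : (5 : ℝ) ≤ Real.exp 2 := by
        have h3 : Real.exp 2 = Real.exp 1 ^ 2 := by rw [← Real.exp_nat_mul]; norm_num
        have h4 := Real.exp_one_gt_d9
        rw [h3]
        nlinarith
      exact h1.trans h2
    have heq : |(rt k - rt l) * ((x : ℝ) - rt i * y) * (ev (rt k) e * ev (rt i) e') ^ r /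
        ((rt i - rt l) * ((x : ℝ) - rt k * y))| = |rt k - rt l| / |rt i - rt l| *
        Real.exp ((Real.log |(x : ℝ) - rt i * y| - r * etaLog j i) -
          (Real.log |(x : ℝ) - rt k * y| - r * etaLog j k)) := by
      rw [abs_div, abs_mul, abs_mul, abs_mul, abs_pow, abs_ev_inv_pow_mul he hee,
        ← Real.exp_nat_mul, show (Real.log |(x : ℝ) - rt i * y| - r * etaLog j i) -
          (Real.log |(x : ℝ) - rt k * y| - r * etaLog j k) = Real.log |(x : ℝ) - rt i * y| -
          Real.log |(x : ℝ) - rt k * y| + r * (etaLog j k - etaLog j i) by ring, Real.exp_add,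
        Real.exp_sub, Real.exp_log (abs_pos.2 (hne i)), Real.exp_log (abs_pos.2 (hne k))]
      ring
    rw [heq, show 4 * etaSize j + 16 / 10 ^ 13 * r + 18 =
      2 + (4 * etaSize j + 16 / 10 ^ 13 * r + 16) by ring, Real.exp_add]
    exact mul_le_mul hratio (Real.exp_le_exp.2 hL) (Real.exp_pos _).le (Real.exp_pos _).le
  · refine log_le_twentysix ?_ ?_
    · have : 0 < m.natAbs := Int.natAbs_pos.2 hm
      positivity
    · have h1 : m.natAbs ≤ 36 := by
        rw [Int.abs_eq_natAbs] at hm36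
        omega
      have h2 : (m.natAbs : ℝ) ≤ 36 := by exact_mod_cast h1
      rw [Nat.cast_mul, Nat.cast_ofNat]
      linarith
  · have h1 := abs_le.1 (abs_etaLog_sub_le hij)
    have h2 := abs_le.1 (abs_etaLog_sub_le hkj)
    rw [abs_le]
    constructor <;> linarith [h1.1, h1.2, h2.1, h2.2]
  · refine (hnear.abs_ratio_sub_one_le hy hij hkj hik).trans ?_
    refine mul_le_mul_of_nonneg_left (Real.exp_le_exp.2 ?_) (by norm_num)
    linarith

/-- The binary quartic form. -/
def form (x y : ℤ) : ℤ := x ^ 4 - 9 * x ^ 3 * y - 21 * x ^ 2 * y ^ 2 + 88 * x * y ^ 3 + 48 * y ^ 4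

theorem form_emod (n x y : ℤ) : form (x % n) (y % n) % n = form x y % n := by
  have hx : x % n ≡ x [ZMOD n] := Int.mod_modEq x n
  have hy : y % n ≡ y [ZMOD n] := Int.mod_modEq y n
  exact (((((hx.pow 4).sub (((hx.pow 3).mul_left 9).mul hy)).sub
    (((hx.pow 2).mul_left 21).mul (hy.pow 2))).add ((hx.mul_left 88).mul (hy.pow 3))).add
      ((hy.pow 4).mul_left 48))

/-- Properties of a pair modulo `n` and the value of the form modulo `n` can be checked on
residues. -/
theorem of_residues {n : ℕ} (hn : 0 < n) {p : ℤ → ℤ → ℤ → Prop}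
    (h : ∀ a < n, ∀ b < n, p a b (form a b % n)) (x y : ℤ) : p (x % n) (y % n) (form x y % n) := by
  have hn' : (n : ℤ) ≠ 0 := by exact_mod_cast hn.ne'
  have hn0 : (0 : ℤ) < n := by exact_mod_cast hn
  have := h (x % n).toNat (by have := Int.emod_lt_of_pos x hn0; omega) (y % n).toNat
    (by have := Int.emod_lt_of_pos y hn0; omega)
  rwa [Int.toNat_of_nonneg (Int.emod_nonneg x hn'), Int.toNat_of_nonneg (Int.emod_nonneg y hn'),
    form_emod] at this

theorem not_dvd_and_dvd {x y : ℤ} (h : Int.gcd x y = 1) {p : ℕ} (hp : 2 ≤ p) :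
    ¬ (x % p = 0 ∧ y % p = 0) := fun ⟨h1, h2⟩ => by
  have h3 := Int.dvd_coe_gcd (Int.dvd_of_emod_eq_zero h1) (Int.dvd_of_emod_eq_zero h2)
  rw [h] at h3
  have := Int.le_of_dvd (by norm_num) h3
  omega

theorem form_emod_ne_zero {x y : ℤ} (h : Int.gcd x y = 1) {p : ℕ} (hp : 2 ≤ p)
    (hd : ∀ a < p, ∀ b < p, form a b % p = 0 → (a : ℤ) = 0 ∧ (b : ℤ) = 0) :
    form x y % p ≠ 0 := fun h0 =>
  not_dvd_and_dvd h hp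
    (of_residues (p := fun a b c => c = 0 → a = 0 ∧ b = 0) (by omega) hd x y h0)

/-- Norms of the representatives. -/
def reprNorm : Fin 15 → ℤ := ![1, 3, 3, 4, 7, 9, 13, 17, 17, 21, 21, 23, 23, 27, 31]

/-- Residues of `α` modulo the representatives. -/
def reprRes : Fin 15 → ℤ := ![0, 0, 2, 2, 2, 6, 3, 12, 16, 2, 9, 6, 8, 24, 29]

theorem abs_mem_of_emod {v : ℤ} (h : |v| ≤ 36) (h5 : v % 5 ≠ 0) (h11 : v % 11 ≠ 0)
    (h19 : v % 19 ≠ 0) (h29 : v % 29 ≠ 0)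
    (h128 : v % 2 = 0 → v % 128 = 4 ∨ v % 128 = 20 ∨ 36 < v % 128 ∧ v % 128 < 92 ∨ v % 128 = 0) :
    |v| ∈ [1, 3, 4, 7, 9, 13, 17, 21, 23, 27, 31] := by
  obtain ⟨h1, h2⟩ := abs_le.1 h
  interval_cases v <;> simp_all

theorem four_dvd_of_form {x y : ℤ} (h : Int.gcd x y = 1) (hF : |form x y| = 4) : 4 ∣ x - 2 * y := by
  have h1 := of_residues (n := 16)
    (p := fun a b c => c = 4 ∨ c = 12 → (a % 2 = 0 ∧ b % 2 = 0) ∨ (a - 2 * b) % 4 = 0)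
      (by norm_num) (by decide +kernel) x y
  have h2 := not_dvd_and_dvd h (p := 2) le_rfl
  rcases (abs_eq (by norm_num)).1 hF with h | h <;> rw [h] at h1 <;> push_cast at h1 h2 <;>
    have := h1 (by decide) <;> omega

theorem nine_dvd_of_form {x y : ℤ} (h : Int.gcd x y = 1) (hF : |form x y| = 9) : 9 ∣ x - 6 * y := by
  have h1 := of_residues (n := 27)
    (p := fun a b c => c = 9 ∨ c = 18 → (a % 3 = 0 ∧ b % 3 = 0) ∨ (a - 6 * b) % 9 = 0)
      (by norm_num) (by decide +kernel) x y
  have h2 := not_dvd_and_dvd h (p := 3) (by norm_num)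
  rcases (abs_eq (by norm_num)).1 hF with h | h <;> rw [h] at h1 <;> push_cast at h1 h2 <;>
    have := h1 (by decide) <;> omega

theorem twentyseven_dvd_of_form {x y : ℤ} (h : Int.gcd x y = 1) (hF : |form x y| = 27) :
    27 ∣ x - 24 * y := by
  have h1 := of_residues (n := 81)
    (p := fun a b c => c = 27 ∨ c = 54 → (a % 3 = 0 ∧ b % 3 = 0) ∨ (a - 24 * b) % 27 = 0)
      (by norm_num) (by decide +kernel) x y
  have h2 := not_dvd_and_dvd h (p := 3) (by norm_num)
  rcases (abs_eq (by norm_num)).1 hF with h | h <;> rw [h] at h1 <;> push_cast at h1 h2 <;>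
    have := h1 (by decide) <;> omega

/-- A divisor of the value of the form divides one of finitely many linear forms. -/
theorem dvd_or_dvd_of_form {n : ℕ} (hn : 0 < n) {s t : ℤ}
    (hd : ∀ a < n, ∀ b < n, form a b % n = 0 → ((a : ℤ) - s * b) % n = 0 ∨ ((a : ℤ) - t * b) % n = 0)
    {x y : ℤ} (hF : |form x y| = n) : (n : ℤ) ∣ x - s * y ∨ (n : ℤ) ∣ x - t * y := by
  have h1 := of_residues (p := fun a b c => c = 0 → (a - s * b) % n = 0 ∨ (a - t * b) % n = 0)
    hn hd x y
  have h2 : form x y % n = 0 := Int.emod_eq_zero_of_dvd ((dvd_abs _ _).1 (by rw [hF]))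
  have h3 : ∀ s : ℤ, (x % n - s * (y % n)) % n = 0 → (n : ℤ) ∣ x - s * y := fun s hs =>
    Int.dvd_of_emod_eq_zero (by rw [← hs]; exact (((Int.mod_modEq x n).sub
      ((Int.mod_modEq y n).mul_left s)).symm : _ ≡ _ [ZMOD n]))
  exact (h1 h2).imp (h3 s) (h3 t)

/-- The congruences satisfied by coprime pairs at which the form is small. -/
theorem exists_repr {x y : ℤ} (h : Int.gcd x y = 1) (hF : |form x y| ≤ 36) :
    ∃ m, |form x y| = reprNorm m ∧ reprNorm m ∣ x - reprRes m * y := by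
  have h5 := form_emod_ne_zero h (p := 5) (by norm_num) (by decide +kernel)
  have h11 := form_emod_ne_zero h (p := 11) (by norm_num) (by decide +kernel)
  have h19 := form_emod_ne_zero h (p := 19) (by norm_num) (by decide +kernel)
  have h29 := form_emod_ne_zero h (p := 29) (by norm_num) (by decide +kernel)
  have h128 := of_residues (n := 128)
    (p := fun a b c => a % 2 = 0 ∧ b % 2 = 1 → c = 4 ∨ c = 20 ∨ 36 < c ∧ c < 92 ∨ c = 0)
    (by norm_num) (by decide +kernel) x y
  have h2 := of_residues (n := 2) (p := fun a b c => c = 0 → a = 0) (by norm_num)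
    (by decide +kernel) x y
  have hx2 := not_dvd_and_dvd h (p := 2) le_rfl
  push_cast at h2 h5 h11 h19 h29 h128 hx2
  have hv := abs_mem_of_emod hF h5 h11 h19 h29 fun h0 => by
    have := h128 (by omega)
    omega
  simp only [List.mem_cons, List.not_mem_nil, or_false] at hv
  rcases hv with hv | hv | hv | hv | hv | hv | hv | hv | hv | hv | hv
  · exact ⟨0, hv, one_dvd _⟩
  · rcases dvd_or_dvd_of_form (n := 3) (s := 0) (t := 2) (by norm_num) (by decide +kernel) hv
      with h | h
    exacts [⟨1, hv, h⟩, ⟨2, hv, h⟩]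
  · exact ⟨3, hv, four_dvd_of_form h hv⟩
  · rcases dvd_or_dvd_of_form (n := 7) (s := 2) (t := 2) (by norm_num) (by decide +kernel) hv
      with h | h <;> exact ⟨4, hv, h⟩
  · exact ⟨5, hv, nine_dvd_of_form h hv⟩
  · rcases dvd_or_dvd_of_form (n := 13) (s := 3) (t := 3) (by norm_num) (by decide +kernel) hv
      with h | h <;> exact ⟨6, hv, h⟩
  · rcases dvd_or_dvd_of_form (n := 17) (s := 12) (t := 16) (by norm_num) (by decide +kernel) hv
      with h | h
    exacts [⟨7, hv, h⟩, ⟨8, hv, h⟩]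
  · rcases dvd_or_dvd_of_form (n := 21) (s := 2) (t := 9) (by norm_num) (by decide +kernel) hv
      with h | h
    exacts [⟨9, hv, h⟩, ⟨10, hv, h⟩]
  · rcases dvd_or_dvd_of_form (n := 23) (s := 6) (t := 8) (by norm_num) (by decide +kernel) hv
      with h | h
    exacts [⟨11, hv, h⟩, ⟨12, hv, h⟩]
  · exact ⟨13, hv, twentyseven_dvd_of_form h hv⟩
  · rcases dvd_or_dvd_of_form (n := 31) (s := 29) (t := 29) (by norm_num) (by decide +kernel) hv
      with h | h <;> exact ⟨14, hv, h⟩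

/-- Quotients of `ρ - α` by the representatives. -/
def reprQuotRoot : Fin 15 → ℤ × ℤ × ℤ × ℤ :=
  ![(0, -1, 0, 0),
    (-4, -8, -5, 8),
    (2, 4, 1, 0),
    (19, 39, 16, -17),
    (-10, -18, -11, 18),
    (2, 3, -3, 2),
    (-7, -13, -8, 13),
    (324, -307, -170, 144),
    (-344, 5, 178, -128),
    (66, 116, -179, 122),
    (27, 0, -3, 2),
    (122, 179, -287, 196),
    (8, 7, -12, 8),
    (-16, -7, -32, 24),
    (-259, -476, -297, 491)]

/-- Quotients of the norms by the representatives. -/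
def reprQuotNorm : Fin 15 → ℤ × ℤ × ℤ × ℤ :=
  ![(1, 0, 0, 0),
    (3, 2, 1, -2),
    (-11, -24, -9, 8),
    (-86, -182, -70, 66),
    (7, 14, 9, -15),
    (3, 5, -2, 1),
    (15, 28, 16, -25),
    (395, -514, -268, 230),
    (-347, 16, 166, -120),
    (203, 462, -681, 463),
    (63, 7, -4, 2),
    (297, 437, -700, 478),
    (15, 8, -28, 22),
    (-21, -14, -34, 26),
    (-433, -797, -494, 813)]

theorem mulVec_reprQuotRoot (m : Fin 15) :
    mulVec (reprVec m) (reprQuotRoot m) = (reprRes m, -1, 0, 0) := by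
  revert m
  decide +kernel

theorem mulVec_reprQuotNorm (m : Fin 15) :
    mulVec (reprVec m) (reprQuotNorm m) = (reprNorm m, 0, 0, 0) := by
  revert m
  decide +kernel

theorem abs_prod_ev_reprVec (m : Fin 15) : |∏ i, ev (rt i) (reprVec m)| = reprNorm m := by
  have h : ∀ m : Fin 15, 0 ≤ reprNorm m ∧ ∃ s : Fin 2, Encl.within (Encl.mul (Encl.mul (Encl.evI 0 (reprVec m))
      (Encl.evI 1 (reprVec m))) (Encl.mul (Encl.evI 2 (reprVec m)) (Encl.evI 3 (reprVec m))))
      (2 * (![1, -1] s * reprNorm m) - 1) (2 * (![1, -1] s * reprNorm m) + 1) 2 = true := by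
    decide +kernel
  obtain ⟨h0, s, hs⟩ := h m
  rw [prod_ev_eq hs]
  have h1 : |(![1, -1] s : ℤ)| = 1 := by fin_cases s <;> rfl
  rw [← Int.cast_abs, abs_mul, h1, abs_of_nonneg h0, one_mul]

theorem form_eq_prod (x y : ℤ) : (form x y : ℝ) = ∏ i, ((x : ℝ) - rt i * y) := by
  rw [← quartic_eq_prod quartic_rt rt_injective, form]
  push_cast
  rfl

theorem reprNorm_pos (m : Fin 15) : 0 < reprNorm m := by
  revert m
  decide

theorem exists_isAssociated {x y : ℤ} {m : Fin 15} (h : |form x y| = reprNorm m)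
    (hd : reprNorm m ∣ x - reprRes m * y) : ∃ c, IsAssociated x y m c := by
  obtain ⟨z, hz⟩ := hd
  refine ⟨(y * (reprQuotRoot m).1 + z * (reprQuotNorm m).1,
    y * (reprQuotRoot m).2.1 + z * (reprQuotNorm m).2.1,
    y * (reprQuotRoot m).2.2.1 + z * (reprQuotNorm m).2.2.1,
    y * (reprQuotRoot m).2.2.2 + z * (reprQuotNorm m).2.2.2), ?_⟩
  have h1 : ∀ i, (x : ℝ) - rt i * y = ev (rt i) (reprVec m) *
      ev (rt i) (y * (reprQuotRoot m).1 + z * (reprQuotNorm m).1,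
        y * (reprQuotRoot m).2.1 + z * (reprQuotNorm m).2.1,
        y * (reprQuotRoot m).2.2.1 + z * (reprQuotNorm m).2.2.1,
        y * (reprQuotRoot m).2.2.2 + z * (reprQuotNorm m).2.2.2) := fun i => by
    have h2 := ev_mulVec (quartic_rt i) (reprVec m) (reprQuotRoot m)
    have h3 := ev_mulVec (quartic_rt i) (reprVec m) (reprQuotNorm m)
    rw [mulVec_reprQuotRoot] at h2
    rw [mulVec_reprQuotNorm] at h3
    have hz' : (x : ℝ) - reprRes m * y = reprNorm m * z := by exact_mod_cast hz
    simp only [ev] at h2 h3 ⊢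
    push_cast at h2 h3 ⊢
    linear_combination (y : ℝ) * h2 + z * h3 + hz'
  refine ⟨h1, ?_⟩
  have h4 : |(form x y : ℝ)| = reprNorm m := by exact_mod_cast h
  rw [form_eq_prod, Finset.prod_congr rfl fun i _ => h1 i, Finset.prod_mul_distrib, abs_mul,
    abs_prod_ev_reprVec] at h4
  have h5 : (reprNorm m : ℝ) ≠ 0 := by exact_mod_cast (reprNorm_pos m).ne'
  exact mul_left_cancel₀ h5 (by rw [h4, mul_one])

theorem abs_lt_of_form {x y : ℤ} (h : Int.gcd x y = 1) (hF : |form x y| ≤ 36) : |y| < 1000 := by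
  by_contra hy
  push Not at hy
  obtain ⟨m, hm, hd⟩ := exists_repr h hF
  obtain ⟨c, hc⟩ := exists_isAssociated hm hd
  have hy0 : y ≠ 0 := by
    rintro rfl
    norm_num at hy
  obtain ⟨j, hj⟩ := exists_isNearest hy0 (by rw [← form_eq_prod]; exact_mod_cast hF)
  rcases le_total (Real.log |(y : ℝ)|) (10 ^ 67) with hY | hY
  · exact false_of_isAssociated_of_log_le hj hc hy hY
  · refine false_of_le_log (form_eq_prod x y).symm ?_ hF hj hY
    rw [← abs_pos, hm]
    exact reprNorm_pos m

/-- Pairs where the form is small. -/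
def solutions : List (ℤ × ℤ) :=
  [(0, 0), (1, 0), (1, -2), (2, 0), (2, -4), (-1, 0), (-1, 2), (-2, 0), (-2, 4)]

/-- The form is large at the given pair, or the pair is listed. -/
def LargeOrListed (x y : ℤ) : Prop := 36 < (form x y).natAbs ∨ (x, y) ∈ solutions

instance (x y : ℤ) : Decidable (LargeOrListed x y) :=
  inferInstanceAs (Decidable (36 < (form x y).natAbs ∨ (x, y) ∈ solutions))

theorem LargeOrListed.mem {x y : ℤ} (h : LargeOrListed x y) (hF : |form x y| ≤ 36) :
    (x, y) ∈ solutions := h.resolve_left (by rw [Int.abs_eq_natAbs] at hF; omega)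

/-- Lower bounds for the roots, multiplied by `10 ^ 4`. -/
def rootFloor : Fin 4 → ℤ := ![-34272, -4994, 27581, 101684]

theorem rootFloor_le (j : Fin 4) : rootFloor j ≤ 10000 * rt j ∧ 10000 * rt j ≤ rootFloor j + 1 := by
  have h0 := rt_zero_bounds
  have h1 := rt_one_bounds
  have h2 := rt_two_bounds
  have h3 := rt_three_bounds
  norm_num at h0 h1 h2 h3
  fin_cases j <;> simp [rootFloor] <;> constructor <;> linarith

theorem mem_solutions_of_two_le {x y : ℤ} (hF : |form x y| ≤ 36) (hy : 2 ≤ y) (hy' : y < 1000) :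
    (x, y) ∈ solutions := by
  have hc : ∀ j : Fin 4, ∀ n : ℕ, n < 1000 → 2 ≤ n → ∀ k : ℕ, k < 2 →
      LargeOrListed (rootFloor j * n / 10000 + k) n := by
    decide +kernel
  have hF' : |(form x y : ℝ)| ≤ 36 := by exact_mod_cast hF
  rw [form_eq_prod] at hF'
  have hy0 : y ≠ 0 := by omega
  obtain ⟨j, hj⟩ := exists_isNearest hy0 hF'
  obtain ⟨h1, h2⟩ := rootFloor_le j
  have hy2 : (2 : ℝ) ≤ y := by exact_mod_cast hy
  have hy3 : (y : ℝ) < 1000 := by exact_mod_cast hy'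
  have h3 := hj.abs_mul_le
  rw [abs_of_pos (by linarith : (0 : ℝ) < y)] at h3
  have h4 : (2 : ℝ) ^ 3 ≤ y ^ 3 := by gcongr
  have h5 : |(x : ℝ) - rt j * y| ≤ 3 / 8 := by
    have := mul_le_mul_of_nonneg_left h4 (abs_nonneg ((x : ℝ) - rt j * y))
    linarith
  obtain ⟨h6, h7⟩ := abs_le.1 h5
  have h8 : (rootFloor j * y - 3750 : ℝ) ≤ 10000 * x := by nlinarith
  have h9 : (10000 * x : ℝ) ≤ rootFloor j * y + 4750 := by nlinarith
  have h10 : rootFloor j * y - 3750 ≤ 10000 * x := by exact_mod_cast h8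
  have h11 : 10000 * x ≤ rootFloor j * y + 4750 := by exact_mod_cast h9
  have h12 := hc j y.toNat (by omega) (by omega) (x - rootFloor j * y / 10000).toNat
  rw [Int.toNat_of_nonneg (by omega : 0 ≤ y), Int.toNat_of_nonneg (by omega)] at h12
  rw [add_sub_cancel] at h12
  exact (h12 (by omega)).mem hF

theorem mem_solutions_of_lt {x y : ℤ} (hF : |form x y| ≤ 36) (hy : 0 ≤ y) (hy' : y < 1000) :
    (x, y) ∈ solutions := by
  rcases lt_or_ge y 2 with h | h
  · have hx : -20 < x ∧ x < 20 := by
      rw [abs_le] at hF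
      unfold form at hF
      obtain rfl | rfl : y = 0 ∨ y = 1 := by omega
      · constructor <;> nlinarith [sq_nonneg (x ^ 2 - 20), sq_nonneg (x ^ 2)]
      · constructor
        · by_contra hx
          nlinarith [sq_nonneg (x ^ 2), mul_nonneg (by omega : 0 ≤ -x - 20) (sq_nonneg x), sq_nonneg x, sq_nonneg (x ^ 2 - 5 * x)]
        · by_contra hx
          nlinarith [sq_nonneg (x ^ 2), mul_nonneg (by omega : 0 ≤ x - 20) (sq_nonneg x), sq_nonneg x, sq_nonneg (x ^ 2 - 5 * x)]
    have hc : ∀ y : ℕ, y < 2 → ∀ x : ℕ, x < 40 → LargeOrListed (x - 20) y := by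
      decide +kernel
    have h1 := hc y.toNat (by omega) (x + 20).toNat (by omega)
    rw [Int.toNat_of_nonneg hy, Int.toNat_of_nonneg (by omega), add_sub_cancel_right] at h1
    exact h1.mem hF
  · exact mem_solutions_of_two_le hF h hy'

theorem form_neg (x y : ℤ) : form (-x) (-y) = form x y := by
  unfold form
  ring

theorem neg_mem_solutions {x y : ℤ} (h : (-x, -y) ∈ solutions) : (x, y) ∈ solutions := by
  have hc : ∀ p ∈ solutions, (-p.1, -p.2) ∈ solutions := by decide
  simpa using hc _ h

theorem mem_solutions_of_gcd_eq_one {x y : ℤ} (h : Int.gcd x y = 1) (hF : |form x y| ≤ 36) :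
    (x, y) ∈ solutions := by
  have h1 := abs_lt.1 (abs_lt_of_form h hF)
  rcases le_total 0 y with hy | hy
  · exact mem_solutions_of_lt hF hy h1.2
  · exact neg_mem_solutions (mem_solutions_of_lt (by rwa [form_neg]) (by omega) (by omega))

theorem mem_solutions {x y : ℤ} (hF : |form x y| ≤ 36) : (x, y) ∈ solutions := by
  rcases Nat.eq_zero_or_pos (Int.gcd x y) with h0 | h0
  · obtain ⟨rfl, rfl⟩ := Int.gcd_eq_zero_iff.1 h0
    decide
  obtain ⟨a, b, hab, hx, hy⟩ := Int.exists_gcd_one (m := x) (n := y) h0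
  have hd : (0 : ℤ) < Int.gcd x y := by exact_mod_cast h0
  generalize ((Int.gcd x y : ℕ) : ℤ) = d at hx hy hd
  subst hx hy
  have h1 : form (a * d) (b * d) = d ^ 4 * form a b := by
    unfold form
    ring
  rw [h1, abs_mul, abs_of_pos (by positivity)] at hF
  have h2 : |form a b| ≤ 36 := by
    refine le_trans ?_ hF
    exact le_mul_of_one_le_left (abs_nonneg _) (one_le_pow₀ (by omega))
  have h3 : 1 ≤ |form a b| := by
    obtain ⟨m, hm, -⟩ := exists_repr hab h2
    rw [hm]
    exact reprNorm_pos m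
  have h4 : d < 3 := by
    by_contra hd3
    have h5 : (3 : ℤ) ^ 4 ≤ d ^ 4 := by gcongr; omega
    nlinarith
  have h5 := mem_solutions_of_gcd_eq_one hab h2
  obtain rfl | rfl : d = 1 ∨ d = 2 := by omega
  · rwa [mul_one, mul_one]
  · simp only [solutions, List.mem_cons, Prod.mk.injEq, List.not_mem_nil, or_false] at h5 ⊢
    rcases h5 with h | h | h | h | h | h | h | h | h <;> obtain ⟨rfl, rfl⟩ := h <;>
      first
        | decide
        | exact absurd hab (by decide)

theorem stmt13 (x₁ y₁ : ℤ) :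
    |x₁ ^ 4 - 9 * x₁ ^ 3 * y₁ - 21 * x₁ ^ 2 * y₁ ^ 2 + 88 * x₁ * y₁ ^ 3 + 48 * y₁ ^ 4| ≤ 36 ↔
      ((x₁, y₁) ∈ ({(0, 0), (1, 0), (1, -2), (2, 0), (2, -4)} : Set (ℤ × ℤ)) ∨
       (-x₁, -y₁) ∈ ({(0, 0), (1, 0), (1, -2), (2, 0), (2, -4)} : Set (ℤ × ℤ))) := by
  have hc : ∀ p ∈ solutions, p ∈ [(0, 0), (1, 0), (1, -2), (2, 0), (2, -4)] ∨
      (-p.1, -p.2) ∈ [(0, 0), (1, 0), (1, -2), (2, 0), (2, -4)] := by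
    decide
  have hc' : ∀ p ∈ [(0, 0), (1, 0), (1, -2), (2, 0), (2, -4)], p ∈ solutions := by decide
  have hs : ∀ p ∈ solutions, |form p.1 p.2| ≤ 36 := by decide +kernel
  have hl : ∀ p : ℤ × ℤ, p ∈ ({(0, 0), (1, 0), (1, -2), (2, 0), (2, -4)} : Set (ℤ × ℤ)) ↔
      p ∈ [(0, 0), (1, 0), (1, -2), (2, 0), (2, -4)] := fun p => by
    simp only [Set.mem_insert_iff, Set.mem_singleton_iff, List.mem_cons, List.not_mem_nil, or_false]
  rw [hl, hl]
  refine ⟨fun h => hc _ (mem_solutions h), fun h => hs (x₁, y₁) ?_⟩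
  exact h.elim (fun h => hc' _ h) fun h => neg_mem_solutions (hc' _ h)
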